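/- arXiv:2408.04481 — 2 statements merged into one kernel-verified Lean document; each statement's English description precedes it below -/
import Mathlib

section
/- Let p be an odd prime and N a prime with N ≡ 1 (mod p). Let G = Gal(L/K) act on the ideal class group Cl(L), and let Cl(L)^G denote the subgroup of classes fixed by every element of G. Then rk_p(Cl(L)^G) ≤ rk_p(Cl(K)) + (3/2)(p-1). -/
open NumberField Polynomial
open scoped nonZeroDivisors

/-- The `p`-rank of a finite abelian group `G`: the `𝔽_p`-dimension of `G ⊗ 𝔽_p`,
equivalently of `G[p]`. -/
noncomputable def pRank (p : ℕ) (G : Type*) [Group G] : ℕ :=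
  (Nat.card {g : G // g ^ p = 1}).factorization p

/-- The image of a nonzero ideal of a Dedekind domain under a ring automorphism,
as a nonzero ideal. -/
def Ideal.mapNZ {R : Type*} [CommRing R] [IsDomain R] [IsDedekindDomain R]
    (e : R ≃+* R) (I : (Ideal R)⁰) : (Ideal R)⁰ :=
  ⟨Ideal.map e I.1, mem_nonZeroDivisors_iff_ne_zero.mpr (by
    have hI : (I.1 : Ideal R) ≠ 0 := mem_nonZeroDivisors_iff_ne_zero.mp I.2
    intro h
    exact hI (by
      rwa [Ideal.zero_eq_bot, Ideal.map_eq_bot_iff_of_injective e.injective,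
        ← Ideal.zero_eq_bot] at h))⟩

/-- The class `c` is fixed by the action on the class group induced by the ring
automorphism `e` : the class of the image under `e` of any representative ideal of `c`
is again `c`. -/
def ClassGroup.IsFixedBy {R : Type*} [CommRing R] [IsDomain R] [IsDedekindDomain R]
    (e : R ≃+* R) (c : ClassGroup R) : Prop :=
  ∀ I : (Ideal R)⁰, ClassGroup.mk0 I = c → ClassGroup.mk0 (Ideal.mapNZ e I) = c

lemma card_ptors_eq (p : ℕ) (G : Type*) [CommGroup G] [Finite G] :
    Nat.card {g : G // g ^ p = 1} = Nat.card (G ⧸ (powMonoidHom p : G →* G).range) := by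
  have h1 : Nat.card {g : G // g ^ p = 1} = Nat.card (powMonoidHom p : G →* G).ker :=
    Nat.card_congr (Equiv.subtypeEquivRight (fun g => by simp [MonoidHom.mem_ker]))
  have h2 := (powMonoidHom p : G →* G).ker.card_mul_index
  rw [Subgroup.index_ker] at h2
  have h3 := (powMonoidHom p : G →* G).range.card_mul_index
  rw [h1]
  have h4 : 0 < Nat.card (powMonoidHom p : G →* G).range := Nat.card_pos
  change _ = (powMonoidHom p : G →* G).range.index
  nlinarith

lemma card_sup_closure_le (p : ℕ) (hp : 0 < p) {Q : Type*} [CommGroup Q] [Finite Q]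
    (hQ : ∀ q : Q, q ^ p = 1) (H : Subgroup Q) (S : Finset Q) :
    Nat.card (H ⊔ Subgroup.closure (S : Set Q) : Subgroup Q) ≤ Nat.card H * p ^ S.card := by
  classical
  induction S using Finset.induction_on with
  | empty => simp
  | insert s T hs ih =>
    have h1 : H ⊔ Subgroup.closure ((insert s T : Finset Q) : Set Q) =
        (H ⊔ Subgroup.closure (T : Set Q)) ⊔ Subgroup.zpowers s := by
      rw [Finset.coe_insert, Set.insert_eq, Subgroup.closure_union, ← Subgroup.zpowers_eq_closure,
        sup_comm (Subgroup.zpowers s), sup_assoc]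
    rw [h1, Finset.card_insert_of_notMem hs]
    set H' := H ⊔ Subgroup.closure (T : Set Q)
    have h2 : Nat.card (H' ⊔ Subgroup.zpowers s : Subgroup Q) ≤
        Nat.card (H' × Subgroup.zpowers s) := by
      refine Nat.card_le_card_of_surjective
        (fun x => ⟨x.1.1 * x.2.1, Subgroup.mul_mem_sup x.1.2 x.2.2⟩) ?_
      rintro ⟨y, hy⟩
      obtain ⟨a, ha, b, hb, rfl⟩ := Subgroup.mem_sup.1 hy
      exact ⟨(⟨a, ha⟩, ⟨b, hb⟩), rfl⟩
    have h3 : Nat.card (Subgroup.zpowers s) ≤ p := by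
      rw [Nat.card_zpowers]
      exact orderOf_le_of_pow_eq_one hp (hQ s)
    calc _ ≤ _ := h2
      _ = Nat.card H' * Nat.card (Subgroup.zpowers s) := Nat.card_prod _ _
      _ ≤ (Nat.card H * p ^ T.card) * p := Nat.mul_le_mul ih h3
      _ = _ := by ring

lemma card_ptors_le (p : ℕ) (hp : 0 < p) {V A : Type*} [CommGroup V] [CommGroup A] [Finite V]
    [Finite A] (j : V →* A) (S : Finset A)
    (h : ∀ a : A, a ∈ j.range ⊔ Subgroup.closure (S : Set A) ⊔ (powMonoidHom p : A →* A).range) :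
    Nat.card {a : A // a ^ p = 1} ≤ Nat.card {v : V // v ^ p = 1} * p ^ S.card := by
  classical
  rw [card_ptors_eq, card_ptors_eq]
  set R := (powMonoidHom p : A →* A).range
  set RV := (powMonoidHom p : V →* V).range
  let π := QuotientGroup.mk' R
  have hQ : ∀ q : A ⧸ R, q ^ p = 1 := by
    intro q
    obtain ⟨a, rfl⟩ := QuotientGroup.mk_surjective q
    rw [← QuotientGroup.mk_pow, QuotientGroup.eq_one_iff]
    exact ⟨a, rfl⟩
  have h1 := card_sup_closure_le p hp hQ (π.comp j).range (S.image π)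
  have h2 : ((π.comp j).range ⊔ Subgroup.closure ((S.image π : Finset _) : Set (A ⧸ R))) = ⊤ := by
    rw [eq_top_iff]
    intro q _
    obtain ⟨a, rfl⟩ := QuotientGroup.mk_surjective q
    have ha : π a ∈ Subgroup.map π (j.range ⊔ Subgroup.closure (S : Set A) ⊔ R) :=
      Subgroup.mem_map_of_mem _ (h a)
    rw [Subgroup.map_sup, Subgroup.map_sup, MonoidHom.map_closure, MonoidHom.map_range] at ha
    have hR : Subgroup.map π R = ⊥ := by
      rw [Subgroup.map_eq_bot_iff]; simp [π]
    rw [hR, sup_bot_eq] at ha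
    rw [Finset.coe_image]
    exact ha
  rw [h2] at h1
  have h3 : Nat.card (⊤ : Subgroup (A ⧸ R)) = Nat.card (A ⧸ R) := Subgroup.card_top
  rw [h3] at h1
  refine h1.trans (Nat.mul_le_mul ?_ (Nat.pow_le_pow_right hp Finset.card_image_le))
  have hle : RV ≤ (π.comp j).rangeRestrict.ker := by
    rintro _ ⟨v, rfl⟩
    rw [MonoidHom.mem_ker]
    ext
    simp only [powMonoidHom_apply, map_pow]
    simp [hQ]
  refine Nat.card_le_card_of_surjective (QuotientGroup.lift RV (π.comp j).rangeRestrict hle) ?_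
  intro y
  obtain ⟨v, rfl⟩ := (π.comp j).rangeRestrict_surjective y
  exact ⟨QuotientGroup.mk v, rfl⟩

/-- Counting fibres. -/
lemma card_sub_le_of_choice {W T : Type*} [CommGroup W] [Finite W] [Finite T]
    (P Q : W → Prop) (f : {c // P c} → T)
    (hf : ∀ c d, f c = f d → Q (c.1 / d.1)) :
    Nat.card {c // P c} ≤ Nat.card {a // Q a} * Nat.card T := by
  classical
  rw [← Nat.card_prod]
  have hrep : ∀ c : {c // P c}, ∃ d, f d = f c := fun c => ⟨c, rfl⟩
  let rep : {c // P c} → {c // P c} := fun c => (⟨f c, c, rfl⟩ : Set.range f).2.choose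
  have h1 : ∀ c, f (rep c) = f c := fun c => (⟨f c, c, rfl⟩ : Set.range f).2.choose_spec
  have h2 : ∀ c d, f c = f d → rep c = rep d := by
    intro c d h
    have : (⟨f c, c, rfl⟩ : Set.range f) = ⟨f d, d, rfl⟩ := Subtype.ext h
    exact congrArg (fun t : Set.range f => t.2.choose) this
  refine Nat.card_le_card_of_injective
    (fun c => ((⟨c.1 / (rep c).1, hf _ _ (h1 c).symm⟩ : {a // Q a}), f c)) ?_
  intro c d h
  rw [Prod.ext_iff] at h
  obtain ⟨h3, h4⟩ := h
  have h5 := Subtype.ext_iff.1 h3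
  simp only at h5 h4
  rw [h2 c d h4, div_left_inj] at h5
  exact Subtype.ext h5
lemma unit_choice (p : ℕ) (hp : p ≠ 0) (K : Type*) [Field K] [NumberField K] :
    ∃ f : (𝓞 K)ˣ → ZMod p × (Fin (NumberField.Units.rank K) → ZMod p),
      ∀ a b, f a = f b → ∃ η, a = b * η ^ p := by
  classical
  obtain ⟨g, hg⟩ := IsCyclic.exists_generator (α := NumberField.Units.torsion K)
  have h1 : ∀ x : (𝓞 K)ˣ, ∃ m : ℤ, ∃ e : Fin (NumberField.Units.rank K) → ℤ,
      x = (g : (𝓞 K)ˣ) ^ m * ∏ i, (NumberField.Units.fundSystem K i) ^ (e i) := by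
    intro x
    obtain ⟨⟨t, e⟩, h, -⟩ := NumberField.Units.exist_unique_eq_mul_prod K x
    obtain ⟨m, hm⟩ := Subgroup.mem_zpowers_iff.1 (hg t)
    refine ⟨m, e, ?_⟩
    rw [h, ← hm]; rfl
  choose m e hme using h1
  refine ⟨fun x => ((m x : ZMod p), fun i => (e x i : ZMod p)), fun a b hab => ?_⟩
  rw [Prod.ext_iff, funext_iff] at hab
  obtain ⟨h1, h2⟩ := hab
  simp only [ZMod.intCast_eq_intCast_iff_dvd_sub] at h1 h2
  obtain ⟨k, hk⟩ := h1
  choose l hl using h2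
  refine ⟨(g : (𝓞 K)ˣ) ^ (-k) * ∏ i, (NumberField.Units.fundSystem K i) ^ (-l i), ?_⟩
  rw [hme a, hme b, mul_pow, ← Finset.prod_pow, mul_mul_mul_comm, ← Finset.prod_mul_distrib]
  congr 1
  · rw [← zpow_natCast, ← zpow_mul, ← zpow_add]; congr 1; linarith
  · refine Finset.prod_congr rfl fun i _ => ?_
    rw [← zpow_natCast, ← zpow_mul, ← zpow_add]; congr 1; linarith [hl i]

lemma cyclo_inst (p : ℕ) (hp : p.Prime) (K : Type*) [Field K] [NumberField K]
    (ζ : K) (hζ : IsPrimitiveRoot ζ p)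
    (hKgen : Algebra.adjoin ℚ {ζ} = (⊤ : Subalgebra ℚ K)) : IsCyclotomicExtension {p} ℚ K := by
  have : NeZero p := ⟨hp.ne_zero⟩
  rw [IsCyclotomicExtension.iff_adjoin_eq_top]
  refine ⟨fun n hn _ => ?_, ?_⟩
  · rw [Set.mem_singleton_iff] at hn; subst hn; exact ⟨ζ, hζ⟩
  · rw [eq_top_iff, ← hKgen]
    apply Algebra.adjoin_mono
    rintro _ rfl
    exact ⟨p, rfl, hp.ne_zero, hζ.pow_eq_one⟩

lemma rank_cyclo (p : ℕ) (hp : p.Prime) (hpodd : Odd p) (K : Type*) [Field K] [NumberField K]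
    [IsCyclotomicExtension {p} ℚ K] : NumberField.Units.rank K + 1 = (p - 1) / 2 := by
  have : NeZero p := ⟨hp.ne_zero⟩
  have h2 : 2 < p := by
    rcases hpodd with ⟨k, rfl⟩
    have := hp.two_le
    omega
  have h3 := NumberField.InfinitePlace.card_eq_nrRealPlaces_add_nrComplexPlaces (K := K)
  rw [IsCyclotomicExtension.Rat.nrRealPlaces_eq_zero (n := p) K h2,
    IsCyclotomicExtension.Rat.nrComplexPlaces_eq_totient_div_two p K, Nat.totient_prime hp] at h3
  rw [NumberField.Units.rank, h3]
  omega

lemma finrank_cyclo (p : ℕ) (hp : p.Prime) (K : Type*) [Field K] [NumberField K]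
    [IsCyclotomicExtension {p} ℚ K] : Module.finrank ℚ K = p - 1 := by
  have : NeZero p := ⟨hp.ne_zero⟩
  rw [IsCyclotomicExtension.finrank (n := p) K (cyclotomic.irreducible_rat (NeZero.pos _)),
    Nat.totient_prime hp]

lemma not_pow (p N : ℕ) (hp : p.Prime) (hN : N.Prime) (K : Type*) [Field K] [NumberField K]
    (hK : Module.finrank ℚ K = p - 1) (b : K) : b ^ p ≠ (N : K) := by
  intro h
  have h1 := congrArg (Algebra.norm ℚ) h
  have h2 : (N : K) = algebraMap ℚ K (N : ℚ) := by simp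
  rw [map_pow, h2, Algebra.norm_algebraMap, hK] at h1
  have : Fact N.Prime := ⟨hN⟩
  have h3 := congrArg (padicValRat N) h1
  rw [padicValRat.pow, padicValRat.pow, padicValRat.self hN.one_lt] at h3
  have h4 : (p : ℤ) ∣ ((p - 1 : ℕ) : ℤ) := ⟨padicValRat N (Algebra.norm ℚ b), by linarith⟩
  have h5 := Nat.le_of_dvd (by have := hp.two_le; omega) (Int.natCast_dvd_natCast.1 h4)
  have := hp.two_le
  omega

lemma kummer_facts (p N : ℕ) (hp : p.Prime) (hN : N.Prime)
    (K L : Type*) [Field K] [NumberField K] [Field L] [NumberField L] [Algebra K L]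
    (ζ : K) (hζ : IsPrimitiveRoot ζ p) (hK : Module.finrank ℚ K = p - 1)
    (α : L) (hα : α ^ p = (N : L))
    (hLgen : Algebra.adjoin K {α} = (⊤ : Subalgebra K L)) :
    IsGalois K L ∧ IsCyclic (L ≃ₐ[K] L) ∧ Nat.card (L ≃ₐ[K] L) = p ∧ Module.finrank K L = p ∧
    ∃ σ : L ≃ₐ[K] L, (∀ x, x ∈ Subgroup.zpowers σ) ∧ σ α = algebraMap K L ζ * α := by
  have : NeZero p := ⟨hp.ne_zero⟩
  have irr : Irreducible (X ^ p - C (N : K)) :=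
    X_pow_sub_C_irreducible_of_prime hp (fun b => not_pow p N hp hN K hK b)
  have hroot : (primitiveRoots p K).Nonempty := ⟨ζ, by rwa [mem_primitiveRoots hp.pos]⟩
  have hLgen' : IntermediateField.adjoin K {α} = ⊤ := by
    rw [eq_top_iff]
    intro x _
    have : x ∈ Algebra.adjoin K {α} := by rw [hLgen]; trivial
    exact IntermediateField.algebra_adjoin_le_adjoin K {α} this
  have hdeg : Module.finrank K L = p := by
    rw [← IntermediateField.finrank_top', ← hLgen',
      IntermediateField.adjoin.finrank (Algebra.IsIntegral.isIntegral α),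
      ← minpoly.eq_of_irreducible_of_monic irr (by simp [hα]) (monic_X_pow_sub_C _ hp.ne_zero)]
    exact natDegree_X_pow_sub_C
  have hα' : α ^ p = algebraMap K L (N : K) := by rw [hα]; simp
  have hsplit : IsSplittingField K L (X ^ p - C (N : K)) := by
    have := isSplittingField_X_pow_sub_C_of_root_adjoin_eq_top (K := K) (L := L) (a := (N : K))
      (α := α) (by rwa [hdeg]) (by rw [hdeg, hα']) hLgen'
    rwa [hdeg] at this
  have hgal := isGalois_of_isSplittingField_X_pow_sub_C hroot irr L
  have hcyc := isCyclic_of_isSplittingField_X_pow_sub_C hroot irr L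
  have hcard : Nat.card (L ≃ₐ[K] L) = p := by
    rw [IsGalois.card_aut_eq_finrank, hdeg]
  refine ⟨hgal, hcyc, hcard, hdeg, ?_⟩
  refine ⟨(autEquivZmod irr L hζ).symm (Multiplicative.ofAdd ((1 : ℕ) : ZMod p)), ?_, ?_⟩
  · have : Fact p.Prime := ⟨hp⟩
    intro x
    apply mem_zpowers_of_prime_card hcard
    rw [ne_eq, EmbeddingLike.map_eq_one_iff]
    intro h
    have := Multiplicative.ofAdd.injective (h.trans (ofAdd_zero).symm)
    simp at this
  · rw [autEquivZmod_symm_apply_natCast irr L hα' hζ, pow_one, Algebra.smul_def]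
open scoped Pointwise

section invariants

variable {K L : Type} [Field K] [NumberField K] [Field L] [NumberField L] [Algebra K L]

instance smulCommInst : SMulCommClass (L ≃ₐ[K] L) (𝓞 K) (𝓞 L) where
  smul_comm g a x := by
    apply RingOfIntegers.ext
    change g ((a • x : 𝓞 L) : L) = ((a • (g • x) : 𝓞 L) : L)
    rw [Algebra.smul_def, Algebra.smul_def]
    exact (map_mul g _ _).trans (congrArg (· * g (x : L)) (g.commutes (a : K)))

lemma map_mapRingEquiv_eq (σ : L ≃ₐ[K] L) (I : Ideal (𝓞 L)) :
    Ideal.map (RingOfIntegers.mapRingEquiv (σ : L ≃+* L)) I = σ • I := rfl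

variable (K L) in
/-- Classes of Galois invariant ideals. -/
noncomputable def invClasses : Subgroup (ClassGroup (𝓞 L)) where
  carrier := {c | ∃ I : (Ideal (𝓞 L))⁰, ClassGroup.mk0 I = c ∧ ∀ g : L ≃ₐ[K] L, g • I.1 = I.1}
  one_mem' := ⟨1, map_one _, fun g => by
    simp only [OneMemClass.coe_one]; exact smul_one g⟩
  mul_mem' := by
    rintro _ _ ⟨I, rfl, hI⟩ ⟨J, rfl, hJ⟩
    refine ⟨I * J, map_mul _ _ _, fun g => ?_⟩
    simp only [Submonoid.coe_mul, smul_mul', hI, hJ]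
  inv_mem' := by
    rintro _ ⟨I, rfl, hI⟩
    refine ⟨I ^ (orderOf (ClassGroup.mk0 I) - 1), ?_, fun g => ?_⟩
    · rw [map_pow, eq_inv_iff_mul_eq_one, ← pow_succ,
        Nat.sub_add_cancel (orderOf_pos _), pow_orderOf_eq_one]
    · simp only [SubmonoidClass.coe_pow, smul_pow', hI]

lemma smul_span (σ : L ≃ₐ[K] L) (x : 𝓞 L) :
    σ • (Ideal.span {x} : Ideal (𝓞 L)) = Ideal.span {σ • x} := by
  rw [Ideal.pointwise_smul_def, Ideal.map_span, Set.image_singleton]; rfl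

lemma exists_unit (σ : L ≃ₐ[K] L) (I : Ideal (𝓞 L)) (hI : I ≠ ⊥) (a b : 𝓞 L)
    (h : Ideal.span {a} * σ • I = Ideal.span {b} * I) :
    ∃ ε : (𝓞 K)ˣ, Algebra.norm K (b : L) = (ε : K) * Algebra.norm K (a : L) := by
  have h1 := congrArg (Ideal.relNorm (𝓞 K)) h
  rw [map_mul, map_mul, Ideal.relNorm_singleton, Ideal.relNorm_singleton,
    Ideal.relNorm_smul] at h1
  have h2 := mul_right_cancel₀ (by simpa [Ideal.zero_eq_bot] using hI) h1
  rw [Ideal.span_singleton_eq_span_singleton] at h2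
  obtain ⟨ε, hε⟩ := h2
  refine ⟨ε, ?_⟩
  have h3 := congrArg (algebraMap (𝓞 K) K) hε
  rw [map_mul, Algebra.algebraMap_intNorm (A := 𝓞 K) (K := K) (L := L) (B := 𝓞 L),
    Algebra.algebraMap_intNorm (A := 𝓞 K) (K := K) (L := L) (B := 𝓞 L)] at h3
  rw [mul_comm]
  exact h3.symm

lemma smul_inv_of_gen (σ : L ≃ₐ[K] L) (hσ : ∀ x, x ∈ Subgroup.zpowers σ) (I : Ideal (𝓞 L))
    (h : σ • I = I) (g : L ≃ₐ[K] L) : g • I = I := by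
  have h1 : σ ∈ MulAction.stabilizer (L ≃ₐ[K] L) I := h
  have h2 : Subgroup.zpowers σ ≤ MulAction.stabilizer (L ≃ₐ[K] L) I := by
    rwa [Subgroup.zpowers_le]
  exact h2 (hσ g)

lemma step1 (p : ℕ) [IsGalois K L] [IsCyclic (L ≃ₐ[K] L)] (hdeg : Module.finrank K L = p)
    (σ : L ≃ₐ[K] L) (hσ : ∀ x, x ∈ Subgroup.zpowers σ)
    (I I' : (Ideal (𝓞 L))⁰) (a b a' b' : 𝓞 L) (ha : a ≠ 0) (hb : b ≠ 0) (ha' : a' ≠ 0)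
    (hb' : b' ≠ 0)
    (h : Ideal.span {a} * σ • I.1 = Ideal.span {b} * I.1)
    (h' : Ideal.span {a'} * σ • I'.1 = Ideal.span {b'} * I'.1)
    (ε ε' η : (𝓞 K)ˣ) (hε : Algebra.norm K (b : L) = (ε : K) * Algebra.norm K (a : L))
    (hε' : Algebra.norm K (b' : L) = (ε' : K) * Algebra.norm K (a' : L))
    (hη : ε = ε' * η ^ p) :
    ClassGroup.mk0 I / ClassGroup.mk0 I' ∈ invClasses K L := by
  classical
  set η' : (𝓞 L)ˣ := Units.map (algebraMap (𝓞 K) (𝓞 L)).toMonoidHom η with hη'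
  have eη : ((η' : 𝓞 L) : L) = algebraMap K L (η : K) := rfl
  have eη0 : ((η' : 𝓞 L) : L) ≠ 0 := by
    simp
  have ha0 : (a : L) ≠ 0 := by simpa using ha
  have hb0 : (b : L) ≠ 0 := by simpa using hb
  have ha0' : (a' : L) ≠ 0 := by simpa using ha'
  have hb0' : (b' : L) ≠ 0 := by simpa using hb'
  have hεK : (ε : K) = (ε' : K) * (η : K) ^ p := by rw [hη]; simp
  have hnorm : Algebra.norm K (((b : L) * a') / (a * b' * (η' : 𝓞 L))) = 1 := by
    have hd : (a : L) * b' * (η' : 𝓞 L) ≠ 0 := mul_ne_zero (mul_ne_zero ha0 hb0') eη0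
    have hd' := (Algebra.norm_ne_zero_iff (R := K)).2 hd
    have h1 := congrArg (Algebra.norm K) (div_mul_cancel₀ ((b : L) * a') hd)
    rw [map_mul] at h1
    refine mul_right_cancel₀ hd' (h1.trans ?_)
    simp only [map_mul]
    rw [hε, hε', eη, Algebra.norm_algebraMap, hdeg, hεK]; ring
  obtain ⟨y, hy⟩ := groupCohomology.exists_div_of_norm_eq_one hσ hnorm
  obtain ⟨m, hm0, hm⟩ := ((IsFractionRing.isAlgebraic_iff ℤ ℚ L).2
    (Algebra.IsAlgebraic.isAlgebraic (R := ℚ) (y : L))).exists_integral_multiple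
  set z : 𝓞 L := ⟨m • (y : L), hm⟩ with hz
  have hmL : (m : L) ≠ 0 := by exact_mod_cast hm0
  have hzL : (z : L) = m * (y : L) := by
    change m • (y : L) = _
    rw [zsmul_eq_mul]
  have hz0 : z ≠ 0 := by
    intro h0
    have : (z : L) = 0 := by rw [h0]; simp
    rw [hzL] at this
    exact (mul_ne_zero hmL y.ne_zero) this
  have hσzL : ((σ • z : 𝓞 L) : L) = m * σ (y : L) := by
    change σ (z : L) = _
    rw [hzL, map_mul, map_intCast]
  have key : z * (a * b' * η') = (σ • z) * (b * a') := by
    apply RingOfIntegers.ext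
    change (z : L) * ((a : L) * b' * ((η' : 𝓞 L) : L)) = ((σ • z : 𝓞 L) : L) * ((b : L) * a')
    rw [hzL, hσzL]
    have hσy : σ (y : L) ≠ 0 := by simp
    rw [div_eq_div_iff hσy (mul_ne_zero (mul_ne_zero ha0 hb0') eη0)] at hy
    linear_combination (m : L) * hy
  have hI'0 : I'.1 ≠ ⊥ := nonZeroDivisors.coe_ne_zero I'
  have hI0 : I.1 ≠ ⊥ := nonZeroDivisors.coe_ne_zero I
  set n : ℕ := Ideal.absNorm I'.1
  have hn0 : (n : 𝓞 L) ≠ 0 := by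
    have : n ≠ 0 := by rw [Ne, Ideal.absNorm_eq_zero_iff]; exact hI'0
    exact_mod_cast this
  have hdvd : I'.1 ∣ Ideal.span {(n : 𝓞 L)} := by
    rw [Ideal.dvd_span_singleton]; exact Ideal.absNorm_mem I'.1
  obtain ⟨J, hJ⟩ := hdvd
  have hnI : Ideal.span {(n : 𝓞 L)} ≠ ⊥ := by
    rwa [Ne, Ideal.span_singleton_eq_bot]
  have hJ0 : J ≠ ⊥ := by
    rintro rfl
    rw [Ideal.mul_bot] at hJ
    exact hnI hJ
  have hσn : σ • Ideal.span {(n : 𝓞 L)} = Ideal.span {(n : 𝓞 L)} := by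
    rw [smul_span]
    congr 2
    exact map_natCast (MulSemiringAction.toRingHom (L ≃ₐ[K] L) (𝓞 L) σ) n
  have hσJ : σ • I'.1 * σ • J = Ideal.span {(n : 𝓞 L)} := by
    rw [← smul_mul', ← hJ, hσn]
  have hzI : Ideal.span {z} ≠ ⊥ := by rwa [Ne, Ideal.span_singleton_eq_bot]
  have haI : Ideal.span {a} ≠ ⊥ := by rwa [Ne, Ideal.span_singleton_eq_bot]
  have hbI' : Ideal.span {b'} ≠ ⊥ := by rwa [Ne, Ideal.span_singleton_eq_bot]
  have keyI : Ideal.span {z} * (Ideal.span {a} * Ideal.span {b'}) =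
      Ideal.span {σ • z} * (Ideal.span {b} * Ideal.span {a'}) := by
    simp only [Ideal.span_singleton_mul_span_singleton]
    rw [← key, Ideal.span_singleton_eq_span_singleton]
    exact ⟨η', by ring⟩
  have hX : σ • (Ideal.span {z} * I.1 * J) = Ideal.span {z} * I.1 * J := by
    have hM : Ideal.span {a} * Ideal.span {b'} * I'.1 ≠ 0 :=
      mul_ne_zero (mul_ne_zero haI hbI') hI'0
    refine mul_right_cancel₀ hM ?_
    rw [smul_mul', smul_mul', smul_span]
    calc _ = Ideal.span {σ • z} * (Ideal.span {a} * σ • I.1) * (σ • J) *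
          (Ideal.span {b'} * I'.1) := by ring
      _ = Ideal.span {σ • z} * (Ideal.span {b} * Ideal.span {a'}) * I.1 *
          (σ • I'.1 * σ • J) := by rw [h, ← h']; ring
      _ = Ideal.span {z} * (Ideal.span {a} * Ideal.span {b'}) * I.1 * (I'.1 * J) := by
          rw [← keyI, hσJ, hJ]
      _ = _ := by ring
  let Z : (Ideal (𝓞 L))⁰ := ⟨Ideal.span {z}, mem_nonZeroDivisors_iff_ne_zero.2 hzI⟩
  let J' : (Ideal (𝓞 L))⁰ := ⟨J, mem_nonZeroDivisors_iff_ne_zero.2 hJ0⟩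
  have hZ : ClassGroup.mk0 Z = 1 := by
    rw [ClassGroup.mk0_eq_one_iff]; exact ⟨z, rfl⟩
  have hJJ : ClassGroup.mk0 I' * ClassGroup.mk0 J' = 1 := by
    rw [← map_mul, ClassGroup.mk0_eq_one_iff]
    exact ⟨(n : 𝓞 L), hJ.symm⟩
  refine ⟨Z * I * J', ?_, fun g => smul_inv_of_gen σ hσ _ hX g⟩
  rw [map_mul, map_mul, hZ, one_mul, div_eq_mul_inv, eq_inv_of_mul_eq_one_right hJJ]

end invariants
section primes

variable {K L : Type} [Field K] [NumberField K] [Field L] [NumberField L] [Algebra K L]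

lemma perfect_res (𝔭 : Ideal (𝓞 K)) [h𝔭 : 𝔭.IsPrime] (h0 : 𝔭 ≠ ⊥) :
    PerfectField 𝔭.ResidueField := by
  have : 𝔭.IsMaximal := h𝔭.isMaximal h0
  have h2 : Function.Surjective (algebraMap ((𝓞 K) ⧸ 𝔭) 𝔭.ResidueField) :=
    (Ideal.bijective_algebraMap_quotient_residueField 𝔭).2
  have : Finite ((𝓞 K) ⧸ 𝔭) := Ideal.finiteQuotientOfFreeOfNeBot 𝔭 h0
  have : Finite 𝔭.ResidueField := Finite.of_surjective _ h2
  infer_instance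

lemma prime_dichotomy (p : ℕ) (hp : p.Prime) [IsGalois K L] (hcard : Nat.card (L ≃ₐ[K] L) = p)
    (P : Ideal (𝓞 L)) [hP : P.IsPrime] (hP0 : P ≠ ⊥) :
    (∀ J : Ideal (𝓞 L), (∀ g : L ≃ₐ[K] L, g • J = J) → P ∣ J →
      (P.under (𝓞 K)).map (algebraMap (𝓞 K) (𝓞 L)) ∣ J) ∨
    ((∀ g : L ≃ₐ[K] L, g • P = P) ∧ ∀ (g : L ≃ₐ[K] L) (x : 𝓞 L), g • x - x ∈ P) := by
  classical
  have hinst : IsGaloisGroup (L ≃ₐ[K] L) (𝓞 K) (𝓞 L) :=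
    IsGaloisGroup.of_isFractionRing (L ≃ₐ[K] L) (𝓞 K) (𝓞 L) K L
  set 𝔭 := P.under (𝓞 K) with h𝔭
  have h𝔭0 : 𝔭 ≠ ⊥ := Ideal.under_ne_bot (𝓞 K) hP0
  have h𝔭m : 𝔭.IsMaximal := Ideal.IsPrime.isMaximal inferInstance h𝔭0
  have := perfect_res 𝔭 h𝔭0
  have : P.LiesOver 𝔭 := ⟨rfl⟩
  have hnef := Ideal.ncard_primesOver_mul_ramificationIdxIn_mul_inertiaDegIn 𝔭 (𝓞 L) (L ≃ₐ[K] L)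
  have hin := Ideal.card_inertia_eq_ramificationIdxIn (G := L ≃ₐ[K] L) 𝔭 P
  rw [hcard] at hnef
  have hdvd : Ideal.ramificationIdxIn 𝔭 (𝓞 L) ∣ p :=
    ⟨(𝔭.primesOver (𝓞 L)).ncard * Ideal.inertiaDegIn 𝔭 (𝓞 L), by rw [← hnef]; ring⟩
  rcases (Nat.dvd_prime hp).1 hdvd with he | he
  · left
    intro J hJ hPJ
    rw [Ideal.map_algebraMap_eq_finsetProd_pow h𝔭0]
    refine Finset.prod_dvd_of_coprime ?_ ?_
    · intro Q hQ Q' hQ' hne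
      simp only [Finset.mem_coe, Set.mem_toFinset] at hQ hQ'
      have hQp := hQ.1
      have hQp' := hQ'.1
      have hQl := hQ.2
      have hQl' := hQ'.2
      have hm : Q.IsMaximal := hQp.isMaximal (Ideal.ne_bot_of_liesOver_of_ne_bot h𝔭0 Q)
      have hm' : Q'.IsMaximal := hQp'.isMaximal (Ideal.ne_bot_of_liesOver_of_ne_bot h𝔭0 Q')
      exact (Ideal.isCoprime_of_isMaximal hne).pow
    · intro Q hQ
      simp only [Set.mem_toFinset] at hQ
      have hQp := hQ.1
      have hQl := hQ.2
      rw [← Ideal.ramificationIdxIn_eq_ramificationIdx 𝔭 Q (L ≃ₐ[K] L), he, pow_one]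
      obtain ⟨g, hg⟩ := Ideal.exists_smul_eq_of_isGaloisGroup 𝔭 P Q (L ≃ₐ[K] L)
      obtain ⟨X, hX⟩ := hPJ
      refine ⟨g • X, ?_⟩
      rw [← hg, ← smul_mul', ← hX, hJ]
  · right
    have htop : Ideal.inertia (L ≃ₐ[K] L) P = ⊤ := by
      apply Subgroup.eq_top_of_card_eq
      rw [hin, he, hcard]
    have hx : ∀ (g : L ≃ₐ[K] L) (x : 𝓞 L), g • x - x ∈ P := by
      intro g x
      have : g ∈ Ideal.inertia (L ≃ₐ[K] L) P := by rw [htop]; trivial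
      exact this x
    refine ⟨fun g => ?_, hx⟩
    have : g ∈ Ideal.inertia (L ≃ₐ[K] L) P := by rw [htop]; trivial
    exact Ideal.inertia_le_stabilizer P this

end primes
section induct

variable {K L : Type} [Field K] [NumberField K] [Field L] [NumberField L] [Algebra K L]

/-- The class of an invariant ideal. -/
noncomputable def invCls (J : (Ideal (𝓞 L))⁰) (hJ : ∀ g : L ≃ₐ[K] L, g • J.1 = J.1) :
    invClasses K L := ⟨ClassGroup.mk0 J, J, rfl, hJ⟩

lemma smul_extended (g : L ≃ₐ[K] L) (I : Ideal (𝓞 K)) :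
    g • I.map (algebraMap (𝓞 K) (𝓞 L)) = I.map (algebraMap (𝓞 K) (𝓞 L)) := by
  rw [Ideal.pointwise_smul_def, Ideal.map_map]
  congr 1
  ext x
  change g (algebraMap (𝓞 L) L (algebraMap (𝓞 K) (𝓞 L) x)) = _
  exact g.commutes (x : K)

variable (K L) in
/-- Extension of classes. -/
noncomputable def jHom : ClassGroup (𝓞 K) →* invClasses K L :=
  (ClassGroup.extendedHom (𝓞 K) (𝓞 L)).codRestrict (invClasses K L) (by
    intro c
    obtain ⟨I, rfl⟩ := ClassGroup.mk0_surjective c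
    rw [ClassGroup.extendedHom_mk0]
    exact ⟨_, rfl, fun g => smul_extended g _⟩)

lemma invCls_mul (M J' J : (Ideal (𝓞 L))⁰) (hM : ∀ g : L ≃ₐ[K] L, g • M.1 = M.1)
    (hJ' : ∀ g : L ≃ₐ[K] L, g • J'.1 = J'.1)
    (hJ : ∀ g : L ≃ₐ[K] L, g • J.1 = J.1) (h : J.1 = M.1 * J'.1) :
    invCls J hJ = invCls M hM * invCls J' hJ' := by
  apply Subtype.ext
  change ClassGroup.mk0 J = ClassGroup.mk0 M * ClassGroup.mk0 J'
  rw [← map_mul]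
  congr 1
  exact Subtype.ext h

lemma inv_of_mul (M J' J : Ideal (𝓞 L)) (hM0 : M ≠ ⊥) (hM : ∀ g : L ≃ₐ[K] L, g • M = M)
    (hJ : ∀ g : L ≃ₐ[K] L, g • J = J) (h : J = M * J') (g : L ≃ₐ[K] L) : g • J' = J' := by
  have h1 := hJ g
  rw [h, smul_mul', hM] at h1
  exact mul_left_cancel₀ hM0 h1

lemma main_induct (p : ℕ) (hp : p.Prime) [IsGalois K L] (hcard : Nat.card (L ≃ₐ[K] L) = p)
    (D : Subgroup (invClasses K L)) (hD : (jHom K L).range ≤ D) (P₁ : Ideal (𝓞 L))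
    (hP : ∀ (P : (Ideal (𝓞 L))⁰) (hPg : ∀ g : L ≃ₐ[K] L, g • P.1 = P.1), P.1.IsPrime → P.1 ≠ P₁ →
      (∀ (g : L ≃ₐ[K] L) (x : 𝓞 L), g • x - x ∈ P.1) → invCls P hPg ∈ D) :
    ∀ (n : ℕ) (J : (Ideal (𝓞 L))⁰) (hJ : ∀ g : L ≃ₐ[K] L, g • J.1 = J.1),
      Ideal.absNorm J.1 = n → ¬ P₁ ∣ J.1 → invCls J hJ ∈ D := by
  intro n
  induction n using Nat.strong_induction_on with
  | _ n ih =>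
  intro J hJ hn hPJ
  have hJ0 : J.1 ≠ ⊥ := nonZeroDivisors.coe_ne_zero J
  by_cases hJt : J.1 = ⊤
  · have : invCls J hJ = 1 := by
      apply Subtype.ext
      change ClassGroup.mk0 J = 1
      rw [ClassGroup.mk0_eq_one_iff]
      rw [hJt]
      exact ⟨1, by simp⟩
    rw [this]
    exact D.one_mem
  obtain ⟨P, hPm, hJP⟩ := Ideal.exists_le_maximal J.1 hJt
  have hPp : P.IsPrime := hPm.isPrime
  have hP0 : P ≠ ⊥ := by
    rintro rfl
    exact hJ0 (le_bot_iff.1 hJP)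
  have hPJd : P ∣ J.1 := Ideal.dvd_iff_le.2 hJP
  -- peel off a factor
  have peel : ∀ (M : (Ideal (𝓞 L))⁰) (hM : ∀ g : L ≃ₐ[K] L, g • M.1 = M.1), M.1 ∣ J.1 → M.1 ≤ P →
      invCls M hM ∈ D → invCls J hJ ∈ D := by
    rintro M hM ⟨J', hJ'⟩ hMP hMD
    have hM0 : M.1 ≠ ⊥ := nonZeroDivisors.coe_ne_zero M
    have hJ'0 : J' ≠ ⊥ := by
      rintro rfl
      rw [Ideal.mul_bot] at hJ'
      exact hJ0 hJ'
    let X : (Ideal (𝓞 L))⁰ := ⟨J', mem_nonZeroDivisors_iff_ne_zero.2 hJ'0⟩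
    have hX : ∀ g : L ≃ₐ[K] L, g • X.1 = X.1 := inv_of_mul M.1 J' J.1 hM0 hM hJ hJ'
    rw [invCls_mul M X J hM hX hJ hJ']
    refine D.mul_mem hMD (ih _ ?_ X hX rfl ?_)
    · rw [← hn, hJ', map_mul]
      have h1 : Ideal.absNorm J' ≠ 0 := by rwa [Ne, Ideal.absNorm_eq_zero_iff]
      have h2 : Ideal.absNorm M.1 ≠ 0 := by rwa [Ne, Ideal.absNorm_eq_zero_iff]
      have h3 : Ideal.absNorm M.1 ≠ 1 := by
        rw [Ne, Ideal.absNorm_eq_one_iff]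
        intro h
        rw [h] at hMP
        exact hPm.ne_top (top_le_iff.1 hMP)
      have h4 : 1 < Ideal.absNorm M.1 := by omega
      exact lt_mul_of_one_lt_left (Nat.pos_of_ne_zero h1) h4
    · intro hd
      exact hPJ (hd.trans ⟨M.1, by rw [hJ', mul_comm]⟩)
  rcases prime_dichotomy p hp hcard P hP0 with h | ⟨h1, h2⟩
  · have h𝔭0 : P.under (𝓞 K) ≠ ⊥ := Ideal.under_ne_bot (𝓞 K) hP0
    let Q : (Ideal (𝓞 K))⁰ := ⟨P.under (𝓞 K), mem_nonZeroDivisors_iff_ne_zero.2 h𝔭0⟩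
    refine peel (ClassGroup.extendedIdeal (𝓞 K) (𝓞 L) Q) (fun g => smul_extended g _)
      (h J.1 hJ hPJd) ?_ (hD ⟨ClassGroup.mk0 Q, ?_⟩)
    · exact Ideal.map_comap_le
    · apply Subtype.ext
      exact ClassGroup.extendedHom_mk0 _ _ _
  · let Q : (Ideal (𝓞 L))⁰ := ⟨P, mem_nonZeroDivisors_iff_ne_zero.2 hP0⟩
    refine peel Q h1 hPJd le_rfl (hP Q h1 hPp ?_ h2)
    rintro rfl
    exact hPJ hPJd

end induct
section final

variable {K L : Type} [Field K] [NumberField K] [Field L] [NumberField L] [Algebra K L]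

lemma mem_of_coprime {A : Type*} [Group A] (D : Subgroup A) (x : A) (a p : ℕ)
    (h : Nat.Coprime a p) (ha : x ^ a ∈ D) (hp : x ^ p ∈ D) : x ∈ D := by
  have h1 := Nat.gcd_eq_gcd_ab a p
  rw [h] at h1
  have h2 : x = (x ^ a) ^ (a.gcdA p) * (x ^ p) ^ (a.gcdB p) := by
    rw [← zpow_natCast, ← zpow_natCast, ← zpow_mul, ← zpow_mul, ← zpow_add, ← h1]
    simp
  rw [h2]
  exact D.mul_mem (D.zpow_mem ha _) (D.zpow_mem hp _)

lemma exp_not_dvd (p N : ℕ) (hp : p.Prime) (hN : N.Prime)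
    (hdeg : Module.finrank ℚ L = p * (p - 1)) (α : 𝓞 L) (hα : α ^ p = (N : 𝓞 L))
    (P : Ideal (𝓞 L)) [hPp : P.IsPrime] (hP0 : P ≠ ⊥) (J : Ideal (𝓞 L)) (a : ℕ)
    (hP : α ∈ P) (hJ : Ideal.span {α} = P ^ a * J) (hPJ : ¬ P ∣ J) : ¬ p ∣ a := by
  intro hpa
  have ha : a ≠ 0 := by
    rintro rfl
    apply hPJ
    rw [pow_zero, one_mul] at hJ
    rw [← hJ, Ideal.dvd_span_singleton]
    exact hP
  have hle : p ≤ a := Nat.le_of_dvd (Nat.pos_of_ne_zero ha) hpa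
  have h1 : P ^ (p * p) ∣ Ideal.span {(N : 𝓞 L)} := by
    rw [← hα, ← Ideal.span_singleton_pow, hJ, mul_pow, ← pow_mul]
    exact (pow_dvd_pow P (Nat.mul_le_mul_right p hle)).trans (Dvd.intro _ rfl)
  have h2 := Ideal.absNorm_dvd_absNorm_of_le (Ideal.le_of_dvd h1)
  have h3 : Ideal.absNorm (Ideal.span {(N : 𝓞 L)}) = N ^ (p * (p - 1)) := by
    rw [Ideal.absNorm_span_singleton]
    have : (N : 𝓞 L) = algebraMap ℤ (𝓞 L) (N : ℤ) := by simp
    rw [this, Algebra.norm_algebraMap, RingOfIntegers.rank, hdeg, Int.natAbs_pow, Int.natAbs_natCast]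
  rw [h3, map_pow] at h2
  have hpp : p * p ≠ 0 := mul_ne_zero hp.ne_zero hp.ne_zero
  have h4 : Ideal.absNorm P ∣ N ^ (p * (p - 1)) := (dvd_pow_self _ hpp).trans h2
  obtain ⟨k, hk, hk'⟩ := (Nat.dvd_prime_pow hN).1 h4
  have hk0 : k ≠ 0 := by
    rintro rfl
    rw [pow_zero, Ideal.absNorm_eq_one_iff] at hk'
    exact hPp.ne_top hk'
  rw [hk', ← pow_mul, Nat.pow_dvd_pow_iff_le_right hN.one_lt] at h2
  have h5 : p * p ≤ k * (p * p) := Nat.le_mul_of_pos_left _ (Nat.pos_of_ne_zero hk0)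
  have h6 : p * (p - 1) < p * p := Nat.mul_lt_mul_of_pos_left (Nat.sub_lt hp.pos one_pos) hp.pos
  omega

lemma full_induct (p N : ℕ) (hp : p.Prime) (hN : N.Prime) [IsGalois K L]
    (hcard : Nat.card (L ≃ₐ[K] L) = p)
    (hdeg : Module.finrank ℚ L = p * (p - 1)) (α : 𝓞 L) (hα : α ^ p = (N : 𝓞 L))
    (hαg : ∀ g : L ≃ₐ[K] L, g • Ideal.span {α} = Ideal.span {α})
    (D : Subgroup (invClasses K L)) (hD : (jHom K L).range ≤ D)
    (hDp : ∀ x : invClasses K L, x ^ p ∈ D) (P₁ : Ideal (𝓞 L))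
    (hP₁ : P₁ = ⊥ ∨ (P₁ ≠ ⊥ ∧ P₁.IsPrime ∧ α ∈ P₁ ∧ ∀ g : L ≃ₐ[K] L, g • P₁ = P₁))
    (hP : ∀ (P : (Ideal (𝓞 L))⁰) (hPg : ∀ g : L ≃ₐ[K] L, g • P.1 = P.1), P.1.IsPrime → P.1 ≠ P₁ →
      (∀ (g : L ≃ₐ[K] L) (x : 𝓞 L), g • x - x ∈ P.1) → invCls P hPg ∈ D)
    (c : invClasses K L) : c ∈ D := by
  have hind := main_induct p hp hcard D hD P₁ hP
  obtain ⟨_, J, rfl, hJ⟩ := c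
  change invCls J hJ ∈ D
  have hJ0 : J.1 ≠ ⊥ := nonZeroDivisors.coe_ne_zero J
  rcases hP₁ with rfl | ⟨h0, hpr, hαP, hPg⟩
  · refine hind _ J hJ rfl ?_
    rw [← Ideal.zero_eq_bot, zero_dvd_iff]
    exact hJ0
  -- splitting off the power of P₁
  have hprime : Prime P₁ := Ideal.prime_of_isPrime h0 hpr
  let Q : (Ideal (𝓞 L))⁰ := ⟨P₁, mem_nonZeroDivisors_iff_ne_zero.2 h0⟩
  have split : ∀ (X : (Ideal (𝓞 L))⁰) (hX : ∀ g : L ≃ₐ[K] L, g • X.1 = X.1),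
      ∃ (a : ℕ) (X' : Ideal (𝓞 L)), X.1 = P₁ ^ a * X' ∧ ¬ P₁ ∣ X' ∧
        ∃ y ∈ D, invCls X hX = (invCls Q hPg) ^ a * y := by
    intro X hX
    have hX0 : X.1 ≠ ⊥ := nonZeroDivisors.coe_ne_zero X
    have hfin : FiniteMultiplicity P₁ X.1 := FiniteMultiplicity.of_not_isUnit hprime.not_isUnit hX0
    obtain ⟨X', hX', hnd⟩ := hfin.exists_eq_pow_mul_and_not_dvd
    refine ⟨_, X', hX', hnd, ?_⟩
    set a := multiplicity P₁ X.1
    have hX'0 : X' ≠ ⊥ := by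
      rintro rfl
      rw [Ideal.mul_bot] at hX'
      exact hX0 hX'
    let Y : (Ideal (𝓞 L))⁰ := ⟨X', mem_nonZeroDivisors_iff_ne_zero.2 hX'0⟩
    have hQa : ∀ g : L ≃ₐ[K] L, g • (Q ^ a).1 = (Q ^ a).1 := by
      intro g
      rw [SubmonoidClass.coe_pow, smul_pow', hPg]
    have hYg : ∀ g : L ≃ₐ[K] L, g • Y.1 = Y.1 :=
      inv_of_mul (P₁ ^ a) X' X.1 (pow_ne_zero _ h0) hQa hX hX'
    refine ⟨invCls Y hYg, hind _ Y hYg rfl hnd, ?_⟩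
    rw [invCls_mul (Q ^ a) Y X hQa hYg hX hX']
    congr 1
    apply Subtype.ext
    exact map_pow _ _ _
  have hN0 : (N : 𝓞 L) ≠ 0 := by exact_mod_cast hN.ne_zero
  have hα0 : α ≠ 0 := by
    rintro rfl
    rw [zero_pow hp.ne_zero] at hα
    exact hN0 hα.symm
  have hαI : Ideal.span {α} ≠ ⊥ := by rwa [Ne, Ideal.span_singleton_eq_bot]
  let Z : (Ideal (𝓞 L))⁰ := ⟨Ideal.span {α}, mem_nonZeroDivisors_iff_ne_zero.2 hαI⟩
  obtain ⟨a, X, hX, hXn, y, hy, hyy⟩ := split Z hαg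
  have hpa : ¬ p ∣ a := exp_not_dvd p N hp hN hdeg α hα P₁ h0 X a hαP hX hXn
  have hZ1 : invCls Z hαg = 1 := by
    apply Subtype.ext
    change ClassGroup.mk0 Z = 1
    rw [ClassGroup.mk0_eq_one_iff]
    exact ⟨α, rfl⟩
  rw [hZ1] at hyy
  have hQa : (invCls Q hPg) ^ a ∈ D := by
    rw [eq_inv_of_mul_eq_one_left hyy.symm]
    exact D.inv_mem hy
  have hQD : invCls Q hPg ∈ D :=
    mem_of_coprime D _ a p ((Nat.Prime.coprime_iff_not_dvd hp).2 hpa).symm hQa (hDp _)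
  obtain ⟨b, X', -, -, y', hy', hyy'⟩ := split J hJ
  rw [hyy']
  exact D.mul_mem (D.pow_mem hQD _) hy'

end final
section count

variable {K L : Type} [Field K] [NumberField K] [Field L] [NumberField L] [Algebra K L]

variable (K L) in
/-- The totally ramified primes. -/
def ramPrimes : Set (Ideal (𝓞 L)) :=
  {P | P ≠ ⊥ ∧ P.IsPrime ∧ (∀ g : L ≃ₐ[K] L, g • P = P) ∧
    ∀ (g : L ≃ₐ[K] L) (x : 𝓞 L), g • x - x ∈ P}

lemma under_injOn [IsGalois K L] :
    Set.InjOn (fun P : Ideal (𝓞 L) => P.under (𝓞 K)) (ramPrimes K L) := by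
  intro P hP Q hQ h
  have hinst : IsGaloisGroup (L ≃ₐ[K] L) (𝓞 K) (𝓞 L) :=
    IsGaloisGroup.of_isFractionRing (L ≃ₐ[K] L) (𝓞 K) (𝓞 L) K L
  have := hP.2.1
  have := hQ.2.1
  have h1 : P.LiesOver (P.under (𝓞 K)) := ⟨rfl⟩
  have h2 : Q.LiesOver (P.under (𝓞 K)) := ⟨h⟩
  obtain ⟨g, hg⟩ := Ideal.exists_smul_eq_of_isGaloisGroup (P.under (𝓞 K)) P Q (L ≃ₐ[K] L)
  rw [← hg, hP.2.2.1]

lemma primesOver_count (p N : ℕ) (hp : p.Prime) (hN : N.Prime)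
    [IsCyclotomicExtension {p} ℚ K] :
    ((Ideal.span {(N : ℤ)}).primesOver (𝓞 K)).Finite ∧
      ((Ideal.span {(N : ℤ)}).primesOver (𝓞 K)).ncard ≤ p - 1 := by
  have : NeZero p := ⟨hp.ne_zero⟩
  have hg : IsGalois ℚ K := IsCyclotomicExtension.isGalois {p} ℚ K
  have hinst : IsGaloisGroup (K ≃ₐ[ℚ] K) ℤ (𝓞 K) :=
    IsGaloisGroup.of_isFractionRing (K ≃ₐ[ℚ] K) ℤ (𝓞 K) ℚ K
  have hNp : (Ideal.span {(N : ℤ)}).IsPrime := by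
    rw [Ideal.span_singleton_prime (by exact_mod_cast hN.ne_zero)]
    exact Nat.prime_iff_prime_int.1 hN
  have h := Ideal.ncard_primesOver_mul_ramificationIdxIn_mul_inertiaDegIn
    (Ideal.span {(N : ℤ)}) (𝓞 K) (K ≃ₐ[ℚ] K)
  rw [IsGalois.card_aut_eq_finrank, finrank_cyclo p hp K] at h
  refine ⟨Algebra.QuasiFinite.finite_primesOver _, ?_⟩
  exact Nat.le_of_dvd (Nat.sub_pos_of_lt hp.one_lt) (Dvd.intro _ h)

lemma ram_count (p N : ℕ) (hp : p.Prime) (hN : N.Prime) [IsGalois K L]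
    [IsCyclotomicExtension {p} ℚ K] (ζ : K) (hζ : IsPrimitiveRoot ζ p)
    (α : 𝓞 L) (hα : α ^ p = (N : 𝓞 L)) (σ : L ≃ₐ[K] L)
    (hσ : σ (α : L) = algebraMap K L ζ * α) :
    ∃ P₁ : Ideal (𝓞 L),
      (P₁ = ⊥ ∨ (P₁ ≠ ⊥ ∧ P₁.IsPrime ∧ α ∈ P₁ ∧ ∀ g : L ≃ₐ[K] L, g • P₁ = P₁)) ∧
      (ramPrimes K L \ {P₁}).Finite ∧ (ramPrimes K L \ {P₁}).ncard ≤ p - 1 := by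
  classical
  have : NeZero p := ⟨hp.ne_zero⟩
  have : Fact p.Prime := ⟨hp⟩
  obtain ⟨hfin, hcount⟩ := primesOver_count (K := K) p N hp hN
  set A : Set (Ideal (𝓞 L)) := {P | P ∈ ramPrimes K L ∧ α ∈ P} with hA
  set B : Set (Ideal (𝓞 L)) :=
    {P | P ∈ ramPrimes K L ∧ algebraMap (𝓞 K) (𝓞 L) (hζ.toInteger - 1) ∈ P} with hB
  have hAB : ramPrimes K L ⊆ A ∪ B := by
    intro P hP
    have h1 := hP.2.2.2 σ α
    have h2 : σ • α - α = algebraMap (𝓞 K) (𝓞 L) (hζ.toInteger - 1) * α := by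
      apply RingOfIntegers.ext
      change σ (α : L) - (α : L) = algebraMap K L (ζ - 1) * (α : L)
      rw [hσ, map_sub, map_one]
      ring
    rw [h2] at h1
    rcases hP.2.1.mem_or_mem h1 with h | h
    · exact Or.inr ⟨hP, h⟩
    · exact Or.inl ⟨hP, h⟩
  have hmaps : Set.MapsTo (fun P : Ideal (𝓞 L) => P.under (𝓞 K)) A
      ((Ideal.span {(N : ℤ)}).primesOver (𝓞 K)) := by
    rintro P ⟨hP, hαP⟩
    have := hP.2.1
    refine ⟨inferInstanceAs (P.comap _).IsPrime, ⟨?_⟩⟩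
    have hNm : (Ideal.span {(N : ℤ)}).IsMaximal := by
      apply Ideal.IsPrime.isMaximal
      · rw [Ideal.span_singleton_prime (by exact_mod_cast hN.ne_zero)]
        exact Nat.prime_iff_prime_int.1 hN
      · rw [Ne, Ideal.span_singleton_eq_bot]
        exact_mod_cast hN.ne_zero
    refine hNm.eq_of_le ?_ ?_
    · exact (Ideal.IsPrime.under ℤ (P.under (𝓞 K))).ne_top
    · rw [Ideal.span_singleton_le_iff_mem]
      change algebraMap (𝓞 K) (𝓞 L) (algebraMap ℤ (𝓞 K) (N : ℤ)) ∈ P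
      have h3 : algebraMap (𝓞 K) (𝓞 L) (algebraMap ℤ (𝓞 K) (N : ℤ)) = α ^ p := by
        rw [hα]; simp
      rw [h3]
      exact P.pow_mem_of_mem hαP p hp.pos
  have hinjA : Set.InjOn (fun P : Ideal (𝓞 L) => P.under (𝓞 K)) A :=
    under_injOn.mono fun P hP => hP.1
  have hAfin : A.Finite := Set.Finite.of_injOn hmaps hinjA hfin
  have hAcard : A.ncard ≤ p - 1 :=
    (Set.ncard_le_ncard_of_injOn _ hmaps hinjA hfin).trans hcount
  have hBss : B.Subsingleton := by
    have hpr : Prime (hζ.toInteger - 1) := hζ.zeta_sub_one_prime'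
    have hpri : (Ideal.span {hζ.toInteger - 1}).IsPrime := by
      rwa [Ideal.span_singleton_prime hpr.ne_zero]
    have hmx : (Ideal.span {hζ.toInteger - 1}).IsMaximal := by
      apply hpri.isMaximal
      rw [Ne, Ideal.span_singleton_eq_bot]
      exact hpr.ne_zero
    have key : ∀ P ∈ B, P.under (𝓞 K) = Ideal.span {hζ.toInteger - 1} := by
      rintro P ⟨hP, hPz⟩
      have := hP.2.1
      refine (hmx.eq_of_le (Ideal.IsPrime.under (𝓞 K) P).ne_top ?_).symm
      rw [Ideal.span_singleton_le_iff_mem]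
      exact hPz
    intro P hP Q hQ
    exact under_injOn hP.1 hQ.1 ((key P hP).trans (key Q hQ).symm)
  have hp1 : 1 ≤ p - 1 := by have := hp.two_le; omega
  have hBfin : B.Finite := hBss.finite
  have hBcard : B.ncard ≤ 1 := by
    have : Finite B := hBfin
    exact Set.ncard_le_one_iff_subsingleton.2 hBss
  have hRfin : (ramPrimes K L).Finite := (hAfin.union hBfin).subset hAB
  rcases A.eq_empty_or_nonempty with hAe | ⟨P₁, hP₁⟩
  · refine ⟨⊥, Or.inl rfl, hRfin.subset Set.sdiff_subset, ?_⟩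
    rw [hAe, Set.empty_union] at hAB
    exact ((Set.ncard_le_ncard (Set.sdiff_subset.trans hAB) hBfin).trans hBcard).trans hp1
  · refine ⟨P₁, Or.inr ⟨hP₁.1.1, hP₁.1.2.1, hP₁.2, hP₁.1.2.2.1⟩, hRfin.subset Set.sdiff_subset, ?_⟩
    rw [Set.ncard_sdiff_singleton_of_mem hP₁.1]
    have h1 := Set.ncard_le_ncard hAB (hAfin.union hBfin)
    have h2 := Set.ncard_union_le A B
    omega

lemma card_inv_le (p N : ℕ) (hp : p.Prime) (hN : N.Prime) [IsGalois K L]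
    [IsCyclotomicExtension {p} ℚ K] (hcard : Nat.card (L ≃ₐ[K] L) = p)
    (hdeg : Module.finrank ℚ L = p * (p - 1)) (ζ : K) (hζ : IsPrimitiveRoot ζ p)
    (α : 𝓞 L) (hα : α ^ p = (N : 𝓞 L)) (σ : L ≃ₐ[K] L)
    (hσg : ∀ x, x ∈ Subgroup.zpowers σ)
    (hσ : σ (α : L) = algebraMap K L ζ * α) :
    Nat.card {a : invClasses K L // a ^ p = 1} ≤
      Nat.card {v : ClassGroup (𝓞 K) // v ^ p = 1} * p ^ (p - 1) := by
  classical
  obtain ⟨P₁, hP₁, hfin, hcnt⟩ := ram_count p N hp hN ζ hζ α hα σ hσ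
  let f : Ideal (𝓞 L) → invClasses K L := fun P =>
    if h : P ≠ ⊥ ∧ ∀ g : L ≃ₐ[K] L, g • P = P then
      invCls ⟨P, mem_nonZeroDivisors_iff_ne_zero.2 h.1⟩ h.2 else 1
  let S : Finset (invClasses K L) := hfin.toFinset.image f
  have hS : S.card ≤ p - 1 := by
    refine Finset.card_image_le.trans ?_
    rwa [← Set.ncard_eq_toFinset_card _ hfin]
  refine (card_ptors_le p hp.pos (jHom K L) S ?_).trans
    (Nat.mul_le_mul_left _ (Nat.pow_le_pow_right hp.pos hS))
  refine full_induct p N hp hN hcard hdeg α hα ?_ _ ?_ ?_ P₁ hP₁ ?_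
  · refine smul_inv_of_gen σ hσg _ ?_
    rw [smul_span]
    have : NeZero p := ⟨hp.ne_zero⟩
    have hu : IsUnit hζ.toInteger := hζ.toInteger_isPrimitiveRoot.isUnit hp.ne_zero
    obtain ⟨u, hu⟩ := hu
    rw [Ideal.span_singleton_eq_span_singleton]
    refine Associated.symm ⟨Units.map (algebraMap (𝓞 K) (𝓞 L)).toMonoidHom u, ?_⟩
    apply RingOfIntegers.ext
    change (α : L) * algebraMap K L ((u : 𝓞 K) : K) = σ (α : L)
    rw [hu, hσ, mul_comm]
    rfl
  · exact le_sup_left.trans le_sup_left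
  · intro x
    exact Subgroup.mem_sup_right ⟨x, rfl⟩
  · intro P hPg hPp hne hin
    refine (le_sup_right.trans le_sup_left : Subgroup.closure (S : Set (invClasses K L)) ≤ _)
      (Subgroup.subset_closure ?_)
    have hP0 : P.1 ≠ ⊥ := nonZeroDivisors.coe_ne_zero P
    refine Finset.mem_coe.2 (Finset.mem_image.2 ⟨P.1, ?_, ?_⟩)
    · rw [Set.Finite.mem_toFinset]
      exact ⟨⟨hP0, hPp, hPg, hin⟩, hne⟩
    · exact dif_pos (⟨hP0, hPg⟩ : P.1 ≠ ⊥ ∧ ∀ g : L ≃ₐ[K] L, g • P.1 = P.1)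

end count
lemma card_sub_le_of_rel {W T : Type*} [CommGroup W] [Finite W] [Finite T]
    (P Q : W → Prop) (R : W → T → Prop) (hR : ∀ c, P c → ∃ t, R c t)
    (hf : ∀ c d t, P c → P d → R c t → R d t → Q (c / d)) :
    Nat.card {c // P c} ≤ Nat.card {a // Q a} * Nat.card T := by
  choose f hfR using fun c : {c // P c} => hR c.1 c.2
  exact card_sub_le_of_choice P Q f fun c d h =>
    hf c.1 d.1 (f c) c.2 d.2 (hfR c) (by rw [h]; exact hfR d)

section fixedclasses

variable {K L : Type} [Field K] [NumberField K] [Field L] [NumberField L] [Algebra K L]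

/-- The norm relation attached to a fixed class. -/
def HasUnit (σ : L ≃ₐ[K] L) (c : ClassGroup (𝓞 L)) (ε : (𝓞 K)ˣ) : Prop :=
  ∃ (I : (Ideal (𝓞 L))⁰) (a b : 𝓞 L), ClassGroup.mk0 I = c ∧ a ≠ 0 ∧ b ≠ 0 ∧
    Ideal.span {a} * σ • I.1 = Ideal.span {b} * I.1 ∧
    Algebra.norm K (b : L) = (ε : K) * Algebra.norm K (a : L)

lemma exists_hasUnit (σ : L ≃ₐ[K] L) (c : ClassGroup (𝓞 L))
    (hc : ClassGroup.IsFixedBy (RingOfIntegers.mapRingEquiv σ) c) : ∃ ε, HasUnit σ c ε := by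
  obtain ⟨I, hI⟩ := ClassGroup.mk0_surjective c
  have h1 := hc I hI
  rw [← hI, ClassGroup.mk0_eq_mk0_iff] at h1
  obtain ⟨a, b, ha, hb, hab⟩ := h1
  obtain ⟨ε, hε⟩ := exists_unit σ I.1 (nonZeroDivisors.coe_ne_zero I) a b hab
  exact ⟨ε, I, a, b, hI, ha, hb, hab, hε⟩

lemma card_fixed_le (p : ℕ) (hp : p ≠ 0) [IsGalois K L] [IsCyclic (L ≃ₐ[K] L)]
    (hdeg : Module.finrank K L = p) (σ : L ≃ₐ[K] L) (hσ : ∀ x, x ∈ Subgroup.zpowers σ)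
    (F : ClassGroup (𝓞 L) → Prop)
    (hF : ∀ c, F c → ClassGroup.IsFixedBy (RingOfIntegers.mapRingEquiv σ) c) :
    Nat.card {c : ClassGroup (𝓞 L) // F c ∧ c ^ p = 1} ≤
      Nat.card {c : ClassGroup (𝓞 L) // c ∈ invClasses K L ∧ c ^ p = 1} *
      Nat.card (ZMod p × (Fin (NumberField.Units.rank K) → ZMod p)) := by
  have : NeZero p := ⟨hp⟩
  obtain ⟨f, hf⟩ := unit_choice p hp K
  refine card_sub_le_of_rel _ _ (fun c t => ∃ ε, HasUnit σ c ε ∧ f ε = t) ?_ ?_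
  · intro c hc
    obtain ⟨ε, hε⟩ := exists_hasUnit σ c (hF c hc.1)
    exact ⟨f ε, ε, hε, rfl⟩
  · rintro c d t hc hd ⟨ε, ⟨I, a, b, hI, ha, hb, hab, hε⟩, h1⟩
      ⟨ε', ⟨I', a', b', hI', ha', hb', hab', hε'⟩, h2⟩
    obtain ⟨η, hη⟩ := hf ε ε' (h1.trans h2.symm)
    refine ⟨?_, by rw [div_pow, hc.2, hd.2, div_one]⟩
    rw [← hI, ← hI']
    exact step1 p hdeg σ hσ I I' a b a' b' ha hb ha' hb' hab hab' ε ε' η hε hε' hη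

end fixedclasses

lemma final_aux (p : ℕ) (hp : p.Prime) (hpodd : Odd p)
    (K L : Type) [Field K] [NumberField K] [Field L] [NumberField L] [Algebra K L]
    [IsGalois K L] [IsCyclic (L ≃ₐ[K] L)]
    (hrank : NumberField.Units.rank K + 1 = (p - 1) / 2)
    (hdeg : Module.finrank K L = p) (σ : L ≃ₐ[K] L) (hσg : ∀ x, x ∈ Subgroup.zpowers σ)
    (hcardinv : Nat.card {a : invClasses K L // a ^ p = 1} ≤
      Nat.card {v : ClassGroup (𝓞 K) // v ^ p = 1} * p ^ (p - 1)) :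
    (Nat.card {c : ClassGroup (𝓞 L) //
        (∀ σ : L ≃ₐ[K] L, ClassGroup.IsFixedBy (RingOfIntegers.mapRingEquiv σ) c) ∧
        c ^ p = 1}).factorization p
      ≤ pRank p (ClassGroup (𝓞 K)) + 3 * (p - 1) / 2 := by
  have hle := card_fixed_le p hp.ne_zero hdeg σ hσg
    (fun c => ∀ σ : L ≃ₐ[K] L, ClassGroup.IsFixedBy (RingOfIntegers.mapRingEquiv σ) c)
    (by
      intro c hc
      have h := hc σ
      exact h)
  have hT : Nat.card (ZMod p × (Fin (NumberField.Units.rank K) → ZMod p)) = p ^ ((p - 1) / 2) := by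
    rw [Nat.card_prod, Nat.card_fun, Nat.card_zmod, Nat.card_eq_fintype_card, Fintype.card_fin,
      ← hrank, pow_succ, mul_comm]
  have hQ : Nat.card {c : ClassGroup (𝓞 L) // c ∈ invClasses K L ∧ c ^ p = 1} =
      Nat.card {x : invClasses K L // x ^ p = 1} := by
    refine Nat.card_congr
      { toFun := fun c => ⟨⟨c.1, c.2.1⟩, Subtype.ext c.2.2⟩
        invFun := fun x => ⟨x.1.1, x.1.2, congrArg Subtype.val x.2⟩
        left_inv := fun c => rfl
        right_inv := fun x => rfl }
  rw [hT, hQ] at hle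
  -- the `p`-torsion of the class group of `K` has `p`-power order
  have hV : Nat.card {v : ClassGroup (𝓞 K) // v ^ p = 1} = p ^ pRank p (ClassGroup (𝓞 K)) := by
    have : Fact p.Prime := ⟨hp⟩
    have hG : IsPGroup p (powMonoidHom p : ClassGroup (𝓞 K) →* ClassGroup (𝓞 K)).ker := by
      intro x
      refine ⟨1, ?_⟩
      rw [pow_one]
      exact Subtype.ext x.2
    obtain ⟨n, hn⟩ := IsPGroup.iff_card.1 hG
    have hn' : Nat.card {v : ClassGroup (𝓞 K) // v ^ p = 1} = p ^ n := hn
    unfold pRank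
    rw [hn', hp.factorization_pow, Finsupp.single_eq_same]
  have hne : Nat.card {c : ClassGroup (𝓞 L) //
      (∀ σ : L ≃ₐ[K] L, ClassGroup.IsFixedBy (RingOfIntegers.mapRingEquiv σ) c) ∧
        c ^ p = 1} ≠ 0 := by
    have : Nonempty {c : ClassGroup (𝓞 L) //
        (∀ σ : L ≃ₐ[K] L, ClassGroup.IsFixedBy (RingOfIntegers.mapRingEquiv σ) c) ∧
          c ^ p = 1} := by
      refine ⟨1, fun τ J hJ => ?_, one_pow _⟩
      rw [ClassGroup.mk0_eq_one_iff] at hJ ⊢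
      obtain ⟨x, hx⟩ := hJ
      refine ⟨τ • x, ?_⟩
      change τ • J.1 = _
      rw [hx]
      exact smul_span τ x
    exact Nat.card_pos.ne'
  generalize Nat.card {c : ClassGroup (𝓞 L) //
      (∀ σ : L ≃ₐ[K] L, ClassGroup.IsFixedBy (RingOfIntegers.mapRingEquiv σ) c) ∧
        c ^ p = 1} = M at hle hne ⊢
  generalize pRank p (ClassGroup (𝓞 K)) = r at hV ⊢
  rw [hV] at hcardinv
  have hfac := Nat.le_of_dvd (Nat.pos_of_ne_zero hne) (Nat.ordProj_dvd M p)
  have hfinal := hfac.trans (hle.trans (Nat.mul_le_mul_right _ hcardinv))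
  rw [← pow_add, ← pow_add] at hfinal
  have h3 := (Nat.pow_le_pow_iff_right hp.one_lt).1 hfinal
  obtain ⟨k, hk⟩ := hpodd
  omega

/-- Let `p` be an odd prime and `N ≠ p` a prime with `N ≡ 1 (mod p)`;
let `K = ℚ(ζ_p)`, `L = ℚ(ζ_p, N^{1/p})` and `G = Gal(L/K)`.  Then
`rk_p(Cl(L)^G) ≤ rk_p(Cl(K)) + (3/2)(p-1)`.  The `p`-rank of the fixed subgroup `Cl(L)^G`
is computed as the exponent of `p` in the cardinality of its `p`-torsion. -/
theorem stmt4 (p N : ℕ) (hp : p.Prime) (hpodd : Odd p) (hN : N.Prime) (hNp : N ≠ p)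
    (hmod : N ≡ 1 [MOD p])
    (K L : Type) [Field K] [NumberField K] [Field L] [NumberField L] [Algebra K L]
    (ζ : K) (hζ : IsPrimitiveRoot ζ p)
    (hKgen : Algebra.adjoin ℚ {ζ} = (⊤ : Subalgebra ℚ K))
    (α : L) (hα : α ^ p = (N : L))
    (hLgen : Algebra.adjoin K {α} = (⊤ : Subalgebra K L)) :
    (Nat.card {c : ClassGroup (𝓞 L) //
        (∀ σ : L ≃ₐ[K] L, ClassGroup.IsFixedBy (RingOfIntegers.mapRingEquiv σ) c) ∧
        c ^ p = 1}).factorization p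
      ≤ pRank p (ClassGroup (𝓞 K)) + 3 * (p - 1) / 2 := by
  classical
  have : NeZero p := ⟨hp.ne_zero⟩
  have hcyc : IsCyclotomicExtension {p} ℚ K := cyclo_inst p hp K ζ hζ hKgen
  have hK := finrank_cyclo p hp K
  have hrank := rank_cyclo p hp hpodd K
  obtain ⟨hgal, hcy, hcard, hdeg, σ, hσg, hσ⟩ := kummer_facts p N hp hN K L ζ hζ hK α hα hLgen
  have hdegL : Module.finrank ℚ L = p * (p - 1) := by
    rw [← Module.finrank_mul_finrank ℚ K L, hK, hdeg, mul_comm]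
  have hαint : IsIntegral ℤ α := by
    refine IsIntegral.of_pow hp.pos ?_
    rw [hα]
    exact map_natCast (algebraMap ℤ L) N ▸ isIntegral_algebraMap
  obtain ⟨β, hβ⟩ : ∃ β : 𝓞 L, (β : L) = α := ⟨⟨α, hαint⟩, rfl⟩
  have hβp : β ^ p = (N : 𝓞 L) := by
    apply RingOfIntegers.ext
    change (β : L) ^ p = _
    rw [hβ, hα]
    exact (map_natCast (algebraMap (𝓞 L) L) N).symm
  have hcardinv := card_inv_le p N hp hN hcard hdegL ζ hζ β hβp σ hσg (by rw [hβ, hσ])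
  exact final_aux p hp hpodd K L hrank hdeg σ hσg hcardinv
end

section
/- Let p be a regular prime (p odd and p does not divide the class number of Q(ζ_p)) and N a prime with N ≡ 1 (mod p). Let G = Gal(L/K) act on the ideal class group Cl(L), and let Cl(L)^G denote the subgroup of classes fixed by every element of G. Then rk_p(Cl(L)^G) ≤ p - 2. -/
open NumberField Polynomial
open scoped nonZeroDivisors

open NumberField Polynomial
open scoped nonZeroDivisors

namespace Amb

/-- comparison of relative indices through a relation -/
lemma relIndex_le_of_rel {G H : Type*} [Group G] [Group H] (A B : Subgroup G) (C D : Subgroup H)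
    (hfin : C.relIndex D ≠ 0) (R : G → H → Prop) (hR : ∀ x ∈ B, ∃ y ∈ D, R x y)
    (hinj : ∀ x ∈ B, ∀ x' ∈ B, ∀ y ∈ D, ∀ y' ∈ D, R x y → R x' y' → y⁻¹ * y' ∈ C → x⁻¹ * x' ∈ A) :
    A.relIndex B ≤ C.relIndex D ∧ A.relIndex B ≠ 0 := by
  choose! f hf hf' using hR
  let F : (B ⧸ A.subgroupOf B) → (D ⧸ C.subgroupOf D) := fun q =>
    QuotientGroup.mk ⟨f (Quotient.out q : B), hf _ (Quotient.out q : B).2⟩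
  have hF : Function.Injective F := by
    intro q q' h
    rw [QuotientGroup.eq, Subgroup.mem_subgroupOf] at h
    have := hinj _ (Quotient.out q : B).2 _ (Quotient.out q' : B).2 _ (hf _ (Quotient.out q : B).2) _ (hf _ (Quotient.out q' : B).2) (hf' _ (Quotient.out q : B).2) (hf' _ (Quotient.out q' : B).2) h
    rw [← Quotient.out_eq q, ← Quotient.out_eq q']
    exact QuotientGroup.eq.mpr (Subgroup.mem_subgroupOf.mpr this)
  have : Finite (D ⧸ C.subgroupOf D) := by
    have : Nat.card (D ⧸ C.subgroupOf D) ≠ 0 := hfin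
    exact (Nat.card_ne_zero.mp this).2
  have : Finite (B ⧸ A.subgroupOf B) := Finite.of_injective F hF
  refine ⟨Nat.card_le_card_of_injective F hF, ?_⟩
  have : Nat.card (B ⧸ A.subgroupOf B) ≠ 0 := Nat.card_ne_zero.mpr ⟨inferInstance, inferInstance⟩
  exact this

section abs
variable {U I : Type*} [CommGroup U] [CommGroup I]

/-- the twisted difference `x ↦ σ x / x` -/
def delta (σ : U →* U) : U →* U := σ / MonoidHom.id U

lemma delta_apply (σ : U →* U) (x : U) : delta σ x = σ x / x := rfl

/-- the norm -/
def nu (p : ℕ) (σ : U →* U) : U →* U where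
  toFun x := ∏ i ∈ Finset.range p, (σ^[i]) x
  map_one' := by simp
  map_mul' x y := by simp [iterate_map_mul, Finset.prod_mul_distrib]

lemma nu_apply (p : ℕ) (σ : U →* U) (x : U) : nu p σ x = ∏ i ∈ Finset.range p, (σ^[i]) x := rfl

/-- fixed points -/
def fixd (σ : U →* U) : Subgroup U := (delta σ).ker

lemma mem_fixd {σ : U →* U} {x : U} : x ∈ fixd σ ↔ σ x = x := by
  rw [fixd, MonoidHom.mem_ker, delta_apply, div_eq_one]

lemma nu_delta (p : ℕ) (σ : U →* U) (hσ : ∀ x, σ^[p] x = x) (x : U) : nu p σ (delta σ x) = 1 := by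
  rw [delta_apply, nu_apply]
  have : ∀ i, σ^[i] (σ x / x) = σ^[i+1] x / σ^[i] x := fun i => by
    rw [iterate_map_div, Function.iterate_succ_apply]
  simp_rw [this]
  rw [Finset.prod_range_div (fun i => σ^[i] x), hσ]
  simp

lemma sigma_nu (p : ℕ) (σ : U →* U) (hσ : ∀ x, σ^[p] x = x) (x : U) : σ (nu p σ x) = nu p σ x := by
  rw [← div_eq_one, nu_apply, map_prod]
  simp_rw [← Function.iterate_succ_apply' ]
  rw [← Finset.prod_div_distrib, Finset.prod_range_div (fun i => σ^[i] x), hσ]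
  simp

lemma nu_fixd (p : ℕ) (σ : U →* U) {x : U} (hx : σ x = x) : nu p σ x = x ^ p := by
  rw [nu_apply]
  have : ∀ i, σ^[i] x = x := fun i => Function.iterate_fixed hx i
  simp [this]

/-- The counting core of the ambiguous class number formula. -/
theorem core (p t j : ℕ) (σ : U →* U) (s : I →* I) (dv : U →* I)
    (hσ : ∀ x, σ^[p] x = x) (hs : ∀ x, s^[p] x = x) (hdv : ∀ x, s (dv x) = dv (σ x))
    (h90 : ∀ x, nu p σ x = 1 → ∃ y, x = delta σ y)
    (CI Z : Subgroup I)
    (hCI : ∀ J, J ∈ CI ↔ (∃ a, s J = J * dv a) ∧ J ^ p ∈ dv.range)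
    (hZ : ∀ J, J ∈ Z ↔ s J = J ∧ J ^ p ∈ dv.range)
    (hz0 : ((fixd σ).map dv).relIndex Z ≠ 0)
    (hz : ((fixd σ).map dv).relIndex Z ≤ p ^ t)
    (hE0 : (dv.ker.map (nu p σ)).relIndex (dv.ker ⊓ fixd σ) ≠ 0)
    (hH1 : p * (dv.ker.map (nu p σ)).relIndex (dv.ker ⊓ fixd σ) ≤
      (dv.ker.map (delta σ)).relIndex (dv.ker ⊓ (nu p σ).ker))
    (hU : p ^ j ≤ (nu p σ).range.relIndex (dv.ker ⊓ fixd σ)) :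
    dv.range.relIndex CI * p ^ (j + 1) ≤ p ^ t := by
  set P := dv.range with hP
  set E := dv.ker with hE
  set F := fixd σ
  set PK := F.map dv
  set ν := nu p σ
  set EK := E ⊓ F
  have hsdv : ∀ (i : ℕ) x, s^[i] (dv x) = dv (σ^[i] x) := by
    intro i x
    induction i with
    | zero => rfl
    | succ n ih => rw [Function.iterate_succ_apply', ih, hdv, Function.iterate_succ_apply']
  have hdvν : ∀ J a, s J = J * dv a → dv (ν a) = 1 := by
    intro J a h
    have key : ∀ n, s^[n] J = J * dv (∏ i ∈ Finset.range n, σ^[i] a) := by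
      intro n
      induction n with
      | zero => simp
      | succ n ih =>
        rw [Function.iterate_succ_apply, h, iterate_map_mul, hsdv, ih,
          Finset.prod_range_succ, map_mul, mul_assoc]
    have := key p
    rw [hs] at this
    rw [nu_apply]
    exact (mul_eq_left.mp this.symm)
  have hνE : E.map ν ≤ EK := by
    rintro _ ⟨e, he, rfl⟩
    refine ⟨hdvν 1 e (by simp [MonoidHom.mem_ker.mp he]), mem_fixd.mpr (sigma_nu p σ hσ e)⟩
  have hPKP : PK ≤ P := by
    rintro _ ⟨e, he, rfl⟩
    exact ⟨e, rfl⟩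
  have hPKZ : PK ≤ Z := by
    rintro _ ⟨e, he, rfl⟩
    rw [hZ, hdv, mem_fixd.mp he]
    exact ⟨rfl, e ^ p, by simp⟩
  have hZCI : Z ≤ CI := by
    intro J hJ
    rw [hCI]
    rw [hZ] at hJ
    exact ⟨⟨1, by simp [hJ.1]⟩, hJ.2⟩
  have hPCI : P ≤ CI := by
    rintro _ ⟨e, rfl⟩
    rw [hCI, hdv]
    exact ⟨⟨σ e / e, by simp⟩, e ^ p, by simp⟩
  -- step 1
  have e1 : P.relIndex (P ⊔ Z) * (P ⊔ Z).relIndex CI = P.relIndex CI :=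
    Subgroup.relIndex_mul_relIndex _ _ _ le_sup_left (sup_le hPCI hZCI)
  have e2 : P.relIndex (P ⊔ Z) = P.relIndex Z := by
    rw [sup_comm]; exact Subgroup.relIndex_sup_right _ _
  have e3 : PK.relIndex (P ⊓ Z) * (P ⊓ Z).relIndex Z = PK.relIndex Z :=
    Subgroup.relIndex_mul_relIndex _ _ _ (le_inf hPKP hPKZ) inf_le_right
  rw [Subgroup.inf_relIndex_right] at e3
  have e4 : (E.map ν).relIndex (ν.range ⊓ EK) * (ν.range ⊓ EK).relIndex EK = (E.map ν).relIndex EK :=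
    Subgroup.relIndex_mul_relIndex _ _ _ (le_inf (Subgroup.map_le_range _ _) hνE) inf_le_right
  rw [Subgroup.inf_relIndex_right] at e4
  have h1 : (P ⊔ Z).relIndex CI ≤ (E.map ν).relIndex (ν.range ⊓ EK) := by
    refine (relIndex_le_of_rel _ _ _ _ ?_ (fun J u => ∃ a, s J = J * dv a ∧ u = ν a) ?_ ?_).1
    · intro h; rw [h, zero_mul] at e4; exact hE0 e4.symm
    · intro J hJ
      obtain ⟨a, ha⟩ := ((hCI J).mp hJ).1
      exact ⟨ν a, ⟨⟨a, rfl⟩, hdvν J a ha, mem_fixd.mpr (sigma_nu p σ hσ a)⟩, a, ha, rfl⟩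
    · rintro J hJ J' hJ' _ - _ - ⟨a, ha, rfl⟩ ⟨b, hb, rfl⟩ ⟨e, he, h⟩
      have : ν (a⁻¹ * b * e⁻¹) = 1 := by rw [map_mul, map_mul, map_inv, map_inv, h]; simp
      obtain ⟨y, hy⟩ := h90 _ this
      have hh : s (J⁻¹ * J' * (dv y)⁻¹) = J⁻¹ * J' * (dv y)⁻¹ := by
        have hy' : dv (a⁻¹ * b * e⁻¹) = dv (delta σ y) := by rw [hy]
        rw [delta_apply, map_mul, map_inv, _root_.map_div, MonoidHom.mem_ker.mp he, map_mul, map_inv] at hy'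
        rw [map_mul, map_mul, map_inv, map_inv, ha, hb, hdv]
        have : dv (σ y) = (dv a)⁻¹ * dv b * dv y := by
          rw [← div_eq_iff_eq_mul, ← hy']; simp
        rw [this]
        simp only [mul_inv_rev, inv_inv]
        calc _ = J⁻¹ * J' * (dv y)⁻¹ * (((dv a)⁻¹ * dv a) * (dv b * (dv b)⁻¹)) := by
              simp only [mul_assoc, mul_comm, mul_left_comm]
          _ = _ := by simp
      have hJZ : J⁻¹ * J' * (dv y)⁻¹ ∈ Z := by
        rw [hZ]
        refine ⟨hh, ?_⟩
        rw [mul_pow, mul_pow]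
        refine mul_mem (mul_mem ?_ ((hCI J').mp hJ').2) ⟨(y⁻¹)^p, by simp⟩
        rw [inv_pow]
        exact inv_mem ((hCI J).mp hJ).2
      have := (P ⊔ Z).mul_mem (Subgroup.mem_sup_right hJZ) (Subgroup.mem_sup_left (⟨y, rfl⟩ : dv y ∈ P))
      simpa using this
  have h2 : (E.map (delta σ)).relIndex (E ⊓ ν.ker) ≤ PK.relIndex (P ⊓ Z) := by
    refine (relIndex_le_of_rel _ _ _ _ ?_ (fun m J => ∃ y, m = delta σ y ∧ J = dv y) ?_ ?_).1
    · intro h; rw [h, zero_mul] at e3; exact hz0 e3.symm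
    · intro m hm
      obtain ⟨y, hy⟩ := h90 m hm.2
      refine ⟨dv y, ⟨⟨y, rfl⟩, ?_⟩, y, hy, rfl⟩
      refine (hZ _).mpr ?_
      rw [hdv]
      refine ⟨?_, y ^ p, by simp⟩
      have : dv m = 1 := hm.1
      rw [hy, delta_apply, _root_.map_div, div_eq_one] at this
      exact this
    · rintro _ - _ - _ - _ - ⟨y, rfl, rfl⟩ ⟨y', rfl, rfl⟩ ⟨f, hf, h⟩
      refine ⟨y⁻¹ * y' * f⁻¹, ?_, ?_⟩
      · change dv _ = 1
        rw [map_mul, map_inv _ f, h]; simp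
      · have : delta σ f = 1 := hf
        rw [map_mul, map_inv _ f, this]
        simp
  -- conclusion
  have hz' := e3 ▸ hz
  rw [← e1, e2]
  set c1 := P.relIndex Z
  set c2 := (P ⊔ Z).relIndex CI
  set e := (E.map ν).relIndex EK
  set ee := (E.map ν).relIndex (ν.range ⊓ EK)
  set q := PK.relIndex (P ⊓ Z)
  set r := ν.range.relIndex EK
  have hee : 0 < ee := by
    rcases Nat.eq_zero_or_pos ee with h | h
    · rw [h, zero_mul] at e4; exact (hE0 e4.symm).elim
    · exact h
  refine Nat.le_of_mul_le_mul_right ?_ hee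
  calc c1 * c2 * p ^ (j + 1) * ee ≤ c1 * ee * p ^ (j + 1) * ee := by gcongr
    _ = c1 * (p * (ee * p ^ j)) * ee := by ring
    _ ≤ c1 * (p * (ee * r)) * ee := by gcongr
    _ ≤ c1 * q * ee := by
      gcongr
      rw [e4]
      exact hH1.trans h2
    _ = (q * c1) * ee := by ring
    _ ≤ p ^ t * ee := by gcongr

end abs
end Amb

open NumberField Polynomial
open scoped nonZeroDivisors

namespace Amb

lemma poly_identity (p : ℕ) (hp : p.Prime) :
    ∃ g : ℤ[X], (X - 1) ^ (p - 1) = ∑ i ∈ Finset.range p, X ^ i + C (p : ℤ) * g := by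
  have := Fact.mk hp
  have h : C (p : ℤ) ∣ (X - 1 : ℤ[X]) ^ (p - 1) - ∑ i ∈ Finset.range p, X ^ i := by
    rw [Polynomial.C_dvd_iff_dvd_coeff]
    intro i
    rw [← ZMod.intCast_zmod_eq_zero_iff_dvd _ p]
    have key : ((X - 1 : ℤ[X]) ^ (p - 1) - ∑ i ∈ Finset.range p, X ^ i).map (Int.castRingHom (ZMod p)) = 0 := by
      have hX : (X - 1 : (ZMod p)[X]) ≠ 0 := by
        have := Polynomial.X_sub_C_ne_zero (1 : ZMod p)
        simpa using this
      refine mul_right_cancel₀ hX ?_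
      simp only [Polynomial.map_sub, Polynomial.map_pow, Polynomial.map_X, Polynomial.map_one,
        Polynomial.map_sum]
      rw [zero_mul, sub_mul, geom_sum_mul, ← pow_succ, Nat.sub_add_cancel hp.one_le, sub_pow_char,
        one_pow, sub_self]
    have := congrArg (fun f => Polynomial.coeff f i) key
    rwa [Polynomial.coeff_map, Polynomial.coeff_zero] at this
  obtain ⟨g, hg⟩ := h
  exact ⟨g, by rw [← hg]; ring⟩

section abs
variable {U : Type*} [CommGroup U]

lemma delta_iter_mem (p : ℕ) (hp : p.Prime) (σ : U →* U) (M : Subgroup U)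
    (hσM : ∀ x ∈ M, σ x ∈ M) (hν : ∀ x ∈ M, nu p σ x = 1) (m : U) (hm : m ∈ M) :
    (delta σ)^[p - 1] m ∈ M.map (powMonoidHom p) := by
  obtain ⟨g, hg⟩ := poly_identity p hp
  let s : Module.End ℤ (Additive U) := (MonoidHom.toAdditive σ).toIntLinearMap
  have hs : ∀ x, s (Additive.ofMul x) = Additive.ofMul (σ x) := fun x => rfl
  have hs1 : ∀ x, (s - 1) (Additive.ofMul x) = Additive.ofMul (delta σ x) := fun x => rfl
  have hpow : ∀ n x, (s ^ n) (Additive.ofMul x) = Additive.ofMul (σ^[n] x) := by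
    intro n
    induction n with
    | zero => intro x; rfl
    | succ n ih => intro x; rw [pow_succ, Module.End.mul_apply, hs, ih, Function.iterate_succ_apply]
  have hpow1 : ∀ n x, ((s - 1) ^ n) (Additive.ofMul x) = Additive.ofMul ((delta σ)^[n] x) := by
    intro n
    induction n with
    | zero => intro x; rfl
    | succ n ih => intro x; rw [pow_succ, Module.End.mul_apply, hs1, ih, Function.iterate_succ_apply]
  have hsM : ∀ x ∈ M.toAddSubgroup, s x ∈ M.toAddSubgroup := fun x hx => hσM x hx
  have hgM : ∀ (f : ℤ[X]), ∀ x ∈ M.toAddSubgroup, (aeval s f) x ∈ M.toAddSubgroup := by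
    intro f
    induction f using Polynomial.induction_on with
    | C a =>
      intro x hx
      rw [aeval_C]
      rw [Module.algebraMap_end_apply]
      exact zsmul_mem hx a
    | add f g hf hg =>
      intro x hx
      rw [map_add]
      exact add_mem (hf x hx) (hg x hx)
    | monomial n a ih =>
      intro x hx
      rw [pow_succ, ← mul_assoc, map_mul, Module.End.mul_apply, aeval_X]
      exact ih _ (hsM x hx)
  have h := congrArg (fun f => (aeval s f) (Additive.ofMul m)) hg
  simp only [map_add, map_mul, map_pow, map_sub, aeval_X, map_one, map_sum, aeval_C] at h
  rw [hpow1] at h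
  refine ⟨Additive.toMul ((aeval s g) (Additive.ofMul m)), hgM g _ hm, ?_⟩
  apply Additive.ofMul.injective
  rw [h]
  rw [LinearMap.add_apply, LinearMap.sum_apply, Module.End.mul_apply, Module.algebraMap_end_apply]
  simp_rw [hpow]
  rw [← ofMul_prod, ← nu_apply, hν m hm]
  simp
  

lemma iter_index (f : U →* U) (M : Subgroup U) (hf : ∀ x ∈ M, f x ∈ M)
    (h0 : (M.map f).relIndex M ≠ 0) (n : ℕ) :
    ∃ H : Subgroup U, (∀ x, x ∈ H ↔ ∃ m ∈ M, x = f^[n] m) ∧ H ≤ M ∧ H.relIndex M ≠ 0 ∧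
      H.relIndex M ≤ ((M.map f).relIndex M) ^ n := by
  induction n with
  | zero => exact ⟨M, fun x => by simp, le_rfl, by simp, by simp⟩
  | succ n ih =>
    obtain ⟨H, hH, hHM, hH0, hHn⟩ := ih
    have hle : M.map f ≤ M := by rintro _ ⟨x, hx, rfl⟩; exact hf x hx
    have key : (H.map f).relIndex (M.map f) ≤ H.relIndex M ∧ (H.map f).relIndex (M.map f) ≠ 0 := by
      refine relIndex_le_of_rel _ _ _ _ hH0 (fun x y => x = f y) ?_ ?_
      · rintro _ ⟨y, hy, rfl⟩
        exact ⟨y, hy, rfl⟩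
      · rintro _ - _ - y - y' - rfl rfl h
        exact ⟨_, h, by simp⟩
    have e := Subgroup.relIndex_mul_relIndex _ _ _ (Subgroup.map_mono (f := f) hHM) hle
    refine ⟨H.map f, ?_, (Subgroup.map_mono hHM).trans hle, ?_, ?_⟩
    · intro x
      constructor
      · rintro ⟨y, hy, rfl⟩
        obtain ⟨m, hm, rfl⟩ := (hH y).mp hy
        exact ⟨m, hm, by rw [Function.iterate_succ_apply']⟩
      · rintro ⟨m, hm, rfl⟩
        exact ⟨_, (hH _).mpr ⟨m, hm, rfl⟩, by rw [Function.iterate_succ_apply']⟩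
    · rw [← e]; exact mul_ne_zero key.2 h0
    · rw [← e, pow_succ]
      gcongr
      exact key.1.trans hHn

theorem herb (p r k : ℕ) (hp : p.Prime) (σ : U →* U) (hσ : ∀ x, σ^[p] x = x) (E : Subgroup U)
    (hσE : ∀ x ∈ E, σ x ∈ E)
    (hM : ((E ⊓ (nu p σ).ker).map (powMonoidHom p)).relIndex (E ⊓ (nu p σ).ker) = p ^ k)
    (hk : (p - 1) * (r + 1) + 1 ≤ k)
    (hEK : ((E ⊓ fixd σ).map (powMonoidHom p)).relIndex (E ⊓ fixd σ) ≤ p ^ (r + 1))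
    (hEK0 : ((E ⊓ fixd σ).map (powMonoidHom p)).relIndex (E ⊓ fixd σ) ≠ 0) :
    p * (E.map (nu p σ)).relIndex (E ⊓ fixd σ) ≤ (E.map (delta σ)).relIndex (E ⊓ (nu p σ).ker) ∧
    (E.map (nu p σ)).relIndex (E ⊓ fixd σ) ≠ 0 := by
  set ν := nu p σ
  set M := E ⊓ ν.ker
  set EK := E ⊓ fixd σ
  set δ := delta σ
  have hiter : ∀ n, ∀ x ∈ E, σ^[n] x ∈ E := by
    intro n
    induction n with
    | zero => intro x hx; exact hx
    | succ n ih => intro x hx; rw [Function.iterate_succ_apply]; exact ih _ (hσE x hx)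
  have hδE : ∀ x ∈ E, δ x ∈ M := fun x hx => ⟨E.div_mem (hσE x hx) hx, nu_delta p σ hσ x⟩
  have hσM : ∀ x ∈ M, σ x ∈ M := by
    intro x hx
    have := mul_mem (hδE x hx.1) hx
    simpa [δ, delta_apply] using this
  have hνE : ∀ x ∈ E, ν x ∈ EK := by
    intro x hx
    refine ⟨?_, mem_fixd.mpr (sigma_nu p σ hσ x)⟩
    change nu p σ x ∈ E
    rw [nu_apply]
    exact prod_mem fun i _ => hiter i x hx
  have hMpM : M.map (powMonoidHom p) ≤ M.map δ := by
    rintro _ ⟨m, hm, rfl⟩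
    have h1 : ∀ n, σ^[n] m / m ∈ M.map δ := by
      intro n
      induction n with
      | zero => simp
      | succ n ih =>
        have hmn : σ^[n] m ∈ M := by
          have := mul_mem (show σ^[n] m / m ∈ M from by
            obtain ⟨y, hy, h⟩ := ih
            rw [← h]; exact hδE y hy.1) hm
          simpa using this
        have := mul_mem (⟨_, hmn, rfl⟩ : δ (σ^[n] m) ∈ M.map δ) ih
        rw [delta_apply, div_mul_div_cancel, ← Function.iterate_succ_apply' (⇑σ)] at this
        exact this
    have h2 : ν m / m ^ p ∈ M.map δ := by
      have : ν m / m ^ p = ∏ i ∈ Finset.range p, (σ^[i] m / m) := by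
        rw [Finset.prod_div_distrib, ← nu_apply]; simp [ν]
      rw [this]
      exact prod_mem fun i _ => h1 i
    have h3 : ν m = 1 := hm.2
    rw [h3, one_div] at h2
    exact inv_mem_iff.mp h2
  have hδM : M.map δ ≤ M := by rintro _ ⟨x, hx, rfl⟩; exact hδE x hx.1
  have e0 := Subgroup.relIndex_mul_relIndex _ _ _ hMpM hδM
  have hdvd : (M.map δ).relIndex M ∣ p ^ k := by rw [← hM, ← e0]; exact dvd_mul_left _ _
  obtain ⟨a, -, ha⟩ := (Nat.dvd_prime_pow hp).mp hdvd
  have ha0 : (M.map δ).relIndex M ≠ 0 := by rw [ha]; exact pow_ne_zero _ hp.ne_zero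
  have har : r + 2 ≤ a := by
    obtain ⟨H, hH, hHM, hH0, hHn⟩ := iter_index δ M (fun x hx => hδE x hx.1) ha0 (p - 1)
    have hHp : H ≤ M.map (powMonoidHom p) := by
      intro x hx
      obtain ⟨m, hm, rfl⟩ := (hH x).mp hx
      exact delta_iter_mem p hp σ M hσM (fun x hx => hx.2) m hm
    have hpMM : M.map (powMonoidHom p) ≤ M := hMpM.trans hδM
    have e := Subgroup.relIndex_mul_relIndex _ _ _ hHp hpMM
    have : p ^ k ≤ H.relIndex M := by
      rw [← hM]
      exact Nat.le_of_dvd (Nat.pos_of_ne_zero hH0) (by rw [← e]; exact dvd_mul_left _ _)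
    rw [ha, ← pow_mul] at hHn
    have := (Nat.pow_le_pow_iff_right hp.one_lt).mp (this.trans hHn)
    by_contra hcon
    have : a * (p - 1) ≤ (r + 1) * (p - 1) := Nat.mul_le_mul_right _ (by omega)
    nlinarith
  have e1 := Subgroup.relIndex_mul_relIndex (M.map δ) (E.map δ) M (Subgroup.map_mono inf_le_left)
    (by rintro _ ⟨x, hx, rfl⟩; exact hδE x hx)
  have hEKν : EK.map ν = EK.map (powMonoidHom p) := by
    ext x
    constructor
    · rintro ⟨y, hy, rfl⟩
      exact ⟨y, hy, (nu_fixd p σ (mem_fixd.mp hy.2)).symm⟩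
    · rintro ⟨y, hy, rfl⟩
      exact ⟨y, hy, (nu_fixd p σ (mem_fixd.mp hy.2))⟩
  have e2 := Subgroup.relIndex_mul_relIndex (EK.map ν) (E.map ν) EK (Subgroup.map_mono inf_le_left)
    (by rintro _ ⟨x, hx, rfl⟩; exact hνE x hx)
  rw [hEKν] at e2
  have hne := hEK0
  rw [← e2] at hne
  have hb := left_ne_zero_of_mul hne
  have h3 : (M.map δ).relIndex (E.map δ) ≤ (EK.map (powMonoidHom p)).relIndex (E.map ν) := by
    refine (relIndex_le_of_rel _ _ _ _ hb (fun x y => ∃ e ∈ E, x = δ e ∧ y = ν e) ?_ ?_).1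
    · rintro _ ⟨e, he, rfl⟩
      exact ⟨ν e, ⟨e, he, rfl⟩, e, he, rfl, rfl⟩
    · rintro _ - _ - _ - _ - ⟨e, he, rfl, rfl⟩ ⟨e', he', rfl, rfl⟩ h
      rw [← hEKν] at h
      obtain ⟨f, hf, h⟩ := h
      refine ⟨e⁻¹ * e' * f⁻¹, ⟨E.mul_mem (E.mul_mem (E.inv_mem he) he') (E.inv_mem hf.1), ?_⟩, ?_⟩
      · change ν _ = 1
        rw [map_mul, map_inv _ f, h]; simp
      · have : δ f = 1 := hf.2
        rw [map_mul, map_inv _ f, this]; simp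
  refine ⟨?_, right_ne_zero_of_mul hne⟩
  set b := (EK.map (powMonoidHom p)).relIndex (E.map ν)
  refine Nat.le_of_mul_le_mul_left ?_ (Nat.pos_of_ne_zero hb)
  calc b * (p * (E.map ν).relIndex EK) = p * (b * (E.map ν).relIndex EK) := by ring
    _ ≤ p * p ^ (r + 1) := by rw [e2]; gcongr
    _ = p ^ (r + 2) := by ring
    _ ≤ p ^ a := Nat.pow_le_pow_right hp.pos har
    _ = (M.map δ).relIndex (E.map δ) * (E.map δ).relIndex M := by rw [e1, ha]
    _ ≤ b * (E.map δ).relIndex M := by gcongr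

end abs
end Amb

open NumberField Polynomial
open scoped nonZeroDivisors

namespace Amb

lemma add_index_free (p : ℕ) (hp : p.Prime) (n : ℕ) :
    (nsmulAddMonoidHom p : (Fin n →₀ ℤ) →+ (Fin n →₀ ℤ)).range.index = p ^ n := by
  have := NeZero.mk hp.ne_zero
  let f : (Fin n →₀ ℤ) →+ (Fin n → ZMod p) :=
    { toFun := fun x i => (x i : ZMod p)
      map_zero' := by ext; simp
      map_add' := fun x y => by ext; simp }
  have hf : Function.Surjective f := by
    intro y
    refine ⟨Finsupp.equivFunOnFinite.symm fun i => (ZMod.cast (y i) : ℤ), ?_⟩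
    ext i
    simp [f]
  have hk : (nsmulAddMonoidHom p : (Fin n →₀ ℤ) →+ (Fin n →₀ ℤ)).range = f.ker := by
    ext x
    rw [AddMonoidHom.mem_ker]
    constructor
    · rintro ⟨y, rfl⟩
      ext i
      simp [f]
    · intro h
      have h' : ∀ i, (p : ℤ) ∣ x i := by
        intro i
        rw [← ZMod.intCast_zmod_eq_zero_iff_dvd _ p]
        exact congrFun h i
      choose y hy using h'
      refine ⟨Finsupp.equivFunOnFinite.symm y, ?_⟩
      ext i
      simp [hy]
  rw [hk, AddSubgroup.index_ker, AddMonoidHom.range_eq_top.mpr hf]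
  simp

lemma add_index_aux (p : ℕ) (hp : p.Prime) (A T : Type*) [AddCommGroup A] [Module.Finite ℤ A]
    [AddCommGroup T] [Finite T] (n : ℕ) (f : A ≃+ (Fin n →₀ ℤ) × T) :
    (nsmulAddMonoidHom p : A →+ A).range.index =
      p ^ (Module.finrank ℤ A) * Nat.card (nsmulAddMonoidHom p : A →+ A).ker := by
  have hrank : Module.finrank ℤ A = n := by
    let g : A →ₗ[ℤ] (Fin n →₀ ℤ) := LinearMap.fst ℤ _ _ ∘ₗ f.toIntLinearEquiv.toLinearMap
    have hg : Function.Surjective g := fun x => ⟨f.symm (x, 0), by simp [g]⟩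
    have h1 : LinearMap.ker g ≤ Submodule.torsion ℤ A := by
      intro x hx
      have hx' : (f x).1 = 0 := hx
      refine (Submodule.mem_torsion_iff _).mpr ⟨⟨(Nat.card T : ℤ), mem_nonZeroDivisors_of_ne_zero
        (by exact_mod_cast (Nat.card_pos).ne')⟩, ?_⟩
      apply f.injective
      rw [map_zero]
      change f ((Nat.card T : ℤ) • x) = 0
      rw [map_zsmul, natCast_zsmul]
      refine Prod.ext ?_ ?_
      · simp [hx']
      · simp
    have h2 := rank_quotient_eq_of_le_torsion h1
    have h3 := (g.quotKerEquivOfSurjective hg).finrank_eq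
    rw [Module.finrank, ← h2]
    change Module.finrank ℤ (A ⧸ LinearMap.ker g) = n
    rw [h3]
    simp
  have hk : Nat.card (nsmulAddMonoidHom p : A →+ A).ker = Nat.card (nsmulAddMonoidHom p : T →+ T).ker := by
    refine Nat.card_congr ⟨fun x => ⟨(f x.1).2, ?_⟩, fun y => ⟨f.symm (0, y.1), ?_⟩, ?_, ?_⟩
    · have : p • x.1 = 0 := x.2
      change p • (f x.1).2 = 0
      rw [← Prod.smul_snd, ← map_nsmul, this]; simp
    · have : p • y.1 = 0 := y.2
      change p • f.symm (0, y.1) = 0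
      rw [← map_nsmul]; simp [this]
    · intro x
      ext
      have : p • x.1 = 0 := x.2
      have h2 : (f x.1).1 = 0 := by
        have h3 : p • (f x.1).1 = 0 := by
          rw [← Prod.smul_fst, ← map_nsmul, this]; simp
        exact (smul_eq_zero.mp h3).resolve_left hp.ne_zero
      apply f.injective
      simp only [AddEquiv.apply_symm_apply]
      exact Prod.ext h2.symm rfl
    · intro y
      ext
      simp
  have hi : (nsmulAddMonoidHom p : A →+ A).range.index =
      ((nsmulAddMonoidHom p : (Fin n →₀ ℤ) →+ (Fin n →₀ ℤ)).range.prod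
       (nsmulAddMonoidHom p : T →+ T).range).index := by
    have : (nsmulAddMonoidHom p : A →+ A).range =
      ((nsmulAddMonoidHom p : (Fin n →₀ ℤ) →+ (Fin n →₀ ℤ)).range.prod
       (nsmulAddMonoidHom p : T →+ T).range).comap f.toAddMonoidHom := by
      ext x
      constructor
      · rintro ⟨y, rfl⟩
        refine ⟨⟨(f y).1, ?_⟩, ⟨(f y).2, ?_⟩⟩ <;> simp
      · rintro ⟨⟨u, hu⟩, ⟨v, hv⟩⟩
        refine ⟨f.symm (u, v), ?_⟩
        apply f.injective
        change f (p • _) = _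
        rw [map_nsmul]
        simp only [AddEquiv.apply_symm_apply]
        exact Prod.ext hu hv
    rw [this, AddSubgroup.index_comap_of_surjective _ f.surjective]
  have ht : (nsmulAddMonoidHom p : T →+ T).range.index = Nat.card (nsmulAddMonoidHom p : T →+ T).ker := by
    have h1 := AddSubgroup.index_mul_card (nsmulAddMonoidHom p : T →+ T).range
    have h2 := AddSubgroup.card_mul_index (nsmulAddMonoidHom p : T →+ T).ker
    rw [AddSubgroup.index_ker] at h2
    rw [← h2] at h1
    exact Nat.eq_of_mul_eq_mul_right Nat.card_pos h1
  rw [hi, AddSubgroup.index_prod, add_index_free p hp, ht, hk, hrank]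

/-- index of `pA` versus size of `A[p]` for f.g. abelian groups -/
lemma add_index (p : ℕ) (hp : p.Prime) (A : Type*) [AddCommGroup A] [Module.Finite ℤ A] :
    (nsmulAddMonoidHom p : A →+ A).range.index =
      p ^ (Module.finrank ℤ A) * Nat.card (nsmulAddMonoidHom p : A →+ A).ker := by
  have : AddGroup.FG A := Module.Finite.iff_addGroup_fg.mp inferInstance
  obtain ⟨n, ι, _, q, hq, e, ⟨f⟩⟩ := AddCommGroup.equiv_free_prod_directSum_zmod A
  have : ∀ i, NeZero (q i ^ e i) := fun i => ⟨pow_ne_zero _ (hq i).ne_zero⟩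
  classical
  have hfin : Finite (DirectSum ι fun i => ZMod (q i ^ e i)) :=
    Finite.of_equiv _ (DirectSum.addEquivProd (fun i => ZMod (q i ^ e i))).symm.toEquiv
  exact add_index_aux p hp A _ n f

lemma pow_index {U : Type*} [CommGroup U] (p : ℕ) (hp : p.Prime) (A : Subgroup U)
    [Module.Finite ℤ (Additive A)] :
    (A.map (powMonoidHom p)).relIndex A =
      p ^ (Module.finrank ℤ (Additive A)) * Nat.card {x : U // x ∈ A ∧ x ^ p = 1} := by
  have h := add_index p hp (Additive A)
  have h1 : (A.map (powMonoidHom p)).relIndex A =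
      (nsmulAddMonoidHom p : Additive A →+ Additive A).range.index := by
    have : (A.map (powMonoidHom p)).subgroupOf A = (powMonoidHom p : A →* A).range := by
      ext x
      rw [Subgroup.mem_subgroupOf]
      constructor
      · rintro ⟨y, hy, h⟩
        exact ⟨⟨y, hy⟩, Subtype.ext h⟩
      · rintro ⟨y, rfl⟩
        exact ⟨y.1, y.2, rfl⟩
    rw [Subgroup.relIndex, this]
    rfl
  have h2 : Nat.card {x : U // x ∈ A ∧ x ^ p = 1} =
      Nat.card (nsmulAddMonoidHom p : Additive A →+ Additive A).ker := by
    refine Nat.card_congr ⟨fun x => ⟨Additive.ofMul ⟨x.1, x.2.1⟩, ?_⟩,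
      fun y => ⟨(Additive.toMul y.1).1, (Additive.toMul y.1).2, ?_⟩, fun x => rfl, fun x => rfl⟩
    · change Additive.ofMul ((⟨x.1, x.2.1⟩ : A) ^ p) = Additive.ofMul 1
      congr 1
      exact Subtype.ext x.2.2
    · have : p • y.1 = 0 := y.2
      have h3 := congrArg (fun z : Additive A => (Additive.toMul z).1) this
      exact h3
  rw [h1, h2, h]

lemma rank_ker {U : Type*} [CommGroup U] (A B : Subgroup U) (ν : U →* U) (hν : ∀ x ∈ A, ν x ∈ B)
    [Module.Finite ℤ (Additive A)] [Module.Finite ℤ (Additive B)] :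
    Module.Finite ℤ (Additive (A ⊓ ν.ker : Subgroup U)) ∧
    Module.finrank ℤ (Additive A) ≤
      Module.finrank ℤ (Additive (A ⊓ ν.ker : Subgroup U)) + Module.finrank ℤ (Additive B) := by
  let f0 : A →* B := (ν.comp A.subtype).codRestrict B (fun x => hν x x.2)
  let f : Additive A →ₗ[ℤ] Additive B := (MonoidHom.toAdditive f0).toIntLinearMap
  let g0 : (A ⊓ ν.ker : Subgroup U) →* A := Subgroup.inclusion inf_le_left
  let g : Additive (A ⊓ ν.ker : Subgroup U) →ₗ[ℤ] Additive A := (MonoidHom.toAdditive g0).toIntLinearMap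
  have hg : Function.Injective g := Subgroup.inclusion_injective inf_le_left
  have hk : LinearMap.ker f = LinearMap.range g := by
    ext x
    constructor
    · intro hx
      have hx' : f0 (Additive.toMul x) = 1 := hx
      exact ⟨Additive.ofMul ⟨(Additive.toMul x).1, (Additive.toMul x).2, congrArg Subtype.val hx'⟩, rfl⟩
    · rintro ⟨y, rfl⟩
      have : f0 (g0 (Additive.toMul y)) = 1 := Subtype.ext (Additive.toMul y).2.2
      exact this
  refine ⟨Module.Finite.of_injective g hg, ?_⟩
  have h1 := (LinearMap.ker f).finrank_quotient_add_finrank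
  have h2 := f.quotKerEquivRange.finrank_eq
  have h3 : Module.finrank ℤ (LinearMap.range f) ≤ Module.finrank ℤ (Additive B) := Submodule.finrank_le _
  have h4 : Module.finrank ℤ (LinearMap.range g) = Module.finrank ℤ (Additive (A ⊓ ν.ker : Subgroup U)) :=
    LinearMap.finrank_range_of_inj hg
  rw [h2, hk, h4] at h1
  omega

end Amb

open NumberField Polynomial
open scoped nonZeroDivisors

namespace Amb

/-- The arithmetic situation of the theorem, with a chosen generator `σ` of the Galois group. -/
structure Setup (p N : ℕ) (K L : Type) [Field K] [NumberField K] [Field L] [NumberField L]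
    [Algebra K L] (ζ : K) (α : L) (σ : L ≃ₐ[K] L) : Prop where
  hp : p.Prime
  hpodd : Odd p
  hN : N.Prime
  hNp : N ≠ p
  hmod : N ≡ 1 [MOD p]
  hζ : IsPrimitiveRoot ζ p
  cyc : IsCyclotomicExtension {p} ℚ K
  hreg : ¬ p ∣ Nat.card (ClassGroup (𝓞 K))
  hα : α ^ p = (N : L)
  degK : Module.finrank ℚ K = p - 1
  deg : Module.finrank K L = p
  gal : IsGalois K L
  gen : ∀ τ : L ≃ₐ[K] L, τ ∈ Subgroup.zpowers σ
  hσα : σ α = algebraMap K L ζ * α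

theorem exists_setup (p N : ℕ) (hp : p.Prime) (hpodd : Odd p) (hN : N.Prime) (hNp : N ≠ p)
    (hmod : N ≡ 1 [MOD p])
    (K L : Type) [Field K] [NumberField K] [Field L] [NumberField L] [Algebra K L]
    (ζ : K) (hζ : IsPrimitiveRoot ζ p)
    (hKgen : Algebra.adjoin ℚ {ζ} = (⊤ : Subalgebra ℚ K))
    (hreg : ¬ p ∣ Nat.card (ClassGroup (𝓞 K)))
    (α : L) (hα : α ^ p = (N : L))
    (hLgen : Algebra.adjoin K {α} = (⊤ : Subalgebra K L)) :
    ∃ σ : L ≃ₐ[K] L, Setup p N K L ζ α σ := by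
  have : NeZero p := ⟨hp.ne_zero⟩
  have cyc : IsCyclotomicExtension {p} ℚ K := by
    rw [IsCyclotomicExtension.iff_singleton]
    refine ⟨⟨ζ, hζ⟩, fun x => ?_⟩
    have hx : x ∈ Algebra.adjoin ℚ {ζ} := by rw [hKgen]; trivial
    refine Algebra.adjoin_mono ?_ hx
    rintro _ rfl
    exact hζ.pow_eq_one
  have degK : Module.finrank ℚ K = p - 1 := by
    rw [IsCyclotomicExtension.Rat.finrank p K, Nat.totient_prime hp]
  have hα' : α ^ p = algebraMap K L (N : K) := by rw [hα, map_natCast]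
  have hirr : Irreducible (X ^ p - C (N : K)) := by
    refine X_pow_sub_C_irreducible_of_prime hp ?_
    intro b hb
    have h := congrArg (Algebra.norm ℚ) hb
    rw [map_pow, show (N : K) = algebraMap ℚ K (N : ℚ) by simp, Algebra.norm_algebraMap, degK] at h
    have hIntg : IsIntegral ℤ b := by
      refine IsIntegral.of_pow hp.pos ?_
      rw [hb]
      rw [← map_natCast (algebraMap ℤ K) N]
      exact isIntegral_algebraMap
    have hIntg' := Algebra.isIntegral_norm ℚ hIntg
    obtain ⟨z, hz⟩ := (IsIntegrallyClosed.isIntegral_iff (R := ℤ) (K := ℚ)).mp hIntg'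
    rw [← hz] at h
    have h2 : z ^ p = (N : ℤ) ^ (p - 1) := by
      have : (algebraMap ℤ ℚ) (z ^ p) = (algebraMap ℤ ℚ) ((N : ℤ) ^ (p - 1)) := by
        rw [map_pow, h]; simp
      exact_mod_cast this
    have h3 : z.natAbs ^ p = N ^ (p - 1) := by
      rw [← Int.natAbs_pow, h2]; simp [Int.natAbs_pow]
    have h4 := congrArg (fun n => n.factorization N) h3
    simp only [Nat.factorization_pow, Finsupp.smul_apply, hN.factorization_self, smul_eq_mul, mul_one] at h4
    have h5 : p ∣ p - 1 := ⟨_, h4.symm⟩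
    have h6 := Nat.le_of_dvd (Nat.sub_pos_of_lt hp.one_lt) h5
    have := hp.one_lt
    omega
  have htop : IntermediateField.adjoin K {α} = ⊤ := by
    rw [← IntermediateField.toSubalgebra_injective.eq_iff]
    rw [IntermediateField.adjoin_simple_toSubalgebra_of_isAlgebraic (Algebra.IsAlgebraic.isAlgebraic α), hLgen]
    rfl
  have hIntg : IsIntegral K α := Algebra.IsIntegral.isIntegral α
  have hmin : minpoly K α = X ^ p - C (N : K) := by
    refine (minpoly.eq_of_irreducible_of_monic hirr ?_ (monic_X_pow_sub_C _ hp.ne_zero)).symm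
    simp [hα]
  have deg : Module.finrank K L = p := by
    rw [← IntermediateField.finrank_top', ← htop, IntermediateField.adjoin.finrank hIntg, hmin,
      natDegree_X_pow_sub_C]
  have hprim : (primitiveRoots p K).Nonempty := ⟨ζ, (mem_primitiveRoots hp.pos).mpr hζ⟩
  have hspl : IsSplittingField K L (X ^ p - C (N : K)) := by
    have := isSplittingField_X_pow_sub_C_of_root_adjoin_eq_top (K := K) (L := L) (a := (N : K))
      (α := α) (by rw [deg]; exact hprim) (by rw [deg]; exact hα') htop
    rwa [deg] at this
  have gal := isGalois_of_isSplittingField_X_pow_sub_C hprim hirr L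
  let e := autEquivZmod hirr L hζ
  refine ⟨e.symm (Multiplicative.ofAdd ((1 : ℕ) : ZMod p)), hp, hpodd, hN, hNp, hmod, hζ, cyc, hreg, hα,
    degK, deg, gal, ?_, ?_⟩
  · intro τ
    rw [Subgroup.mem_zpowers_iff]
    refine ⟨((e τ).toAdd.val : ℤ), ?_⟩
    apply e.injective
    rw [map_zpow, MulEquiv.apply_symm_apply, zpow_natCast, ← ofAdd_nsmul]
    simp
  · rw [autEquivZmod_symm_apply_natCast hirr L hα' hζ, pow_one, Algebra.smul_def]

variable {p N : ℕ} {K L : Type} [Field K] [NumberField K] [Field L] [NumberField L]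
    [Algebra K L] {ζ : K} {α : L} {σ : L ≃ₐ[K] L}

lemma Setup.order (S : Setup p N K L ζ α σ) : orderOf σ = p := by
  have := S.gal
  rw [orderOf_eq_card_of_forall_mem_zpowers S.gen, IsGalois.card_aut_eq_finrank, S.deg]

lemma Setup.pow_p (S : Setup p N K L ζ α σ) : σ ^ p = 1 := by
  rw [← S.order]; exact pow_orderOf_eq_one σ

lemma Setup.p3 (S : Setup p N K L ζ α σ) : 3 ≤ p := by
  have := S.hp.two_le
  obtain ⟨k, hk⟩ := S.hpodd
  omega

lemma Setup.totK (S : Setup p N K L ζ α σ) : IsTotallyComplex K := by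
  have := S.cyc
  have := S.p3
  have : NeZero p := ⟨S.hp.ne_zero⟩
  exact IsCyclotomicExtension.Rat.isTotallyComplex K (n := p) (by omega)

lemma Setup.rankK (S : Setup p N K L ζ α σ) : Units.rank K + 1 = (p - 1) / 2 := by
  have := S.totK
  have h := IsTotallyComplex.finrank K
  rw [S.degK] at h
  have h2 := InfinitePlace.card_eq_nrRealPlaces_add_nrComplexPlaces K
  have h3 := IsTotallyComplex.nrRealPlaces_eq_zero K
  have := S.p3
  rw [Units.rank]
  omega

lemma Setup.rankL (S : Setup p N K L ζ α σ) : Units.rank L + 1 = p * ((p - 1) / 2) := by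
  have := S.totK
  have : IsTotallyComplex L := isTotallyComplex_of_algebra K L
  have h := IsTotallyComplex.finrank L
  rw [← Module.finrank_mul_finrank ℚ K L, S.degK, S.deg] at h
  have h2 := InfinitePlace.card_eq_nrRealPlaces_add_nrComplexPlaces L
  have h3 := IsTotallyComplex.nrRealPlaces_eq_zero L
  have := S.p3
  obtain ⟨k, hk⟩ := S.hpodd
  subst hk
  have e1 : 2 * k + 1 - 1 = 2 * k := by omega
  rw [e1] at h ⊢
  have e2 : 2 * k / 2 = k := by omega
  rw [e2]
  have : 0 < Fintype.card (InfinitePlace L) := Fintype.card_pos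
  have : (2 * k + 1) * k = InfinitePlace.nrComplexPlaces L := by nlinarith
  rw [Units.rank]
  omega

lemma finrank_units (F : Type*) [Field F] [NumberField F] :
    Module.finrank ℤ (Additive (𝓞 F)ˣ) = Units.rank F := by
  rw [← Units.finrank_modTorsion F]
  let T : Submodule ℤ (Additive (𝓞 F)ˣ) := AddSubgroup.toIntSubmodule (Subgroup.toAddSubgroup (Units.torsion F))
  have h1 : T ≤ Submodule.torsion ℤ (Additive (𝓞 F)ˣ) := by
    intro x hx
    have hx' : Additive.toMul x ∈ Units.torsion F := hx
    rw [Units.torsion, CommGroup.mem_torsion, isOfFinOrder_iff_pow_eq_one] at hx'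
    obtain ⟨n, hn, h⟩ := hx'
    refine (Submodule.mem_torsion_iff _).mpr ⟨⟨(n : ℤ), mem_nonZeroDivisors_of_ne_zero
      (by exact_mod_cast hn.ne')⟩, ?_⟩
    change (n : ℤ) • x = 0
    rw [natCast_zsmul]
    exact h
  have h2 := rank_quotient_eq_of_le_torsion h1
  rw [Module.finrank, ← h2]
  rfl

end Amb

open NumberField Polynomial
open scoped nonZeroDivisors

namespace Amb

set_option linter.unusedSectionVars false

variable {p N : ℕ} {K L : Type} [Field K] [NumberField K] [Field L] [NumberField L]
    [Algebra K L] {ζ : K} {α : L} {σ : L ≃ₐ[K] L}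

/-- action on units of `L` -/
noncomputable def aU (σ : L ≃ₐ[K] L) : Lˣ →* Lˣ := Units.map (σ : L →* L)

@[simp] lemma aU_val (σ : L ≃ₐ[K] L) (x : Lˣ) : ((aU σ x : Lˣ) : L) = σ x := rfl

lemma aU_iter (σ : L ≃ₐ[K] L) (n : ℕ) (x : Lˣ) : (((aU σ)^[n] x : Lˣ) : L) = (σ ^ n) (x : L) := by
  induction n with
  | zero => rfl
  | succ n ih => rw [Function.iterate_succ_apply', aU_val, ih, pow_succ']; rfl

/-- action on fractional ideals of `L` -/
noncomputable def aI (σ : L ≃ₐ[K] L) :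
    (FractionalIdeal (𝓞 L)⁰ L)ˣ →* (FractionalIdeal (𝓞 L)⁰ L)ˣ :=
  Units.map ((FractionalIdeal.ringEquivOfRingEquiv L L (RingOfIntegers.mapRingEquiv (σ : L ≃+* L)) :
    _ ≃+* _) : FractionalIdeal (𝓞 L)⁰ L →* FractionalIdeal (𝓞 L)⁰ L)

lemma frac_eq (σ : L ≃ₐ[K] L) (x : L) :
    IsFractionRing.ringEquivOfRingEquiv (K := L) (L := L)
      (RingOfIntegers.mapRingEquiv (σ : L ≃+* L)) x = σ x := by
  obtain ⟨a, b, hb, rfl⟩ := IsFractionRing.div_surjective (A := 𝓞 L) x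
  simp only [_root_.map_div₀, IsFractionRing.ringEquivOfRingEquiv_algebraMap]
  rfl

lemma mem_aI (σ : L ≃ₐ[K] L) (J : (FractionalIdeal (𝓞 L)⁰ L)ˣ) (x : L) :
    x ∈ ((aI σ J : (FractionalIdeal (𝓞 L)⁰ L)ˣ) : FractionalIdeal (𝓞 L)⁰ L) ↔
      σ.symm x ∈ (J : FractionalIdeal (𝓞 L)⁰ L) := by
  change x ∈ (FractionalIdeal.ringEquivOfRingEquiv L L (RingOfIntegers.mapRingEquiv (σ : L ≃+* L))
    (J : FractionalIdeal (𝓞 L)⁰ L)).val ↔ _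
  rw [FractionalIdeal.ringEquivOfRingEquiv_apply_val]
  constructor
  · rintro ⟨y, hy, rfl⟩
    have : σ.symm (IsFractionRing.ringEquivOfRingEquiv (K := L) (L := L)
      (RingOfIntegers.mapRingEquiv (σ : L ≃+* L)) y) = y := by
        rw [frac_eq]; simp
    exact this.symm ▸ hy
  · intro h
    refine ⟨σ.symm x, h, ?_⟩
    have := frac_eq σ (σ.symm x)
    rw [AlgEquiv.apply_symm_apply] at this
    exact this

lemma mem_aI_iter (σ : L ≃ₐ[K] L) (n : ℕ) (J : (FractionalIdeal (𝓞 L)⁰ L)ˣ) (x : L) :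
    x ∈ (((aI σ)^[n] J : (FractionalIdeal (𝓞 L)⁰ L)ˣ) : FractionalIdeal (𝓞 L)⁰ L) ↔
      (σ ^ n).symm x ∈ (J : FractionalIdeal (𝓞 L)⁰ L) := by
  induction n generalizing x with
  | zero => rfl
  | succ n ih =>
    rw [Function.iterate_succ_apply', mem_aI, ih, pow_succ']
    rfl

/-- principal ideals -/
noncomputable abbrev dv (L : Type) [Field L] [NumberField L] :
    Lˣ →* (FractionalIdeal (𝓞 L)⁰ L)ˣ := toPrincipalIdeal (𝓞 L) L

lemma aI_dv (σ : L ≃ₐ[K] L) (x : Lˣ) : aI σ (dv L x) = dv L (aU σ x) := by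
  symm
  rw [toPrincipalIdeal_eq_iff]
  change _ = FractionalIdeal.ringEquivOfRingEquiv L L _ _
  rw [coe_toPrincipalIdeal, FractionalIdeal.ringEquivOfRingEquiv_spanSingleton, frac_eq]
  rfl

lemma mem_dv_ker (x : Lˣ) : x ∈ (dv L).ker ↔ ∃ u : (𝓞 L)ˣ, (u : L) = x := by
  rw [MonoidHom.mem_ker, toPrincipalIdeal_eq_iff, Units.val_one]
  constructor
  · intro h
    have h1 : (x : L) ∈ (1 : FractionalIdeal (𝓞 L)⁰ L) := by
      rw [← h]; exact FractionalIdeal.mem_spanSingleton_self _ _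
    have h2 : (1 : L) ∈ FractionalIdeal.spanSingleton (𝓞 L)⁰ (x : L) := by
      rw [h]; exact FractionalIdeal.one_mem_one _
    obtain ⟨a, ha⟩ := (FractionalIdeal.mem_one_iff _).mp h1
    obtain ⟨b, hb⟩ := (FractionalIdeal.mem_spanSingleton _).mp h2
    have hab : a * b = 1 := by
      apply RingOfIntegers.coe_injective
      rw [map_mul, map_one, mul_comm, ← hb, Algebra.smul_def, ha]
    exact ⟨Units.mkOfMulEqOne a b hab, ha⟩
  · rintro ⟨u, hu⟩
    rw [← hu]
    apply le_antisymm
    · rw [FractionalIdeal.spanSingleton_le_iff_mem]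
      exact (FractionalIdeal.mem_one_iff _).mpr ⟨u, rfl⟩
    · intro y hy
      obtain ⟨a, rfl⟩ := (FractionalIdeal.mem_one_iff _).mp hy
      rw [FractionalIdeal.mem_spanSingleton]
      refine ⟨a * ((u⁻¹ : (𝓞 L)ˣ) : 𝓞 L), ?_⟩
      rw [Algebra.smul_def, ← map_mul, mul_assoc, Units.inv_mul, mul_one]

lemma Setup.aU_p (S : Setup p N K L ζ α σ) (x : Lˣ) : (aU σ)^[p] x = x := by
  ext; rw [aU_iter, S.pow_p]; rfl

lemma Setup.aI_p (S : Setup p N K L ζ α σ) (J) : (aI σ)^[p] J = J := by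
  ext x; rw [mem_aI_iter, S.pow_p]; rfl

lemma Setup.gen_pow (S : Setup p N K L ζ α σ) (τ : L ≃ₐ[K] L) : ∃ n < p, σ ^ n = τ := by
  classical
  have h := S.gen τ
  rw [mem_zpowers_iff_mem_range_orderOf, S.order] at h
  simpa using h

lemma Setup.norm_eq (S : Setup p N K L ζ α σ) (x : L) :
    algebraMap K L (Algebra.norm K x) = ∏ i ∈ Finset.range p, (σ ^ i) x := by
  have := S.gal
  rw [Algebra.norm_eq_prod_automorphisms]
  symm
  refine Finset.prod_bij (fun i _ => σ ^ i) (fun _ _ => Finset.mem_univ _) ?_ ?_ (fun _ _ => rfl)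
  · intro i hi j hj h
    rw [Finset.mem_range] at hi hj
    rw [← S.order] at hi hj
    exact pow_injOn_Iio_orderOf hi hj h
  · intro τ _
    obtain ⟨n, hn, h⟩ := S.gen_pow τ
    exact ⟨n, Finset.mem_range.mpr hn, h⟩

lemma nu_val (p : ℕ) (σ : L ≃ₐ[K] L) (x : Lˣ) :
    ((nu p (aU σ) x : Lˣ) : L) = ∏ i ∈ Finset.range p, (σ ^ i) (x : L) := by
  rw [nu_apply, Units.coe_prod]
  exact Finset.prod_congr rfl fun i _ => aU_iter σ i x

lemma Setup.h90 (S : Setup p N K L ζ α σ) (x : Lˣ) (hx : nu p (aU σ) x = 1) :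
    ∃ y, x = delta (aU σ) y := by
  have := S.gal
  have : IsCyclic (L ≃ₐ[K] L) := ⟨⟨σ, S.gen⟩⟩
  have h := congrArg (fun u : Lˣ => (u : L)) hx
  simp only [nu_val, Units.val_one] at h
  rw [← S.norm_eq, ← map_one (algebraMap K L)] at h
  obtain ⟨y, hy⟩ := groupCohomology.exists_div_of_norm_eq_one S.gen ((algebraMap K L).injective h)
  have hy0 : (y : L) ≠ 0 := y.ne_zero
  refine ⟨y⁻¹, ?_⟩
  ext
  rw [delta_apply, Units.val_div_eq_div_val, aU_val, Units.val_inv_eq_inv_val, map_inv₀, ← hy]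
  have : σ (y : L) ≠ 0 := by simp [hy0]
  field_simp

lemma Setup.fixed (S : Setup p N K L ζ α σ) (x : L) : σ x = x ↔ ∃ y, algebraMap K L y = x := by
  have := S.gal
  constructor
  · intro h
    have : x ∈ (⊥ : IntermediateField K L) := by
      rw [IsGalois.mem_bot_iff_fixed]
      intro f
      obtain ⟨n, -, rfl⟩ := S.gen_pow f
      induction n with
      | zero => rfl
      | succ n ih => rw [pow_succ, AlgEquiv.mul_apply, h, ih]
    rwa [IntermediateField.mem_bot] at this
  · rintro ⟨y, rfl⟩; simp

end Amb

open NumberField Polynomial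
open scoped nonZeroDivisors

namespace Amb

set_option linter.unusedSectionVars false

variable {p N : ℕ} {K L : Type} [Field K] [NumberField K] [Field L] [NumberField L]
    [Algebra K L] {ζ : K} {α : L} {σ : L ≃ₐ[K] L}

lemma transfer {A U : Type*} [CommGroup A] [CommGroup U] (f : A →* U) (hf : Function.Injective f)
    (B : Subgroup U) (hB : ∀ x, x ∈ B ↔ ∃ a, f a = x) [Module.Finite ℤ (Additive A)] :
    Module.Finite ℤ (Additive B) ∧
      Module.finrank ℤ (Additive B) = Module.finrank ℤ (Additive A) := by
  have : B = f.range := by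
    ext x; rw [hB, MonoidHom.mem_range]
  subst this
  let e : Additive A ≃ₗ[ℤ] Additive f.range := (MulEquiv.toAdditive (MonoidHom.ofInjective hf)).toIntLinearEquiv
  exact ⟨Module.Finite.equiv e, e.finrank_eq.symm⟩

/-- units of `K` in `L` -/
noncomputable def unitsKL (K L : Type) [Field K] [NumberField K] [Field L] [NumberField L]
    [Algebra K L] : (𝓞 K)ˣ →* Lˣ :=
  Units.map (((algebraMap K L).comp (algebraMap (𝓞 K) K) : 𝓞 K →+* L) : 𝓞 K →* L)

lemma unitsKL_inj : Function.Injective (unitsKL K L) := by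
  apply Units.map_injective
  exact (algebraMap K L).injective.comp RingOfIntegers.coe_injective

lemma Setup.mem_EK (S : Setup p N K L ζ α σ) (x : Lˣ) :
    x ∈ (dv L).ker ⊓ fixd (aU σ) ↔ ∃ u : (𝓞 K)ˣ, unitsKL K L u = x := by
  rw [Subgroup.mem_inf, mem_dv_ker, mem_fixd]
  constructor
  · rintro ⟨⟨u, hu⟩, h⟩
    have h := congrArg (fun u : Lˣ => (u : L)) h
    simp only [aU_val] at h
    obtain ⟨y, hy⟩ := (S.fixed _).mp h
    have hy0 : y ≠ 0 := by
      rintro rfl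
      rw [map_zero] at hy
      exact x.ne_zero hy.symm
    have int1 : IsIntegral ℤ y := by
      rw [← isIntegral_algebraMap_iff (algebraMap K L).injective, hy, ← hu]
      exact RingOfIntegers.isIntegral_coe _
    have int2 : IsIntegral ℤ y⁻¹ := by
      rw [← isIntegral_algebraMap_iff (algebraMap K L).injective, map_inv₀, hy, ← hu]
      have : ((u : 𝓞 L) : L)⁻¹ = ((u⁻¹ : (𝓞 L)ˣ) : L) := by
        have h1 : ((u : 𝓞 L) : L) * ((u⁻¹ : (𝓞 L)ˣ) : 𝓞 L) = 1 := by
          rw [← map_mul, Units.mul_inv, map_one]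
        exact inv_eq_of_mul_eq_one_right h1
      rw [this]
      exact RingOfIntegers.isIntegral_coe _
    refine ⟨Units.mkOfMulEqOne (⟨y, int1⟩ : 𝓞 K) ⟨y⁻¹, int2⟩ ?_, ?_⟩
    · apply RingOfIntegers.coe_injective
      exact mul_inv_cancel₀ hy0
    · ext
      exact hy
  · rintro ⟨u, rfl⟩
    refine ⟨⟨Units.map (algebraMap (𝓞 K) (𝓞 L) : 𝓞 K →* 𝓞 L) u, rfl⟩, ?_⟩
    ext
    exact (S.fixed _).mpr ⟨_, rfl⟩

/-- `ζ` as a unit of `L` -/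
noncomputable def Setup.z (S : Setup p N K L ζ α σ) : Lˣ :=
  Units.mk0 (algebraMap K L ζ) (by simpa using S.hζ.ne_zero S.hp.ne_zero)

lemma Setup.z_prim (S : Setup p N K L ζ α σ) : IsPrimitiveRoot S.z p := by
  rw [← IsPrimitiveRoot.coe_units_iff]
  exact S.hζ.map_of_injective (algebraMap K L).injective

lemma Setup.z_ker (S : Setup p N K L ζ α σ) : S.z ∈ (dv L).ker ⊓ fixd (aU σ) := by
  rw [S.mem_EK]
  have : NeZero p := ⟨S.hp.ne_zero⟩
  refine ⟨S.hζ.toInteger_isPrimitiveRoot.isUnit S.hp.ne_zero |>.unit, ?_⟩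
  ext
  rfl

lemma Setup.card_torsion (S : Setup p N K L ζ α σ) (A : Subgroup Lˣ) (hA : S.z ∈ A) :
    Nat.card {x : Lˣ // x ∈ A ∧ x ^ p = 1} = p := by
  have : NeZero p := ⟨S.hp.ne_zero⟩
  have h : Nat.card (rootsOfUnity p L) = p := by
    exact (IsPrimitiveRoot.coe_units_iff.mpr S.z_prim).card_rootsOfUnity
  refine Eq.trans ?_ h
  refine Nat.card_congr (Equiv.subtypeEquivRight ?_)
  intro x
  rw [mem_rootsOfUnity]
  refine ⟨fun h => h.2, fun h => ⟨?_, h⟩⟩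
  have h' : (x : L) ^ p = 1 := by rw [← Units.val_pow_eq_pow_val, h, Units.val_one]
  obtain ⟨i, -, hi⟩ := (IsPrimitiveRoot.coe_units_iff.mpr S.z_prim).eq_pow_of_pow_eq_one h'
  have hi' : S.z ^ i = x := Units.ext hi
  rw [← hi']
  exact pow_mem hA _

lemma Setup.units (S : Setup p N K L ζ α σ) :
    (p * ((dv L).ker.map (nu p (aU σ))).relIndex ((dv L).ker ⊓ fixd (aU σ)) ≤
      ((dv L).ker.map (delta (aU σ))).relIndex ((dv L).ker ⊓ (nu p (aU σ)).ker)) ∧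
    ((dv L).ker.map (nu p (aU σ))).relIndex ((dv L).ker ⊓ fixd (aU σ)) ≠ 0 := by
  have hfin : ∀ (F : Type) [Field F] [NumberField F], Module.Finite ℤ (Additive (𝓞 F)ˣ) := by
    intro F _ _
    infer_instance
  have := hfin K
  have := hfin L
  obtain ⟨fE, rE⟩ := transfer (Units.map ((algebraMap (𝓞 L) L : 𝓞 L →* L)))
    (Units.map_injective RingOfIntegers.coe_injective) (dv L).ker (by
      intro x
      rw [mem_dv_ker]
      refine exists_congr fun u => ?_
      rw [Units.ext_iff]
      rfl)
  obtain ⟨fK, rK⟩ := transfer (unitsKL K L) unitsKL_inj _ S.mem_EK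
  obtain ⟨fM, rM⟩ := rank_ker (dv L).ker ((dv L).ker ⊓ fixd (aU σ)) (nu p (aU σ)) (by
    intro x hx
    refine ⟨?_, ?_⟩
    · change nu p (aU σ) x ∈ (dv L).ker
      rw [nu_apply]
      refine prod_mem fun i hi => ?_
      clear hi
      induction i with
      | zero => exact hx
      | succ i ih =>
        rw [Function.iterate_succ_apply', MonoidHom.mem_ker, ← aI_dv, MonoidHom.mem_ker.mp ih, map_one]
    · exact mem_fixd.mpr (sigma_nu p _ S.aU_p x))
  rw [rE, rK, finrank_units, finrank_units] at rM
  have hzM : S.z ∈ (dv L).ker ⊓ (nu p (aU σ)).ker := by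
    refine ⟨S.z_ker.1, ?_⟩
    change _ = _
    rw [nu_fixd p _ (mem_fixd.mp S.z_ker.2)]
    exact S.z_prim.pow_eq_one
  have iM := pow_index p S.hp ((dv L).ker ⊓ (nu p (aU σ)).ker)
  have iK := pow_index p S.hp ((dv L).ker ⊓ fixd (aU σ))
  rw [S.card_torsion _ hzM, ← pow_succ] at iM
  rw [S.card_torsion _ S.z_ker, ← pow_succ, rK, finrank_units] at iK
  refine herb p (Units.rank K) _ S.hp (aU σ) S.aU_p (dv L).ker ?_ iM ?_ iK.le ?_
  · intro x hx
    rw [MonoidHom.mem_ker, ← aI_dv, MonoidHom.mem_ker.mp hx, map_one]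
  · have h1 := S.rankK
    have h2 := S.rankL
    rw [← h1] at h2
    have h3 := S.p3
    obtain ⟨q, rfl⟩ : ∃ q, p = q + 1 := ⟨p - 1, by omega⟩
    rw [Nat.add_sub_cancel]
    rw [add_mul, one_mul] at h2
    omega
  · rw [iK]; exact pow_ne_zero _ S.hp.ne_zero

end Amb

open NumberField Polynomial
open scoped nonZeroDivisors

namespace Amb

set_option linter.unusedSectionVars false

variable {p N : ℕ} {K L : Type} [Field K] [NumberField K] [Field L] [NumberField L]
    [Algebra K L] {ζ : K} {α : L} {σ : L ≃ₐ[K] L}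

/-- ideals with ambiguous `p`-torsion class -/
noncomputable def CI (p : ℕ) (σ : L ≃ₐ[K] L) : Subgroup (FractionalIdeal (𝓞 L)⁰ L)ˣ :=
  (dv L).range.comap (delta (aI σ)) ⊓ (dv L).range.comap (powMonoidHom p)

/-- invariant ideals with `p`-torsion class -/
noncomputable def ZI (p : ℕ) (σ : L ≃ₐ[K] L) : Subgroup (FractionalIdeal (𝓞 L)⁰ L)ˣ :=
  fixd (aI σ) ⊓ (dv L).range.comap (powMonoidHom p)

lemma mem_CI (J : (FractionalIdeal (𝓞 L)⁰ L)ˣ) :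
    J ∈ CI p σ ↔ (∃ a, aI σ J = J * dv L a) ∧ J ^ p ∈ (dv L).range := by
  refine and_congr ?_ Iff.rfl
  change (∃ a, _ = _) ↔ _
  refine exists_congr fun a => ?_
  rw [delta_apply, eq_div_iff_mul_eq', eq_comm, mul_comm]

lemma mem_ZI (J : (FractionalIdeal (𝓞 L)⁰ L)ˣ) :
    J ∈ ZI p σ ↔ aI σ J = J ∧ J ^ p ∈ (dv L).range := and_congr mem_fixd Iff.rfl

lemma mk_one (F : Type) [Field F] [NumberField F] (J : (FractionalIdeal (𝓞 F)⁰ F)ˣ) :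
    ClassGroup.mk F J = 1 ↔ J ∈ (toPrincipalIdeal (𝓞 F) F).range := by
  rw [← (ClassGroup.equiv F).map_eq_one_iff, ClassGroup.equiv_mk]
  have : (Units.mapEquiv ↑(FractionalIdeal.canonicalEquiv (𝓞 F)⁰ F F)) J = J := by
    ext; simp
  rw [this]
  exact QuotientGroup.eq_one_iff J

lemma aI_mk0 (σ : L ≃ₐ[K] L) (I : (Ideal (𝓞 L))⁰) :
    aI σ (FractionalIdeal.mk0 L I) = FractionalIdeal.mk0 L
      (Ideal.mapNZ (RingOfIntegers.mapRingEquiv (σ : L ≃+* L)) I) := by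
  ext x
  rw [mem_aI, FractionalIdeal.coe_mk0, FractionalIdeal.coe_mk0, FractionalIdeal.mem_coeIdeal,
    FractionalIdeal.mem_coeIdeal]
  change _ ↔ ∃ x', x' ∈ Ideal.map (RingOfIntegers.mapRingEquiv (σ : L ≃+* L)) I.1 ∧ _
  constructor
  · rintro ⟨y, hy, h⟩
    refine ⟨_, Ideal.mem_map_of_mem _ hy, ?_⟩
    change σ (algebraMap (𝓞 L) L y) = x
    rw [h, AlgEquiv.apply_symm_apply]
  · rintro ⟨y, hy, rfl⟩
    obtain ⟨z, hz, rfl⟩ := (Ideal.mem_map_of_equiv (RingOfIntegers.mapRingEquiv (σ : L ≃+* L)) _).mp hy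
    refine ⟨z, hz, ?_⟩
    change _ = σ.symm (σ (algebraMap (𝓞 L) L z))
    rw [AlgEquiv.symm_apply_apply]

lemma card_le (p : ℕ) (σ : L ≃ₐ[K] L) :
    Nat.card {c : ClassGroup (𝓞 L) //
        (∀ σ : L ≃ₐ[K] L, ClassGroup.IsFixedBy (RingOfIntegers.mapRingEquiv σ) c) ∧
        c ^ p = 1} ≤ (dv L).range.relIndex (CI p σ) := by
  have h1 : (dv L).range = (ClassGroup.mk (R := 𝓞 L) L).ker := by
    ext J; rw [MonoidHom.mem_ker, mk_one]
  have hk := Subgroup.relIndex_ker (CI p σ) (ClassGroup.mk (R := 𝓞 L) L)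
  rw [h1, hk]
  refine Nat.card_le_card_of_injective (fun c => ⟨c.1, ?_⟩) ?_
  · obtain ⟨c, hc, hcp⟩ := c
    obtain ⟨I, rfl⟩ := ClassGroup.mk0_surjective c
    refine ⟨FractionalIdeal.mk0 L I, (mem_CI _).mpr ⟨?_, ?_⟩, ClassGroup.mk_mk0 L I⟩
    · have h2 := hc σ I rfl
      rw [← ClassGroup.mk_mk0 L, ← ClassGroup.mk_mk0 L, ← aI_mk0, ← inv_mul_eq_one, ← map_inv, ← map_mul,
        mk_one] at h2
      obtain ⟨a, ha⟩ := h2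
      refine ⟨a⁻¹, ?_⟩
      rw [map_inv, ha]
      simp
    · rw [← mk_one, map_pow, ClassGroup.mk_mk0]
      exact hcp
  · intro a b h
    exact Subtype.ext (congrArg (fun x => x.1) h)

/-- The arithmetic input remaining: bound of invariant ideals and norm index. -/
theorem Setup.final (S : Setup p N K L ζ α σ) (t j : ℕ) (htj : t ≤ p - 2 + (j + 1))
    (hz : ((fixd (aU σ)).map (dv L)).relIndex (ZI p σ) ≤ p ^ t)
    (hz0 : ((fixd (aU σ)).map (dv L)).relIndex (ZI p σ) ≠ 0)
    (hU : p ^ j ≤ (nu p (aU σ)).range.relIndex ((dv L).ker ⊓ fixd (aU σ))) :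
    (Nat.card {c : ClassGroup (𝓞 L) //
        (∀ σ : L ≃ₐ[K] L, ClassGroup.IsFixedBy (RingOfIntegers.mapRingEquiv σ) c) ∧
        c ^ p = 1}).factorization p
      ≤ p - 2 := by
  have h := core p t j (aU σ) (aI σ) (dv L) S.aU_p S.aI_p (aI_dv σ) S.h90 (CI p σ) (ZI p σ)
    mem_CI mem_ZI hz0 hz S.units.2 S.units.1 hU
  have h2 := card_le (K := K) (L := L) p σ
  have h3 : (dv L).range.relIndex (CI p σ) ≤ p ^ (p - 2) := by
    have h4 : p ^ t ≤ p ^ (p - 2) * p ^ (j + 1) := by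
      rw [← pow_add]; exact Nat.pow_le_pow_right S.hp.pos htj
    exact Nat.le_of_mul_le_mul_right (h.trans h4) (pow_pos S.hp.pos _)
  refine (Nat.pow_le_pow_iff_right S.hp.one_lt).mp ?_
  refine le_trans (Nat.ordProj_le p ?_) (h2.trans h3)
  have : Nonempty {c : ClassGroup (𝓞 L) //
        (∀ σ : L ≃ₐ[K] L, ClassGroup.IsFixedBy (RingOfIntegers.mapRingEquiv σ) c) ∧
        c ^ p = 1} := by
    refine ⟨1, ?_, one_pow _⟩
    intro τ I hI
    rw [← ClassGroup.mk_mk0 L, ← aI_mk0]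
    rw [← ClassGroup.mk_mk0 L, mk_one] at hI
    obtain ⟨a, ha⟩ := hI
    rw [mk_one, ← ha]
    exact ⟨aU τ a, (aI_dv τ a).symm⟩
  exact Nat.card_ne_zero.mpr ⟨this, inferInstance⟩

end Amb

open NumberField Polynomial
open scoped nonZeroDivisors

namespace Amb

open UniqueFactorizationMonoid
open scoped Pointwise

open Classical in
lemma count_smul {B G : Type*} [CommRing B] [IsDedekindDomain B] [Group G]
    [MulSemiringAction G B] (g : G) (P I : Ideal B) (hP : P.IsPrime) (hP0 : P ≠ ⊥) (hI : I ≠ ⊥) :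
    (normalizedFactors (g • I)).count (g • P) = (normalizedFactors I).count P := by
  have hgP : (g • P).IsPrime := inferInstance
  have hb : ∀ J : Ideal B, J ≠ ⊥ → g • J ≠ ⊥ := by
    intro J hJ h
    apply hJ
    have := congrArg (fun x => g⁻¹ • x) h
    simpa using this
  have h1 := emultiplicity_eq_count_normalizedFactors (Ideal.prime_of_isPrime hP0 hP).irreducible hI
  have h2 := emultiplicity_eq_count_normalizedFactors
    (Ideal.prime_of_isPrime (hb P hP0) hgP).irreducible (hb I hI)
  rw [normalize_eq] at h1 h2
  have h3 : emultiplicity (g • P) (g • I) = emultiplicity P I := by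
    rw [emultiplicity_eq_emultiplicity_iff]
    intro n
    rw [Ideal.dvd_iff_le, Ideal.dvd_iff_le, ← smul_pow', Ideal.pointwise_smul_le_pointwise_smul_iff]
  rw [h1, h2] at h3
  exact_mod_cast h3

open Classical in
theorem extended_of_invariant {A B : Type*} [CommRing A] [IsDedekindDomain A] [CommRing B]
    [IsDedekindDomain B] [Algebra A B] [Module.Finite A B] [Module.IsTorsionFree A B]
    (G : Type*) [Group G] [Finite G] [MulSemiringAction G B] [IsGaloisGroup G A B]
    (I : Ideal B) (hI0 : I ≠ ⊥) (hinv : ∀ g : G, g • I = I)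
    (he : ∀ P : Ideal B, P.IsPrime → P ≠ ⊥ → P.ramificationIdx A ∣ (normalizedFactors I).count P) :
    ∃ I' : Ideal A, I = I'.map (algebraMap A B) := by
  generalize hn : Multiset.card (normalizedFactors I) = n
  induction n using Nat.strong_induction_on generalizing I with
  | _ n ih =>
  by_cases hI1 : I = ⊤
  · exact ⟨⊤, by rw [hI1, Ideal.map_top]⟩
  obtain ⟨P, hPm, hIP⟩ := Ideal.exists_le_maximal I hI1
  have hP := hPm.isPrime
  have hP0 : P ≠ ⊥ := fun h => hI0 (le_bot_iff.mp (h ▸ hIP))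
  set q := P.under A with hq
  have hq0 : q ≠ ⊥ := Ideal.under_ne_bot A hP0
  have hqB : q.map (algebraMap A B) ≠ ⊥ := Ideal.map_ne_bot_of_ne_bot hq0
  have hcount : ∀ Q : Ideal B, Q.IsPrime → Q ≠ ⊥ → Q.under A = q →
      (normalizedFactors (q.map (algebraMap A B))).count Q = Q.ramificationIdx A := by
    intro Q hQ hQ0 hQq
    have : Q.LiesOver q := ⟨hQq.symm⟩
    rw [Ideal.IsDedekindDomain.ramificationIdx_eq_normalizedFactors_count q Q hqB]
  have hcount0 : ∀ Q : Ideal B, Q.IsPrime → Q.under A ≠ q →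
      (normalizedFactors (q.map (algebraMap A B))).count Q = 0 := by
    intro Q hQ hQq
    rw [Multiset.count_eq_zero]
    intro h
    apply hQq
    have h1 := dvd_of_mem_normalizedFactors h
    rw [Ideal.dvd_iff_le, Ideal.map_le_iff_le_comap] at h1
    have hqm : q.IsMaximal := Ideal.IsMaximal.under A P
    exact (hqm.eq_of_le (Ideal.IsPrime.under A Q).ne_top h1).symm
  have hdvd : q.map (algebraMap A B) ∣ I := by
    rw [dvd_iff_normalizedFactors_le_normalizedFactors hqB hI0, Multiset.le_iff_count]
    intro Q
    by_cases hQm : Q ∈ normalizedFactors (q.map (algebraMap A B))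
    swap
    · rw [Multiset.count_eq_zero.mpr hQm]; exact Nat.zero_le _
    have hQp := prime_of_normalized_factor Q hQm
    have hQ : Q.IsPrime := Ideal.isPrime_of_prime hQp
    have hQ0 : Q ≠ ⊥ := hQp.ne_zero
    by_cases hQq : Q.under A = q
    swap
    · rw [hcount0 Q hQ hQq]; exact Nat.zero_le _
    rw [hcount Q hQ hQ0 hQq]
    refine Nat.le_of_dvd ?_ (he Q hQ hQ0)
    have : Q.LiesOver q := ⟨hQq.symm⟩
    have : P.LiesOver q := ⟨rfl⟩
    obtain ⟨g, hg⟩ := Ideal.exists_smul_eq_of_isGaloisGroup q P Q G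
    rw [← hg, ← hinv g, count_smul g P I hP hP0 hI0, Multiset.count_pos,
      Ideal.mem_normalizedFactors_iff hI0]
    exact ⟨hP, hIP⟩
  obtain ⟨I2, hI2⟩ := hdvd
  have hI20 : I2 ≠ ⊥ := by
    rintro rfl
    exact hI0 (by rw [hI2, Ideal.mul_bot])
  have hnf : normalizedFactors I = normalizedFactors (q.map (algebraMap A B)) + normalizedFactors I2 := by
    rw [hI2, normalizedFactors_mul hqB hI20]
  obtain ⟨I', hI'⟩ := ih (Multiset.card (normalizedFactors I2)) (by
      rw [← hn, hnf, Multiset.card_add]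
      have : 0 < Multiset.card (normalizedFactors (q.map (algebraMap A B))) := by
        rw [Multiset.card_pos_iff_exists_mem]
        refine ⟨P, ?_⟩
        rw [Ideal.mem_normalizedFactors_iff hqB]
        exact ⟨hP, Ideal.map_comap_le⟩
      omega) I2 hI20 (by
        intro g
        have h1 := hinv g
        rw [hI2, smul_mul'] at h1
        have h2 : g • (q.map (algebraMap A B)) = q.map (algebraMap A B) := by
          have : SMulCommClass G A B := IsGaloisGroup.commutes
          rw [Ideal.pointwise_smul_def, Ideal.map_map]
          congr 1
          ext a
          simp
        rw [h2] at h1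
        exact mul_left_cancel₀ hqB h1) (by
        intro Q hQ hQ0
        have h1 := he Q hQ hQ0
        rw [hnf, Multiset.count_add] at h1
        by_cases hQq : Q.under A = q
        · rw [hcount Q hQ hQ0 hQq] at h1
          exact (Nat.dvd_add_right (dvd_refl _)).mp h1
        · rwa [hcount0 Q hQ hQq, zero_add] at h1) rfl
  exact ⟨q * I', by rw [hI2, Ideal.map_mul, hI']⟩

end Amb

open NumberField Polynomial
open scoped nonZeroDivisors

namespace Amb

open UniqueFactorizationMonoid IsDedekindDomain
open scoped Pointwise

set_option linter.unusedSectionVars false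

variable {p N : ℕ} {K L : Type} [Field K] [NumberField K] [Field L] [NumberField L]
    [Algebra K L] {ζ : K} {α : L} {σ : L ≃ₐ[K] L}

lemma Setup.eDvd (S : Setup p N K L ζ α σ) (P : Ideal (𝓞 L)) (hP : P.IsPrime) :
    P.ramificationIdx (𝓞 K) = 1 ∨ (P.ramificationIdx (𝓞 K) = p ∧
      ((P.under (𝓞 K)).primesOver (𝓞 L)).ncard = 1) := by
  have := S.gal
  have h := Ideal.ncard_primesOver_mul_ramificationIdxIn_mul_inertiaDegIn (P.under (𝓞 K)) (𝓞 L)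
    (L ≃ₐ[K] L)
  rw [IsGalois.card_aut_eq_finrank, S.deg, Ideal.ramificationIdxIn_eq_ramificationIdx
    (P.under (𝓞 K)) P (L ≃ₐ[K] L)] at h
  have hd : P.ramificationIdx (𝓞 K) ∣ p := by
    rw [← h]
    exact Dvd.dvd.mul_left (Dvd.intro _ rfl) _
  rcases (Nat.dvd_prime S.hp).mp hd with h1 | h1
  · exact Or.inl h1
  · refine Or.inr ⟨h1, ?_⟩
    rw [h1] at h
    have h2 : p * (((P.under (𝓞 K)).primesOver (𝓞 L)).ncard * (P.under (𝓞 K)).inertiaDegIn (𝓞 L)) = p * 1 := by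
      rw [mul_one]; nth_rewrite 2 [← h]; ring
    have h3 := Nat.eq_of_mul_eq_mul_left S.hp.pos h2
    exact Nat.eq_one_of_mul_eq_one_right h3

/-- the ramified primes -/
def ram (K L : Type) [Field K] [NumberField K] [Field L] [NumberField L] [Algebra K L] :
    Set (HeightOneSpectrum (𝓞 L)) := {v | v.asIdeal.ramificationIdx (𝓞 K) ≠ 1}

lemma principal_of_pow (S : Setup p N K L ζ α σ) (I : Ideal (𝓞 K)) (n : ℕ)
    (h : Submodule.IsPrincipal (I ^ (p ^ n))) : Submodule.IsPrincipal I := by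
  refine Ideal.IsPrincipal.of_isPrincipal_pow_of_coprime ?_ h
  apply Nat.Coprime.pow_left
  rw [Nat.Prime.coprime_iff_not_dvd S.hp, ← Nat.card_eq_fintype_card]
  exact S.hreg

open Classical in
lemma Setup.zmain (S : Setup p N K L ζ α σ) (J : (FractionalIdeal (𝓞 L)⁰ L)ˣ) (hJ : J ∈ ZI p σ)
    (hc : ∀ v ∈ ram K L, (p : ℤ) ∣ FractionalIdeal.count L v (J : FractionalIdeal (𝓞 L)⁰ L)) :
    J ∈ (fixd (aU σ)).map (dv L) := by
  have := S.gal
  obtain ⟨hJs, hJp⟩ := (mem_ZI J).mp hJ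
  obtain ⟨a, aI', ha, hJa⟩ := FractionalIdeal.exists_eq_spanSingleton_mul (J : FractionalIdeal (𝓞 L)⁰ L)
  set n := Ideal.absNorm (Ideal.span {a}) with hn
  have hn0 : n ≠ 0 := by
    rw [hn, Ne, Ideal.absNorm_eq_zero_iff, Ideal.span_singleton_eq_bot]; exact ha
  obtain ⟨b, hb⟩ := Ideal.mem_span_singleton.mp (Ideal.absNorm_mem (Ideal.span {a}))
  rw [← hn] at hb
  have hnL : (n : L) ≠ 0 := by exact_mod_cast hn0
  let c : Lˣ := Units.mk0 (n : L) hnL ^ p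
  have hcf : c ∈ fixd (aU σ) := by
    rw [mem_fixd]; ext; simp [c]
  have hcv : (c : L) = (n : L) ^ p := by simp [c]
  set I : Ideal (𝓞 L) := Ideal.span {(n : 𝓞 L) ^ (p - 1) * b} * aI' with hI
  have haL : algebraMap (𝓞 L) L a ≠ 0 := by simpa using ha
  have hbL : (n : L) = algebraMap (𝓞 L) L a * algebraMap (𝓞 L) L b := by
    rw [← map_mul, ← hb, map_natCast]
  have hcJ : ((dv L c * J : (FractionalIdeal (𝓞 L)⁰ L)ˣ) : FractionalIdeal (𝓞 L)⁰ L) = (I : FractionalIdeal (𝓞 L)⁰ L) := by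
    rw [Units.val_mul, coe_toPrincipalIdeal, hJa, ← mul_assoc, FractionalIdeal.spanSingleton_mul_spanSingleton,
      hI, FractionalIdeal.coeIdeal_mul, FractionalIdeal.coeIdeal_span_singleton]
    congr 2
    rw [hcv, map_mul, map_pow, map_natCast, ← Nat.succ_pred_prime S.hp, pow_succ]
    nth_rewrite 2 [hbL]
    rw [Nat.succ_pred_prime S.hp, Nat.pred_eq_sub_one]
    field_simp
  have hI0 : I ≠ ⊥ := by
    intro h
    rw [h] at hcJ
    refine (dv L c * J).ne_zero ?_
    rw [hcJ]; simp
  let I0 : (Ideal (𝓞 L))⁰ := ⟨I, mem_nonZeroDivisors_of_ne_zero hI0⟩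
  have hmk : dv L c * J = FractionalIdeal.mk0 L I0 := Units.ext hcJ
  have hinv1 : σ • I = I := by
    have h1 : aI σ (dv L c * J) = dv L c * J := by
      rw [map_mul, hJs, aI_dv, mem_fixd.mp hcf]
    rw [hmk, aI_mk0] at h1
    have h2 := congrArg (fun u : (FractionalIdeal (𝓞 L)⁰ L)ˣ => (u : FractionalIdeal (𝓞 L)⁰ L)) h1
    simp only [FractionalIdeal.coe_mk0] at h2
    have h3 := FractionalIdeal.coeIdeal_injective h2
    exact h3
  have hinv : ∀ g : L ≃ₐ[K] L, g • I = I := by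
    intro g
    obtain ⟨m, -, rfl⟩ := S.gen_pow g
    induction m with
    | zero => rw [pow_zero, one_smul]
    | succ m ih => rw [pow_succ, mul_smul, hinv1, ih]
  obtain ⟨I', hI'⟩ := extended_of_invariant (A := 𝓞 K) (B := 𝓞 L) (L ≃ₐ[K] L) I hI0 hinv (by
    intro P hP hP0
    rcases S.eDvd P hP with h1 | ⟨h1, -⟩
    · rw [h1]; exact one_dvd _
    · let v : HeightOneSpectrum (𝓞 L) := ⟨P, hP, hP0⟩
      have hv : v ∈ ram K L := by
        change P.ramificationIdx (𝓞 K) ≠ 1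
        rw [h1]; exact S.hp.one_lt.ne'
      rw [h1]
      have h2 : (p : ℤ) ∣ FractionalIdeal.count L v
          ((dv L c * J : (FractionalIdeal (𝓞 L)⁰ L)ˣ) : FractionalIdeal (𝓞 L)⁰ L) := by
        rw [Units.val_mul, FractionalIdeal.count_mul L v (Units.ne_zero _) (Units.ne_zero _)]
        refine dvd_add ?_ (hc v hv)
        simp only [c]
        rw [map_pow, Units.val_pow_eq_pow_val, FractionalIdeal.count_pow]
        exact dvd_mul_right _ _
      rw [hcJ, FractionalIdeal.count_coe L v hI0] at h2
      have h3 := Ideal.count_associates_factors_eq hI0 hP hP0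
      rw [← h3]
      exact_mod_cast h2)
  -- `I'` is principal
  have hpr : Submodule.IsPrincipal I' := by
    refine principal_of_pow S I' 2 ?_
    have h1 : ClassGroup.mk L ((dv L c * J) ^ p) = 1 := by
      rw [mk_one, mul_pow]
      exact mul_mem (pow_mem (show dv L c ∈ (dv L).range from ⟨c, rfl⟩) p) hJp
    rw [hmk, ← map_pow, ClassGroup.mk_mk0] at h1
    have h2 := (ClassGroup.mk0_eq_one_iff (I := I ^ p) (I0 ^ p).2).mp h1
    obtain ⟨x, hx⟩ := h2.principal
    have h3 : I ^ p = Ideal.span {x} := hx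
    have h4 := congrArg (Ideal.relNorm (𝓞 K)) h3
    rw [Ideal.relNorm_singleton, hI', map_pow, Ideal.relNorm_algebraMap, ← IsFractionRing.finrank_eq (𝓞 K) K (𝓞 L) L, S.deg, ← pow_mul, ← sq] at h4
    exact ⟨_, h4⟩
  obtain ⟨x, hx⟩ := hpr.principal
  have hx' : I' = Ideal.span {x} := hx
  have hIx : I = Ideal.span {algebraMap (𝓞 K) (𝓞 L) x} := by
    rw [hI', hx', Ideal.map_span, Set.image_singleton]
  have hx0 : algebraMap K L (algebraMap (𝓞 K) K x) ≠ 0 := by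
    intro h
    simp only [map_eq_zero, RingOfIntegers.coe_eq_zero_iff] at h
    rw [h, map_zero, Ideal.span_singleton_eq_bot.mpr rfl] at hIx
    exact hI0 hIx
  refine ⟨c⁻¹ * Units.mk0 _ hx0, mul_mem (inv_mem hcf) ?_, ?_⟩
  · change _ ∈ fixd _
    rw [mem_fixd]; ext; exact (S.fixed _).mpr ⟨_, rfl⟩
  · rw [map_mul, map_inv, inv_mul_eq_iff_eq_mul]
    ext1
    rw [hcJ, hIx, coe_toPrincipalIdeal, FractionalIdeal.coeIdeal_span_singleton]
    rfl

theorem Setup.zbound (S : Setup p N K L ζ α σ) (hfin : (ram K L).Finite) :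
    ((fixd (aU σ)).map (dv L)).relIndex (ZI p σ) ≤ p ^ (ram K L).ncard ∧
    ((fixd (aU σ)).map (dv L)).relIndex (ZI p σ) ≠ 0 := by
  have : Fact p.Prime := ⟨S.hp⟩
  have := hfin.to_subtype
  have hcard : (⊥ : Subgroup (ram K L → Multiplicative (ZMod p))).relIndex ⊤ = p ^ (ram K L).ncard := by
    rw [Subgroup.relIndex_bot_left, Subgroup.card_top, Nat.card_fun]
    congr 1
    rw [Nat.card_congr Multiplicative.toAdd, Nat.card_zmod]
  rw [← hcard]
  refine relIndex_le_of_rel _ _ _ _ ?_ (fun J y => ∀ v : ram K L, y v =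
    Multiplicative.ofAdd ((FractionalIdeal.count L v.1 (J : FractionalIdeal (𝓞 L)⁰ L) : ℤ) : ZMod p)) ?_ ?_
  · rw [hcard]; exact pow_ne_zero _ S.hp.ne_zero
  · intro J _
    exact ⟨_, Subgroup.mem_top _, fun v => rfl⟩
  · intro J hJ J' hJ' y _ y' _ hy hy' h
    refine S.zmain _ (mul_mem (inv_mem hJ) hJ') ?_
    intro v hv
    rw [Subgroup.mem_bot, inv_mul_eq_one] at h
    have h1 := congrFun h ⟨v, hv⟩
    rw [hy, hy'] at h1
    have h2 := Multiplicative.ofAdd.injective h1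
    rw [Units.val_mul, FractionalIdeal.count_mul L v (Units.ne_zero _) (Units.ne_zero _),
      Units.val_inv_eq_inv_val, FractionalIdeal.count_inv, ← ZMod.intCast_zmod_eq_zero_iff_dvd]
    push_cast
    rw [h2]; simp

end Amb

open NumberField Polynomial
open scoped nonZeroDivisors

namespace Amb

open UniqueFactorizationMonoid IsDedekindDomain
open scoped Pointwise

set_option linter.unusedSectionVars false

variable {p N : ℕ} {K L : Type} [Field K] [NumberField K] [Field L] [NumberField L]
    [Algebra K L] {ζ : K} {α : L} {σ : L ≃ₐ[K] L}

lemma Setup.inertia_all (S : Setup p N K L ζ α σ) (P : Ideal (𝓞 L)) (hP : P.IsPrime) (hP0 : P ≠ ⊥)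
    (he : P.ramificationIdx (𝓞 K) ≠ 1) (x : 𝓞 L) : σ • x - x ∈ P := by
  have := S.gal
  have h1 := (S.eDvd P hP).resolve_left he
  have h0 : P.under (𝓞 K) ≠ ⊥ := Ideal.under_ne_bot (𝓞 K) hP0
  have hm : (P.under (𝓞 K)).IsMaximal := Ideal.IsPrime.isMaximal inferInstance h0
  have : Finite (𝓞 K ⧸ P.under (𝓞 K)) := Ideal.finiteQuotientOfFreeOfNeBot _ h0
  have : Finite (P.under (𝓞 K)).ResidueField :=
    Finite.of_surjective _ (Ideal.bijective_algebraMap_quotient_residueField (P.under (𝓞 K))).2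
  have h2 := Ideal.card_inertia_eq_ramificationIdxIn (G := L ≃ₐ[K] L) (P.under (𝓞 K)) P
  rw [Ideal.ramificationIdxIn_eq_ramificationIdx (P.under (𝓞 K)) P (L ≃ₐ[K] L), h1.1, ← S.deg,
    ← IsGalois.card_aut_eq_finrank] at h2
  have h3 := Subgroup.eq_top_of_card_eq _ h2
  have h4 : σ ∈ P.inertia (L ≃ₐ[K] L) := by rw [h3]; trivial
  exact h4 x

lemma Setup.exists_a (S : Setup p N K L ζ α σ) : ∃ a : 𝓞 L, (a : L) = α ∧ a ^ p = (N : 𝓞 L) := by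
  have h : IsIntegral ℤ α := by
    have h1 : IsIntegral ℤ (α ^ p) := by
      rw [S.hα]
      exact_mod_cast isIntegral_algebraMap (R := ℤ) (A := L) (x := (N : ℤ))
    exact IsIntegral.of_pow S.hp.pos h1
  refine ⟨⟨α, h⟩, rfl, ?_⟩
  ext
  change α ^ p = _
  simp [S.hα]

lemma Setup.ram_mem [Fact p.Prime] (S : Setup p N K L ζ α σ) (v : HeightOneSpectrum (𝓞 L)) (hv : v ∈ ram K L) :
    (N : 𝓞 L) ∈ v.asIdeal ∨ algebraMap (𝓞 K) (𝓞 L) (S.hζ.toInteger - 1) ∈ v.asIdeal := by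
  obtain ⟨a, ha, haN⟩ := S.exists_a
  have hP := v.isPrime
  have h := S.inertia_all v.asIdeal v.isPrime v.ne_bot hv a
  have h1 : σ • a - a = algebraMap (𝓞 K) (𝓞 L) (S.hζ.toInteger - 1) * a := by
    ext
    change σ (a : L) - a = algebraMap K L (ζ - 1) * a
    rw [ha, S.hσα]; simp; ring
  rw [h1] at h
  rcases hP.mem_or_mem h with h | h
  · exact Or.inr h
  · left; rw [← haN]; exact Ideal.pow_mem_of_mem _ h _ S.hp.pos

lemma Setup.e_dvd (S : Setup p N K L ζ α σ) (P : Ideal (𝓞 L)) (hP : P.IsPrime)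
    [P.LiesOver (Ideal.span {(N : ℤ)})] : p ∣ P.ramificationIdx ℤ := by
  classical
  obtain ⟨a, ha, haN⟩ := S.exists_a
  have hN0 : (Ideal.span {(N : ℤ)}) ≠ ⊥ := by simp [S.hN.ne_zero]
  have hmap : (Ideal.span {(N : ℤ)}).map (algebraMap ℤ (𝓞 L)) = Ideal.span {a} ^ p := by
    rw [Ideal.map_span, Ideal.span_singleton_pow, haN]; simp
  have := Ideal.IsDedekindDomain.ramificationIdx_eq_normalizedFactors_count (Ideal.span {(N : ℤ)}) P
    (by rw [hmap, Ideal.span_singleton_pow, haN]; simp [S.hN.ne_zero])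
  rw [this, hmap, normalizedFactors_pow, Multiset.count_nsmul]
  exact dvd_mul_right _ _

lemma Setup.nprimes (S : Setup p N K L ζ α σ) :
    ((Ideal.span {(N : ℤ)}).primesOver (𝓞 L)).Finite ∧
    ((Ideal.span {(N : ℤ)}).primesOver (𝓞 L)).ncard ≤ p - 1 := by
  have hpr : (Ideal.span {(N : ℤ)}).IsPrime :=
    (Ideal.span_singleton_prime (by simp [S.hN.ne_zero])).mpr (Nat.prime_iff_prime_int.mp S.hN)
  have hfin : ((Ideal.span {(N : ℤ)}).primesOver (𝓞 L)).Finite := Algebra.QuasiFinite.finite_primesOver _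
  refine ⟨hfin, ?_⟩
  have : Fintype ((Ideal.span {(N : ℤ)}).primesOver (𝓞 L)) := hfin.fintype
  have h := Ideal.sum_ramification_inertia_eq_finrank (Ideal.span {(N : ℤ)}) (𝓞 L)
  have h2 : Module.finrank ℤ (𝓞 L) = (p - 1) * p := by
    rw [RingOfIntegers.rank, ← Module.finrank_mul_finrank ℚ K L, S.degK, S.deg]
  rw [h2] at h
  have h3 : ((Ideal.span {(N : ℤ)}).primesOver (𝓞 L)).ncard * p ≤ (p - 1) * p := by
    rw [← h, ← Set.fintypeCard_eq_ncard, ← smul_eq_mul, ← Finset.card_univ, ← Finset.sum_const]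
    refine Finset.sum_le_sum fun P _ => ?_
    have hPp : P.1.IsPrime := P.2.1
    have hPl : P.1.LiesOver (Ideal.span {(N : ℤ)}) := P.2.2
    have h4 := Nat.le_of_dvd (Ideal.ramificationIdx_pos P.1 ℤ) (S.e_dvd P.1 P.2.1)
    have h5 := Ideal.inertiaDeg_pos P.1 ℤ
    nlinarith
  exact Nat.le_of_mul_le_mul_right h3 S.hp.pos

lemma liesOver_of_mem {q : ℕ} (hq : q.Prime) {M : Type} [Field M] [NumberField M] (P : Ideal (𝓞 M))
    (hP : P.IsPrime) (h : (q : 𝓞 M) ∈ P) : P.LiesOver (Ideal.span {(q : ℤ)}) := by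
  have hm : (Ideal.span {(q : ℤ)}).IsMaximal :=
    PrincipalIdealRing.isMaximal_of_irreducible (Nat.prime_iff_prime_int.mp hq).irreducible
  refine ⟨hm.eq_of_le ?_ ?_⟩
  · exact (inferInstance : (P.under ℤ).IsPrime).ne_top
  · rw [Ideal.span_singleton_le_iff_mem, Ideal.mem_comap]
    simpa using h

end Amb

open NumberField Polynomial
open scoped nonZeroDivisors

namespace Amb

open UniqueFactorizationMonoid IsDedekindDomain
open scoped Pointwise

set_option linter.unusedSectionVars false

variable {p N : ℕ} {K L : Type} [Field K] [NumberField K] [Field L] [NumberField L]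
    [Algebra K L] {ζ : K} {α : L} {σ : L ≃ₐ[K] L}

/-- The set of primes of `L` above `N`. -/
def abv (N : ℕ) (L : Type) [Field L] [NumberField L] : Set (HeightOneSpectrum (𝓞 L)) :=
  {v | (N : 𝓞 L) ∈ v.asIdeal}

lemma Setup.abv_card (S : Setup p N K L ζ α σ) : (abv N L).Finite ∧ (abv N L).ncard ≤ p - 1 := by
  obtain ⟨h1, h2⟩ := S.nprimes
  have hinj : Set.InjOn (fun v : HeightOneSpectrum (𝓞 L) => v.asIdeal) (abv N L) :=
    fun v _ w _ h => HeightOneSpectrum.ext h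
  have hmaps : ∀ v ∈ abv N L, v.asIdeal ∈ (Ideal.span {(N : ℤ)}).primesOver (𝓞 L) :=
    fun v hv => ⟨v.isPrime, liesOver_of_mem S.hN _ v.isPrime hv⟩
  exact ⟨Set.Finite.of_injOn hmaps hinj h1,
    (Set.ncard_le_ncard_of_injOn _ hmaps hinj h1).trans h2⟩

lemma Setup.ram_p_unique [Fact p.Prime] (S : Setup p N K L ζ α σ) (v w : HeightOneSpectrum (𝓞 L))
    (hv : v ∈ ram K L)
    (hv' : algebraMap (𝓞 K) (𝓞 L) (S.hζ.toInteger - 1) ∈ v.asIdeal)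
    (hw' : algebraMap (𝓞 K) (𝓞 L) (S.hζ.toInteger - 1) ∈ w.asIdeal) : v = w := by
  have := S.cyc
  have key : ∀ u : HeightOneSpectrum (𝓞 L),
      algebraMap (𝓞 K) (𝓞 L) (S.hζ.toInteger - 1) ∈ u.asIdeal →
      u.asIdeal.under (𝓞 K) = Ideal.span {S.hζ.toInteger - 1} := by
    intro u hu
    have hpr : (Ideal.span {S.hζ.toInteger - 1}).IsPrime :=
      (Ideal.span_singleton_prime S.hζ.zeta_sub_one_prime'.ne_zero).mpr S.hζ.zeta_sub_one_prime'
    have hmax : (Ideal.span {S.hζ.toInteger - 1}).IsMaximal := hpr.isMaximal (by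
      rw [Ne, Ideal.span_singleton_eq_bot]; exact S.hζ.zeta_sub_one_prime'.ne_zero)
    symm
    have := u.isPrime
    refine hmax.eq_of_le (inferInstance : (u.asIdeal.under (𝓞 K)).IsPrime).ne_top ?_
    rw [Ideal.span_singleton_le_iff_mem, Ideal.mem_comap]
    exact hu
  have hc := ((S.eDvd v.asIdeal v.isPrime).resolve_left hv).2
  obtain ⟨Q, hQ⟩ := Set.ncard_eq_one.mp hc
  have h1 : v.asIdeal ∈ (v.asIdeal.under (𝓞 K)).primesOver (𝓞 L) := ⟨v.isPrime, ⟨rfl⟩⟩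
  have h2 : w.asIdeal ∈ (v.asIdeal.under (𝓞 K)).primesOver (𝓞 L) :=
    ⟨w.isPrime, ⟨(key v hv').trans (key w hw').symm⟩⟩
  rw [hQ] at h1 h2
  exact HeightOneSpectrum.ext (h1.trans h2.symm)

lemma Setup.ram_card (S : Setup p N K L ζ α σ) : (ram K L).Finite ∧ (ram K L).ncard ≤ p := by
  have : Fact p.Prime := ⟨S.hp⟩
  obtain ⟨h1, h2⟩ := S.abv_card
  set B : Set (HeightOneSpectrum (𝓞 L)) :=
    {v | v ∈ ram K L ∧ algebraMap (𝓞 K) (𝓞 L) (S.hζ.toInteger - 1) ∈ v.asIdeal} with hB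
  have hsub : ram K L ⊆ abv N L ∪ B := by
    intro v hv
    rcases S.ram_mem v hv with h | h
    · exact Or.inl h
    · exact Or.inr ⟨hv, h⟩
  have hBs : B.Subsingleton := fun v hv w hw => S.ram_p_unique v w hv.1 hv.2 hw.2
  have hBf : B.Finite := hBs.finite
  have := hBf.to_subtype
  have hBc : B.ncard ≤ 1 := Set.ncard_le_one_iff_subsingleton.mpr hBs
  have hf := h1.union hBf
  refine ⟨hf.subset hsub, (Set.ncard_le_ncard hsub hf).trans ((Set.ncard_union_le _ _).trans ?_)⟩
  have := S.hp.two_le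
  omega

lemma Setup.exists_beta [Fact p.Prime] (S : Setup p N K L ζ α σ) (h2 : p ^ 2 ∣ N - 1) :
    ∃ b : 𝓞 L, algebraMap K L (ζ - 1) * (b : L) = α - 1 := by
  have := S.cyc
  set π : 𝓞 K := S.hζ.toInteger - 1 with hπ
  have hπ0 : π ≠ 0 := S.hζ.zeta_sub_one_prime'.ne_zero
  have hπp : π ^ (p - 1) ∣ (p : 𝓞 K) :=
    (IsCyclotomicExtension.Rat.associated_zeta_sub_one_pow_prime p S.hζ).dvd
  have hp3 := S.p3
  have hcoef : ∀ i : Fin p, ∃ c : 𝓞 K,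
      π ^ p * c = (p.choose i : 𝓞 K) * π ^ (i : ℕ) - (if (i : ℕ) = 0 then (N : 𝓞 K) else 0) := by
    intro i
    by_cases hi : (i : ℕ) = 0
    · rw [if_pos hi, hi]
      obtain ⟨m, hm⟩ := h2
      have hN' : (N : 𝓞 K) = 1 + p ^ 2 * m := by
        have : N = 1 + p ^ 2 * m := by have := S.hN.one_lt; omega
        rw [this]; push_cast; ring
      obtain ⟨c, hc⟩ := hπp
      refine ⟨-(π ^ (p - 2) * c ^ 2 * m), ?_⟩
      simp only [Nat.choose_zero_right, Nat.cast_one, pow_zero, mul_one]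
      rw [hN']
      have e : (p : 𝓞 K) ^ 2 = π ^ p * π ^ (p - 2) * c ^ 2 := by
        rw [hc, mul_pow, ← pow_mul, ← pow_add]
        congr 2
        omega
      rw [e]; ring
    · rw [if_neg hi, sub_zero]
      obtain ⟨m, hm⟩ := S.hp.dvd_choose_self hi i.2
      obtain ⟨c, hc⟩ := hπp
      refine ⟨c * m * π ^ ((i : ℕ) - 1), ?_⟩
      rw [hm]
      push_cast
      rw [hc]
      have e1 : π ^ p = π ^ (p - 1) * π := by rw [← pow_succ]; congr 1; omega
      have e2 : π ^ (i : ℕ) = π * π ^ ((i : ℕ) - 1) := by rw [← pow_succ']; congr 1; omega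
      rw [e1, e2]; ring
  choose c hc using hcoef
  set f : (𝓞 K)[X] := X ^ p + ∑ i : Fin p, C (c i) * X ^ (i : ℕ) with hf
  have hmon : f.Monic := monic_X_pow_add (degree_sum_fin_lt c)
  set πL : L := algebraMap K L (ζ - 1) with hπL
  have hππ : algebraMap (𝓞 K) L π = πL := by
    rw [IsScalarTower.algebraMap_apply (𝓞 K) K L]
    rfl
  have hπL0 : πL ≠ 0 := by
    rw [← hππ]
    intro h
    apply hπ0
    rw [IsScalarTower.algebraMap_apply (𝓞 K) K L] at h
    simpa using h
  have hIntg : IsIntegral (𝓞 K) ((α - 1) / πL) := by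
    refine ⟨f, hmon, ?_⟩
    set β := (α - 1) / πL with hβ
    have hα : α = πL * β + 1 := by rw [hβ]; field_simp; ring
    have h3 : πL ^ p * eval₂ (algebraMap (𝓞 K) L) β f = 0 := by
      rw [hf, eval₂_add, eval₂_finsetSum, mul_add, Finset.mul_sum]
      have h4 : ∀ i : Fin p, πL ^ p * eval₂ (algebraMap (𝓞 K) L) β (C (c i) * X ^ (i : ℕ)) =
          (πL * β) ^ (i : ℕ) * (p.choose i : L) - (if (i : ℕ) = 0 then (N : L) else 0) := by
        intro i
        have h5 := congrArg (algebraMap (𝓞 K) L) (hc i)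
        rw [map_sub, map_mul, map_mul, map_pow, map_pow, hππ, map_natCast] at h5
        rw [eval₂_mul, eval₂_C, eval₂_X_pow, ← mul_assoc, h5]
        by_cases hi : (i : ℕ) = 0
        · simp [hi]
        · simp [hi]; ring
      rw [Finset.sum_congr rfl (fun i _ => h4 i), Finset.sum_sub_distrib,
        Fin.sum_univ_eq_sum_range (fun i => (πL * β) ^ i * (p.choose i : L)) p,
        Fin.sum_univ_eq_sum_range (fun i => if i = 0 then (N : L) else 0) p]
      have h6 := add_pow (πL * β) 1 p
      rw [← hα, S.hα, Finset.sum_range_succ] at h6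
      simp only [one_pow, mul_one, Nat.choose_self, Nat.cast_one] at h6
      rw [Finset.sum_ite_eq' (Finset.range p) 0 (fun _ => (N : L)), if_pos (Finset.mem_range.mpr S.hp.pos), eval₂_X_pow, h6]
      ring
    exact (mul_eq_zero.mp h3).resolve_left (pow_ne_zero _ hπL0)
  have hIntg' : IsIntegral ℤ ((α - 1) / πL) := isIntegral_trans (R := ℤ) (A := 𝓞 K) _ hIntg
  refine ⟨⟨_, hIntg'⟩, ?_⟩
  change πL * ((α - 1) / πL) = _
  field_simp

lemma Setup.ram_card' (S : Setup p N K L ζ α σ) (h2 : p ^ 2 ∣ N - 1) :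
    (ram K L).ncard ≤ p - 1 := by
  have : Fact p.Prime := ⟨S.hp⟩
  obtain ⟨b, hb⟩ := S.exists_beta h2
  obtain ⟨a, ha, haN⟩ := S.exists_a
  obtain ⟨hf, hc⟩ := S.abv_card
  refine (Set.ncard_le_ncard ?_ hf).trans hc
  intro v hv
  have h := S.inertia_all v.asIdeal v.isPrime v.ne_bot hv b
  have hπ0 : algebraMap K L (ζ - 1) ≠ 0 := by
    rw [Ne, map_eq_zero, sub_eq_zero]
    exact S.hζ.ne_one S.hp.one_lt
  have h1 : σ • b - b = a := by
    ext
    change σ (b : L) - b = a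
    refine mul_left_cancel₀ hπ0 ?_
    have h3 := congrArg σ hb
    rw [map_mul, AlgEquiv.commutes, map_sub σ, map_one σ, S.hσα] at h3
    rw [mul_sub, h3, hb, ha, map_sub, map_one]
    ring
  rw [h1] at h
  change (N : 𝓞 L) ∈ v.asIdeal
  rw [← haN]
  exact Ideal.pow_mem_of_mem _ h _ S.hp.pos

end Amb

open NumberField Polynomial
open scoped nonZeroDivisors

namespace Amb

open UniqueFactorizationMonoid IsDedekindDomain
open scoped Pointwise

set_option linter.unusedSectionVars false

variable {p N : ℕ} {K L : Type} [Field K] [NumberField K] [Field L] [NumberField L]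
    [Algebra K L] {ζ : K} {α : L} {σ : L ≃ₐ[K] L}

lemma exists_frac {R : Type*} [CommRing R] [IsDomain R] [IsDedekindDomain R] (P : Ideal R)
    [hP : P.IsPrime] (hP0 : P ≠ ⊥) (x y : R) :
    ∃ a s : R, s ∉ P ∧ (x * a = y * s ∨ y * a = x * s) := by
  have : IsDiscreteValuationRing (Localization.AtPrime P) :=
    IsLocalization.AtPrime.isDiscreteValuationRing_of_dedekind_domain R hP0 _
  have hinj : Function.Injective (algebraMap R (Localization.AtPrime P)) :=
    IsLocalization.injective _ P.primeCompl_le_nonZeroDivisors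
  obtain ⟨c, hc⟩ := ValuationRing.cond (algebraMap R (Localization.AtPrime P) x)
    (algebraMap R (Localization.AtPrime P) y)
  obtain ⟨⟨a, s⟩, hs⟩ := IsLocalization.surj P.primeCompl c
  simp only at hs
  refine ⟨a, s, s.2, ?_⟩
  rcases hc with hc | hc
  · left
    apply hinj
    rw [map_mul, map_mul, ← hc, ← hs]; ring
  · right
    apply hinj
    rw [map_mul, map_mul, ← hc, ← hs]; ring

/-- The norm on integers -/
def nm (p : ℕ) (σ : L ≃ₐ[K] L) : 𝓞 L →* 𝓞 L where
  toFun x := ∏ i ∈ Finset.range p, (σ ^ i) • x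
  map_one' := by simp
  map_mul' x y := by simp [smul_mul', Finset.prod_mul_distrib]

lemma nm_apply (p : ℕ) (σ : L ≃ₐ[K] L) (x : 𝓞 L) : nm p σ x = ∏ i ∈ Finset.range p, (σ ^ i) • x := rfl

lemma nm_coe (p : ℕ) (σ : L ≃ₐ[K] L) (x : 𝓞 L) :
    ((nm p σ x : 𝓞 L) : L) = ∏ i ∈ Finset.range p, (σ ^ i) (x : L) := by
  rw [nm_apply]
  exact map_prod (algebraMap (𝓞 L) L) _ _

lemma nm_ne_zero (p : ℕ) (σ : L ≃ₐ[K] L) (x : 𝓞 L) (hx : x ≠ 0) : nm p σ x ≠ 0 := by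
  rw [nm_apply, Finset.prod_ne_zero_iff]
  intro i _
  rwa [Ne, smul_eq_zero_iff_eq]

lemma nm_mod (p : ℕ) (σ : L ≃ₐ[K] L) (P : Ideal (𝓞 L)) (h : ∀ x : 𝓞 L, σ • x - x ∈ P) (x : 𝓞 L) :
    Ideal.Quotient.mk P (nm p σ x) = Ideal.Quotient.mk P x ^ p := by
  have h1 : ∀ i, Ideal.Quotient.mk P ((σ ^ i) • x) = Ideal.Quotient.mk P x := by
    intro i
    induction i with
    | zero => simp
    | succ i ih =>
      rw [← ih, pow_succ', mul_smul, Ideal.Quotient.eq]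
      exact h _
  rw [nm_apply, map_prod, Finset.prod_congr rfl (fun i _ => h1 i), Finset.prod_const, Finset.card_range]

lemma Setup.abv_facts (S : Setup p N K L ζ α σ) (P : Ideal (𝓞 L)) [hP : P.IsPrime]
    (hN : (N : 𝓞 L) ∈ P) : P.ramificationIdx (𝓞 K) ≠ 1 ∧ Nat.card (𝓞 L ⧸ P) = N := by
  have := S.gal
  have := S.cyc
  have : Fact N.Prime := ⟨S.hN⟩
  have : NeZero p := ⟨S.hp.ne_zero⟩
  have hl := liesOver_of_mem S.hN P hP hN
  have hNp : ¬ N ∣ p := fun h => S.hNp ((Nat.prime_dvd_prime_iff_eq S.hN S.hp).mp h)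
  have hq : (P.under (𝓞 K)).LiesOver (Ideal.span {(N : ℤ)}) := by
    refine liesOver_of_mem S.hN _ inferInstance ?_
    rw [Ideal.mem_comap]; simpa using hN
  have hN0 : (N : 𝓞 L) ≠ 0 := by simpa using S.hN.ne_zero
  have h1 := IsCyclotomicExtension.Rat.ramificationIdx_eq_of_not_dvd N K (P.under (𝓞 K)) hNp
  have h2 := IsCyclotomicExtension.Rat.inertiaDeg_eq_of_not_dvd N K (P.under (𝓞 K)) hNp
  have h3 : (N : ZMod p) = 1 := by
    have := (ZMod.natCast_eq_natCast_iff N 1 p).mpr S.hmod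
    simpa using this
  rw [h3, orderOf_one] at h2
  have h4 := Ideal.ramificationIdx_tower (R := ℤ) (P.under (𝓞 K)) P
  rw [h1, one_mul] at h4
  have h5 := S.e_dvd P hP
  rw [h4] at h5
  have he : P.ramificationIdx (𝓞 K) ≠ 1 := by
    intro h
    rw [h] at h5
    exact S.hp.one_lt.ne' (Nat.dvd_one.mp h5)
  refine ⟨he, ?_⟩
  have h6 := Ideal.inertiaDeg_tower (R := ℤ) (P.under (𝓞 K)) P
  rw [h2, one_mul] at h6
  have h7 := Ideal.ncard_primesOver_mul_ramificationIdxIn_mul_inertiaDegIn (P.under (𝓞 K)) (𝓞 L)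
    (L ≃ₐ[K] L)
  rw [IsGalois.card_aut_eq_finrank, S.deg, Ideal.ramificationIdxIn_eq_ramificationIdx
    (P.under (𝓞 K)) P (L ≃ₐ[K] L), Ideal.inertiaDegIn_eq_inertiaDeg
    (P.under (𝓞 K)) P (L ≃ₐ[K] L)] at h7
  obtain ⟨h8, h9⟩ := (S.eDvd P hP).resolve_left he
  rw [h8, h9, one_mul] at h7
  have h10 : P.inertiaDeg (𝓞 K) = 1 := by
    refine Nat.eq_of_mul_eq_mul_left S.hp.pos ?_
    rw [h7, mul_one]
  rw [h10] at h6
  have hm : (Ideal.span {(N : ℤ)}).IsMaximal :=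
    PrincipalIdealRing.isMaximal_of_irreducible (Nat.prime_iff_prime_int.mp S.hN).irreducible
  have hPm : P.IsMaximal := hP.isMaximal (by
    rintro rfl
    exact hN0 (by simpa using hN))
  have h11 := Ideal.absNorm_eq_pow_inertiaDeg' P S.hN
  rw [Ideal.inertiaDeg'_eq_inertiaDeg, h6, pow_one] at h11
  rw [← h11]
  rfl

theorem Setup.not_norm (S : Setup p N K L ζ α σ) (h2 : ¬ p ^ 2 ∣ N - 1) (γ : Lˣ) :
    nu p (aU σ) γ ≠ S.z := by
  intro hγ
  have : Fact p.Prime := ⟨S.hp⟩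
  have := S.cyc
  -- a prime above `N`
  have hnu : ¬ IsUnit (N : 𝓞 L) := by
    intro h
    have h1 := (S.exists_a).choose_spec.2
    obtain ⟨hf, -⟩ := S.nprimes
    have h2 : Ideal.absNorm (Ideal.span {(N : 𝓞 L)}) = 1 := by
      rw [Ideal.span_singleton_eq_top.mpr h, Ideal.absNorm_top]
    rw [Ideal.absNorm_span_natCast] at h2
    have h3 : 0 < Module.finrank ℤ (𝓞 L) := Module.finrank_pos
    exact S.hN.one_lt.ne' ((Nat.pow_eq_one.mp h2).resolve_right h3.ne')
  obtain ⟨P, hPm, hNP⟩ := Ideal.exists_le_maximal (Ideal.span {(N : 𝓞 L)})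
    (by rwa [Ne, Ideal.span_singleton_eq_top])
  rw [Ideal.span_singleton_le_iff_mem] at hNP
  have hP : P.IsPrime := hPm.isPrime
  have hP0 : P ≠ ⊥ := by
    rintro rfl
    have : (N : 𝓞 L) = 0 := by simpa using hNP
    exact S.hN.ne_zero (by exact_mod_cast this)
  obtain ⟨he, hcard⟩ := S.abv_facts P hNP
  have hin := S.inertia_all P hP hP0 he
  set z : 𝓞 L := algebraMap (𝓞 K) (𝓞 L) S.hζ.toInteger with hz
  have hzp : z ^ p = 1 := by
    rw [hz, ← map_pow, S.hζ.toInteger_isPrimitiveRoot.pow_eq_one, map_one]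
  have hz1 : Ideal.Quotient.mk P z ≠ 1 := by
    intro h
    rw [← map_one (Ideal.Quotient.mk P), Ideal.Quotient.eq] at h
    have h3 : (p : 𝓞 L) ∈ P := by
      obtain ⟨c, hc⟩ := (dvd_pow_self (S.hζ.toInteger - 1) (Nat.sub_ne_zero_of_lt S.hp.one_lt)).trans
        (IsCyclotomicExtension.Rat.associated_zeta_sub_one_pow_prime p S.hζ).dvd
      have h4 := congrArg (algebraMap (𝓞 K) (𝓞 L)) hc
      rw [map_natCast, map_mul, map_sub, map_one] at h4
      rw [h4]
      exact P.mul_mem_right _ h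
    have hcop : IsCoprime (p : ℤ) (N : ℤ) := by
      rw [Nat.isCoprime_iff_coprime, Nat.coprime_primes S.hp S.hN]
      exact S.hNp.symm
    obtain ⟨u, w, huw⟩ := hcop
    have h4 := congrArg (Int.cast : ℤ → 𝓞 L) huw
    push_cast at h4
    exact hP.ne_top ((Ideal.eq_top_iff_one P).mpr (h4 ▸ P.add_mem (P.mul_mem_left _ h3) (P.mul_mem_left _ hNP)))
  obtain ⟨x, y, hy, hxy⟩ := IsFractionRing.div_surjective (A := 𝓞 L) (γ : L)
  have hy0 : y ≠ 0 := nonZeroDivisors.ne_zero hy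
  have hyL : (y : L) ≠ 0 := by simpa using hy0
  have hxyn : nm p σ x = z * nm p σ y := by
    ext
    have h3 := congrArg (fun u : Lˣ => (u : L)) hγ
    simp only [nu_val] at h3
    have h4 : (z : L) = ((S.z : Lˣ) : L) := rfl
    change _ = (z : L) * (nm p σ y : 𝓞 L)
    rw [h4, ← h3, nm_coe, nm_coe, ← Finset.prod_mul_distrib]
    refine Finset.prod_congr rfl fun i _ => ?_
    rw [← map_mul, ← hxy]
    congr 1
    exact (div_mul_cancel₀ _ hyL).symm
  obtain ⟨a, s, hs, has⟩ := exists_frac P hP0 x y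
  let : Field (𝓞 L ⧸ P) := Ideal.Quotient.field P
  have hs0 : Ideal.Quotient.mk P s ≠ 0 := by rwa [Ne, Ideal.Quotient.eq_zero_iff_mem]
  set Z := Ideal.Quotient.mk P z with hZ
  have hZp : Z ^ p = 1 := by rw [hZ, ← map_pow, hzp, map_one]
  have hZ0 : Z ≠ 0 := by
    intro h
    rw [h, zero_pow S.hp.ne_zero] at hZp
    exact zero_ne_one hZp
  set u := Ideal.Quotient.mk P a / Ideal.Quotient.mk P s with hu
  have hup : u ^ p ≠ 1 ∧ (u ^ p) ^ p = 1 := by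
    have hyn := nm_ne_zero p σ y hy0
    rcases has with h | h
    · have h3 := congrArg (nm p σ) h
      rw [map_mul, map_mul, hxyn] at h3
      have h4 : z * nm p σ a = nm p σ s := mul_left_cancel₀ hyn (by rw [← h3]; ring)
      have h5 := congrArg (Ideal.Quotient.mk P) h4
      rw [map_mul, nm_mod p σ P hin, nm_mod p σ P hin] at h5
      have h6 : u ^ p = Z⁻¹ := by
        rw [hu, div_pow, div_eq_iff (pow_ne_zero _ hs0), ← h5, inv_mul_cancel_left₀ hZ0]
      rw [h6]
      exact ⟨fun h => hz1 (inv_eq_one.mp h), by rw [inv_pow, hZp, inv_one]⟩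
    · have h3 := congrArg (nm p σ) h
      rw [map_mul, map_mul, hxyn] at h3
      have h4 : nm p σ a = z * nm p σ s := mul_left_cancel₀ hyn (by rw [h3]; ring)
      have h5 := congrArg (Ideal.Quotient.mk P) h4
      rw [map_mul, nm_mod p σ P hin, nm_mod p σ P hin] at h5
      have h6 : u ^ p = Z := by
        rw [hu, div_pow, div_eq_iff (pow_ne_zero _ hs0), ← h5]
      rw [h6]
      exact ⟨hz1, hZp⟩
  have hu0 : u ≠ 0 := by
    intro h
    rw [h, zero_pow S.hp.ne_zero, zero_pow S.hp.ne_zero] at hup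
    exact zero_ne_one hup.2
  have hord : orderOf (Units.mk0 u hu0) = p ^ (1 + 1) := by
    refine orderOf_eq_prime_pow ?_ ?_
    · intro h
      rw [pow_one] at h
      exact hup.1 (by simpa using congrArg (fun t : (𝓞 L ⧸ P)ˣ => (t : 𝓞 L ⧸ P)) h)
    · ext
      rw [Units.val_pow_eq_pow_val, Units.val_mk0, pow_succ, pow_one, pow_mul, hup.2, Units.val_one]
  have hdvd := orderOf_dvd_natCard (Units.mk0 u hu0)
  rw [hord, Nat.card_units, hcard] at hdvd
  exact h2 hdvd

lemma Setup.idx_ne (S : Setup p N K L ζ α σ) :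
    (nu p (aU σ)).range.relIndex ((dv L).ker ⊓ fixd (aU σ)) ≠ 0 :=
  fun h0 => S.units.2 (Nat.eq_zero_of_zero_dvd (h0 ▸ Subgroup.relIndex_dvd_of_le_left _ (by
    rintro _ ⟨x, -, rfl⟩
    exact ⟨x, rfl⟩)))

lemma Setup.idx_p (S : Setup p N K L ζ α σ) (h2 : ¬ p ^ 2 ∣ N - 1) :
    p ≤ (nu p (aU σ)).range.relIndex ((dv L).ker ⊓ fixd (aU σ)) := by
  have : Fact p.Prime := ⟨S.hp⟩
  set M := (dv L).ker ⊓ fixd (aU σ) with hM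
  set H := (nu p (aU σ)).range.subgroupOf M with hH
  have hne : H.index ≠ 0 := S.idx_ne
  change p ≤ H.index
  have hfin : Finite (M ⧸ H) := Nat.finite_of_card_ne_zero hne
  have hpg : IsPGroup p (M ⧸ H) := by
    intro g
    refine ⟨1, ?_⟩
    obtain ⟨x, rfl⟩ := QuotientGroup.mk_surjective g
    rw [pow_one, ← QuotientGroup.mk_pow, QuotientGroup.eq_one_iff, hH, Subgroup.mem_subgroupOf]
    exact ⟨x.1, nu_fixd p _ (mem_fixd.mp x.2.2)⟩
  obtain ⟨n, hn⟩ := IsPGroup.iff_card.mp hpg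
  change H.index = p ^ n at hn
  rw [hn]
  have hn0 : n ≠ 0 := by
    rintro rfl
    rw [pow_zero, Subgroup.index_eq_one] at hn
    have h3 : (⟨S.z, S.z_ker⟩ : M) ∈ H := by rw [hn]; trivial
    rw [hH, Subgroup.mem_subgroupOf] at h3
    obtain ⟨γ, hγ⟩ := h3
    exact S.not_norm h2 γ hγ
  exact Nat.le_self_pow hn0 p

theorem Setup.done (S : Setup p N K L ζ α σ) :
    (Nat.card {c : ClassGroup (𝓞 L) //
        (∀ σ : L ≃ₐ[K] L, ClassGroup.IsFixedBy (RingOfIntegers.mapRingEquiv σ) c) ∧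
        c ^ p = 1}).factorization p
      ≤ p - 2 := by
  have hp3 := S.p3
  obtain ⟨hf, hc⟩ := S.ram_card
  obtain ⟨hz, hz0⟩ := S.zbound hf
  by_cases h2 : p ^ 2 ∣ N - 1
  · refine S.final (p - 1) 0 (by omega) (hz.trans (Nat.pow_le_pow_right S.hp.pos (S.ram_card' h2))) hz0 ?_
    rw [pow_zero]
    exact Nat.one_le_iff_ne_zero.mpr S.idx_ne
  · refine S.final p 1 (by omega) (hz.trans (Nat.pow_le_pow_right S.hp.pos hc)) hz0 ?_
    rw [pow_one]
    exact S.idx_p h2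

end Amb

/-- Let `p` be a regular prime (odd, not dividing the class number of
`ℚ(ζ_p)`) and `N ≠ p` a prime with `N ≡ 1 (mod p)`; let `K = ℚ(ζ_p)`,
`L = ℚ(ζ_p, N^{1/p})` and `G = Gal(L/K)`.  Then `rk_p(Cl(L)^G) ≤ p - 2`. -/
theorem stmt5 (p N : ℕ) (hp : p.Prime) (hpodd : Odd p) (hN : N.Prime) (hNp : N ≠ p)
    (hmod : N ≡ 1 [MOD p])
    (K L : Type) [Field K] [NumberField K] [Field L] [NumberField L] [Algebra K L]
    (ζ : K) (hζ : IsPrimitiveRoot ζ p)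
    (hKgen : Algebra.adjoin ℚ {ζ} = (⊤ : Subalgebra ℚ K))
    (hreg : ¬ p ∣ Nat.card (ClassGroup (𝓞 K)))
    (α : L) (hα : α ^ p = (N : L))
    (hLgen : Algebra.adjoin K {α} = (⊤ : Subalgebra K L)) :
    (Nat.card {c : ClassGroup (𝓞 L) //
        (∀ σ : L ≃ₐ[K] L, ClassGroup.IsFixedBy (RingOfIntegers.mapRingEquiv σ) c) ∧
        c ^ p = 1}).factorization p
      ≤ p - 2 := by
  obtain ⟨σ, S⟩ := Amb.exists_setup p N hp hpodd hN hNp hmod K L ζ hζ hKgen hreg α hα hLgen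
  exact S.done
end
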